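/- Let k be an even integer ≥ 2 and r ≥ 1 an integer. Every zero in H of the r-th derivative E_k^{(r)} of E_k is simple: if z ∈ H and E_k^{(r)}(z) = 0, then E_k^{(r+1)}(z) ≠ 0. -/

import Mathlib

/-- The normalized Eisenstein series of even weight `k ≥ 4` (the definition also
makes sense for `k = 2`, giving the quasi-modular Eisenstein series `E₂`), defined by
its Fourier expansion `E_k(z) = 1 - (2k/B_k) ∑_{n≥1} σ_{k-1}(n) qⁿ`, `q = exp(2πiz)`. -/
noncomputable def Ek (k : ℕ) (z : ℂ) : ℂ :=
  1 - (2 * (k : ℂ) / ((bernoulli k : ℚ) : ℂ)) *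
    ∑' n : ℕ, (∑ d ∈ n.divisors, (d : ℂ) ^ (k - 1)) * Complex.exp (2 * Real.pi * Complex.I * z) ^ n

section

open MvPolynomial in
/-- Ramanujan's derivation on `ℚ[E₂, E₄, E₆]`. -/
noncomputable def ramanujanD :
    Derivation ℚ (MvPolynomial (Fin 3) ℚ) (MvPolynomial (Fin 3) ℚ) :=
  mkDerivation ℚ ![C (1 / 12) * (X 0 ^ 2 - X 1), C (1 / 3) * (X 0 * X 1 - X 2),
    C (1 / 2) * (X 0 * X 2 - X 1 ^ 2)]

namespace RamanujanD
open MvPolynomial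

local notation "QM" => MvPolynomial (Fin 3) ℚ

@[simp] lemma D_X0 : ramanujanD (X 0) = C (1 / 12) * (X 0 ^ 2 - X 1) := mkDerivation_X ..
@[simp] lemma D_X1 : ramanujanD (X 1) = C (1 / 3) * (X 0 * X 1 - X 2) := mkDerivation_X ..
@[simp] lemma D_X2 : ramanujanD (X 2) = C (1 / 2) * (X 0 * X 2 - X 1 ^ 2) := mkDerivation_X ..

/-- Half the modular weights of `E₂`, `E₄`, `E₆`. -/
def wt : Fin 3 → ℕ := ![1, 2, 3]

lemma aeval_smul_wt {A : Type*} [CommRing A] [Algebra ℚ A] {P : QM} {w : ℕ}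
    (h : P.IsWeightedHomogeneous wt w) (v : Fin 3 → A) (s : A) :
    aeval (fun i => s ^ wt i * v i) P = s ^ w * aeval v P := by
  induction h using IsWeightedHomogeneous.induction_on with
  | zero => simp
  | add p q hp hq ihp ihq => simp [ihp, ihq, mul_add]
  | monomial d r hr =>
    have : Finsupp.weight wt d = d 0 + 2 * d 1 + 3 * d 2 := by
      simp [Finsupp.weight_apply, Finsupp.sum_fintype, Fin.sum_univ_three, wt]
      ring
    rw [this] at hr
    simp only [aeval_monomial, Finsupp.prod_pow, Fin.prod_univ_three, ← hr, wt]
    simp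
    ring

lemma D_C_mul (a : ℚ) (P : QM) : ramanujanD (C a * P) = C a * ramanujanD P := by
  rw [← smul_eq_C_mul, Derivation.map_smul, smul_eq_C_mul]

lemma D_monomial (d : Fin 3 →₀ ℕ) :
    (ramanujanD (monomial d 1)).IsWeightedHomogeneous wt (Finsupp.weight wt d + 1) := by
  have hX : ∀ i, (X i : QM).IsWeightedHomogeneous wt (wt i) := isWeightedHomogeneous_X ℚ wt
  have hDX : ∀ i, (ramanujanD (X i)).IsWeightedHomogeneous wt (wt i + 1) := by
    intro i
    fin_cases i
    · exact D_X0 ▸ (((hX 0).pow 2).sub (hX 1)).C_mul _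
    · exact D_X1 ▸ (((hX 0).mul (hX 1)).sub (hX 2)).C_mul _
    · exact D_X2 ▸ (((hX 0).mul (hX 2)).sub ((hX 1).pow 2)).C_mul _
  have hmon : ∀ d : Fin 3 →₀ ℕ, (monomial d (1 : ℚ)).IsWeightedHomogeneous wt
      (Finsupp.weight wt d) := fun d => isWeightedHomogeneous_monomial wt d 1 rfl
  induction d using Finsupp.induction_linear with
  | zero => simp [monomial_zero', isWeightedHomogeneous_zero]
  | add f g hf hg =>
    have : monomial (f + g) (1 : ℚ) = monomial f 1 * monomial g 1 := by simp [monomial_mul]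
    rw [this, Derivation.leibniz, map_add]
    refine IsWeightedHomogeneous.add ?_ ?_
    · rw [smul_eq_mul, add_assoc]
      exact (hmon f).mul hg
    · rw [smul_eq_mul, add_comm (Finsupp.weight wt f), add_assoc]
      exact (hmon g).mul hf
  | single i n =>
    have h1 : monomial (Finsupp.single i n) (1 : ℚ) = X i ^ n := by
      rw [X_pow_eq_monomial]
    rw [h1, Derivation.leibniz_pow, Finsupp.weight_single]
    rcases n with _ | n
    · simp [isWeightedHomogeneous_zero]
    · rw [nsmul_eq_mul, ← map_natCast (C : ℚ →+* QM), smul_eq_mul]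
      refine IsWeightedHomogeneous.C_mul ?_ _
      have := ((hX i).pow n).mul (hDX i)
      rw [succ_nsmul, add_assoc, Nat.add_sub_cancel, smul_eq_mul]
      exact this

lemma weight_D {P : QM} {w : ℕ}
    (h : P.IsWeightedHomogeneous wt w) : (ramanujanD P).IsWeightedHomogeneous wt (w + 1) := by
  induction h using IsWeightedHomogeneous.induction_on with
  | zero => simp [isWeightedHomogeneous_zero]
  | add p q hp hq ihp ihq => rw [map_add]; exact ihp.add ihq
  | monomial d r hr =>
    have : monomial d r = C r * monomial d 1 := by simp [C_mul_monomial]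
    rw [this, D_C_mul, ← hr]
    exact (D_monomial d).C_mul _

lemma weight_iterate_D {P : QM} {w : ℕ} (h : P.IsWeightedHomogeneous wt w) (n : ℕ) :
    (ramanujanD^[n] P).IsWeightedHomogeneous wt (w + n) := by
  induction n with
  | zero => simpa using h
  | succ n ih => rw [Function.iterate_succ_apply', ← add_assoc]; exact weight_D ih

/-- The commutator of `∂/∂E₂` and `D` is a multiple of the Euler operator. -/
lemma pderiv_D (P : QM) : pderiv 0 (ramanujanD P) = ramanujanD (pderiv 0 P) +
    C (1 / 6) * ∑ i, (wt i : QM) * (X i * pderiv i P) := by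
  rw [Fin.sum_univ_three]
  have h12 : (C (6⁻¹ : ℚ) : QM) = 2 * C 12⁻¹ := by
    rw [← map_ofNat (C : ℚ →+* QM) 2, ← C_mul]; norm_num
  have h3 : (C (6⁻¹ : ℚ) : QM) * 2 = C 3⁻¹ := by
    rw [← map_ofNat (C : ℚ →+* QM) 2, ← C_mul]; norm_num
  have h4 : (C (6⁻¹ : ℚ) : QM) * 3 = C 2⁻¹ := by
    rw [← map_ofNat (C : ℚ →+* QM) 3, ← C_mul]; norm_num
  induction P using MvPolynomial.induction_on with
  | C a => simp [derivation_C]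
  | add p q hp hq => simp only [map_add, hp, hq]; ring
  | mul_X p i hp =>
    rw [Derivation.leibniz, map_add, smul_eq_mul, smul_eq_mul, pderiv_mul, pderiv_mul, hp]
    fin_cases i
    · simp [pderiv_X, wt]
      linear_combination (-p * X 0) * h12
    · simp [pderiv_X, wt]
      linear_combination (-p * X 1) * h3
    · simp [pderiv_X, wt]
      linear_combination (-p * X 2) * h4

/-- The Appell property: on iterated derivatives, `∂/∂E₂` lowers the order. -/
lemma pderiv_iterate_D {P : QM} {w : ℕ} (h : P.IsWeightedHomogeneous wt w)
    (h0 : ramanujanD (pderiv 0 P) = 0) (n : ℕ) :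
    pderiv 0 (ramanujanD^[n + 1] P) =
      C ((n + 1) * (2 * w + n) / 12 : ℚ) * ramanujanD^[n] P := by
  have euler : ∀ n, C (1 / 6) * ∑ i, (wt i : QM) * (X i * pderiv i (ramanujanD^[n] P)) =
      C ((w + n) / 6 : ℚ) * ramanujanD^[n] P := by
    intro n
    have := (weight_iterate_D h n).sum_weight_X_mul_pderiv
    simp only [nsmul_eq_mul] at this
    rw [this, ← map_natCast (C : ℚ →+* QM), ← mul_assoc, ← C_mul]
    congr 2; push_cast; ring
  induction n with
  | zero =>
    rw [Function.iterate_succ_apply', pderiv_D, euler]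
    simp only [Function.iterate_zero, id, h0, zero_add]
    congr 2; push_cast; ring
  | succ n ih =>
    rw [Function.iterate_succ_apply', pderiv_D, euler, ih, D_C_mul,
      ← Function.iterate_succ_apply' (f := ramanujanD), ← add_mul, ← C_add]
    congr 2; push_cast; ring

/-- An element of `ℚ[E₂, E₄, E₆]` as a polynomial in `E₂`, with `E₄`, `E₆` specialised. -/
noncomputable def toPoly {A : Type*} [CommRing A] [Algebra ℚ A] (b c : A) :
    QM →ₐ[ℚ] Polynomial A :=
  aeval ![Polynomial.X, Polynomial.C b, Polynomial.C c]

section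
variable {A : Type*} [CommRing A] [Algebra ℚ A]

lemma toPoly_C (b c : A) (a : ℚ) : toPoly b c (C a) = Polynomial.C (algebraMap ℚ A a) := by
  rw [toPoly, aeval_C, Polynomial.algebraMap_apply]

lemma eval_toPoly (b c x : A) (P : QM) :
    (toPoly b c P).eval x = aeval ![x, b, c] P := by
  induction P using MvPolynomial.induction_on with
  | C a => rw [toPoly_C, Polynomial.eval_C, aeval_C]
  | add p q hp hq => simp [hp, hq]
  | mul_X p i hp => fin_cases i <;> simp [hp] <;> simp [toPoly]

lemma derivative_toPoly (b c : A) (P : QM) :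
    (toPoly b c P).derivative = toPoly b c (pderiv 0 P) := by
  induction P using MvPolynomial.induction_on with
  | C a => rw [toPoly_C, Polynomial.derivative_C, pderiv_C, map_zero]
  | add p q hp hq => simp [hp, hq]
  | mul_X p i hp =>
    fin_cases i <;> simp [hp, pderiv_X] <;> simp [toPoly, mul_comm, add_comm]

lemma map_toPoly {B : Type*} [CommRing B] [Algebra ℚ B] (φ : A →ₐ[ℚ] B) (b c : A) (P : QM) :
    (toPoly b c P).map (φ : A →+* B) = toPoly (φ b) (φ c) P := by
  induction P using MvPolynomial.induction_on with
  | C a =>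
    rw [toPoly_C, toPoly_C, Polynomial.map_C]
    exact congrArg Polynomial.C (φ.commutes a)
  | add p q hp hq => simp [hp, hq]
  | mul_X p i hp =>
    fin_cases i <;> simp [hp] <;> simp [toPoly]

end

end RamanujanD

end

section

open Finset in
/-- A perturbation of `κ Yⁿ` by small lower order terms of comparable size has no double root. -/
lemma no_double_root_of_small {n : ℕ} (hn : 1 ≤ n) (α : ℂ) (κ : ℕ → ℂ) (hκ0 : κ 0 ≠ 0)
    (hκn : κ n ≠ 0) {B β : ℝ} (hβ : 0 < β) :
    ∃ δ > 0, ∀ (e : ℕ → ℂ) (ρ : ℝ), 0 < ρ → ρ < δ → 1 / 2 ≤ ‖e 0‖ →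
      (∀ j, 1 ≤ j → j ≤ n → ‖e j‖ ≤ B * ρ) → β * ρ ≤ ‖e n‖ → ∀ Y : ℂ,
      α * Y ^ (n + 1) + κ n * e 0 * Y ^ n + ∑ m ∈ range n, κ m * e (n - m) * Y ^ m = 0 →
      (n + 1) * α * Y ^ (n + 1) + n * κ n * e 0 * Y ^ n +
        ∑ m ∈ range n, m * κ m * e (n - m) * Y ^ m ≠ 0 := by
  set S : ℝ := ∑ m ∈ range n, (n + 1) * ‖κ m‖ * |B| with hS
  have hS0 : 0 ≤ S := by positivity
  have hκn' : 0 < ‖κ n‖ := norm_pos_iff.2 hκn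
  have hκ0' : 0 < ‖κ 0‖ := norm_pos_iff.2 hκ0
  set U : ℝ := 2 * S / ‖κ n‖ with hU
  have hU0 : 0 ≤ U := by positivity
  set V : ℝ := ‖α‖ * U + S with hV
  have hV0 : 0 ≤ V := by positivity
  set y : ℝ := β * ‖κ 0‖ / (V + 1) with hy
  have hy0 : 0 < y := by positivity
  refine ⟨min (1 / (U + 1)) (y ^ n / (U + 1)), by positivity, ?_⟩
  intro e ρ hρ hρδ he0 he hen Y h1 h2
  have hρ1 : ρ * (U + 1) < 1 := by
    rw [← lt_div_iff₀ (by positivity)]; exact hρδ.trans_le (min_le_left _ _)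
  have hρ2 : ρ * (U + 1) < y ^ n := by
    rw [← lt_div_iff₀ (by positivity)]; exact hρδ.trans_le (min_le_right _ _)
  have hBρ : ∀ j, 1 ≤ j → j ≤ n → ‖e j‖ ≤ |B| * ρ := fun j h1 h2 =>
    (he j h1 h2).trans (by gcongr; exact le_abs_self B)
  -- eliminate the top term
  have e1 : κ n * e 0 * Y ^ n = - ∑ m ∈ range n, ((n + 1 - m : ℝ) : ℂ) * κ m * e (n - m) * Y ^ m := by
    have : ∑ m ∈ range n, ((n + 1 - m : ℝ) : ℂ) * κ m * e (n - m) * Y ^ m =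
        (n + 1) * ∑ m ∈ range n, κ m * e (n - m) * Y ^ m -
        ∑ m ∈ range n, m * κ m * e (n - m) * Y ^ m := by
      rw [mul_sum, ← sum_sub_distrib]
      refine sum_congr rfl fun m _ => ?_
      push_cast; ring
    rw [this]
    linear_combination (n + 1 : ℂ) * h1 - h2
  have bound : ∀ Z : ℝ, (∀ m < n, ‖Y‖ ^ m ≤ Z) → 0 ≤ Z → ‖κ n‖ / 2 * ‖Y‖ ^ n ≤ S * ρ * Z := by
    intro Z hZ hZ0
    calc ‖κ n‖ / 2 * ‖Y‖ ^ n ≤ ‖κ n‖ * ‖e 0‖ * ‖Y‖ ^ n := by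
          have : ‖κ n‖ / 2 ≤ ‖κ n‖ * ‖e 0‖ := by nlinarith
          gcongr
      _ = ‖κ n * e 0 * Y ^ n‖ := by simp
      _ ≤ ∑ m ∈ range n, ‖((n + 1 - m : ℝ) : ℂ) * κ m * e (n - m) * Y ^ m‖ := by
          rw [e1, norm_neg]; exact norm_sum_le _ _
      _ ≤ ∑ m ∈ range n, (n + 1) * ‖κ m‖ * |B| * (ρ * Z) := by
          refine sum_le_sum fun m hm => ?_
          have hm := mem_range.1 hm
          have hm' : (m : ℝ) ≤ n := by exact_mod_cast hm.le
          rw [norm_mul, norm_mul, norm_mul, norm_pow, Complex.norm_real, Real.norm_eq_abs,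
            abs_of_nonneg (by linarith)]
          have h3 : ((n : ℝ) + 1 - m) ≤ n + 1 := by simp
          have h4 := hBρ (n - m) (by omega) (by omega)
          have h5 := hZ m hm
          calc _ ≤ ((n : ℝ) + 1) * ‖κ m‖ * (|B| * ρ) * Z := by gcongr
            _ = _ := by ring
      _ = S * ρ * Z := by rw [← sum_mul, hS]; ring
  have hY1 : ‖Y‖ < 1 := by
    by_contra! hY
    have := bound (‖Y‖ ^ n) (fun m hm => pow_le_pow_right₀ hY hm.le) (by positivity)
    have hp : 0 < ‖Y‖ ^ n := by positivity
    have h3 : ‖κ n‖ / 2 ≤ S * ρ := le_of_mul_le_mul_right this hp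
    have h4 : S = U * ‖κ n‖ / 2 := by rw [hU]; field_simp
    rw [h4] at h3
    nlinarith
  have hYn : ‖Y‖ ^ n ≤ U * ρ := by
    have := bound 1 (fun m hm => pow_le_one₀ (norm_nonneg _) hY1.le) zero_le_one
    rw [hU, div_mul_eq_mul_div, le_div_iff₀ hκn']
    linarith
  have hYy : ‖Y‖ < y := by
    refine lt_of_pow_lt_pow_left₀ n hy0.le (hYn.trans_lt ?_)
    nlinarith
  -- eliminate `Yⁿ`
  have e2 : n * (κ 0 * e n) = α * Y ^ (n + 1) -
      ∑ m ∈ range (n - 1), ((n - (m + 1) : ℝ) : ℂ) * κ (m + 1) * e (n - (m + 1)) * Y ^ (m + 1) := by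
    obtain ⟨N, rfl⟩ : ∃ N, n = N + 1 := ⟨n - 1, by omega⟩
    have : ∑ m ∈ range (N + 1), (((N + 1 : ℕ) - m : ℝ) : ℂ) * κ m * e (N + 1 - m) * Y ^ m =
        (N + 1 : ℕ) * ∑ m ∈ range (N + 1), κ m * e (N + 1 - m) * Y ^ m -
        ∑ m ∈ range (N + 1), m * κ m * e (N + 1 - m) * Y ^ m := by
      rw [mul_sum, ← sum_sub_distrib]
      refine sum_congr rfl fun m _ => ?_
      push_cast; ring
    rw [sum_range_succ'] at this
    simp only [Nat.add_sub_cancel]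
    push_cast at this ⊢
    simp only [pow_zero, mul_one, sub_zero] at this
    push_cast at h1 h2
    linear_combination this + (N + 1 : ℂ) * h1 - h2
  have hn' : (1 : ℝ) ≤ n := by exact_mod_cast hn
  have hlow : β * ρ * ‖κ 0‖ ≤ ‖n * (κ 0 * e n)‖ := by
    rw [norm_mul, norm_mul, Complex.norm_natCast]
    calc β * ρ * ‖κ 0‖ ≤ ‖e n‖ * ‖κ 0‖ := by gcongr
      _ ≤ n * (‖κ 0‖ * ‖e n‖) := by
        have : 0 ≤ ‖e n‖ * ‖κ 0‖ := by positivity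
        nlinarith
  have hup : ‖n * (κ 0 * e n)‖ ≤ V * ρ * ‖Y‖ := by
    rw [e2]
    refine (norm_sub_le _ _).trans ?_
    have t1 : ‖α * Y ^ (n + 1)‖ ≤ ‖α‖ * U * ρ * ‖Y‖ := by
      rw [norm_mul, norm_pow, pow_succ]
      calc ‖α‖ * (‖Y‖ ^ n * ‖Y‖) ≤ ‖α‖ * (U * ρ * ‖Y‖) := by gcongr
        _ = _ := by ring
    have t2 : ‖∑ m ∈ range (n - 1), ((n - (m + 1) : ℝ) : ℂ) * κ (m + 1) * e (n - (m + 1)) *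
        Y ^ (m + 1)‖ ≤ S * ρ * ‖Y‖ := by
      refine (norm_sum_le _ _).trans ?_
      calc _ ≤ ∑ m ∈ range (n - 1), (n + 1) * ‖κ (m + 1)‖ * |B| * (ρ * ‖Y‖) := by
            refine sum_le_sum fun m hm => ?_
            have hm := mem_range.1 hm
            have hm' : (m : ℝ) + 1 ≤ n := by exact_mod_cast (by omega : m + 1 ≤ n)
            rw [norm_mul, norm_mul, norm_mul, norm_pow, Complex.norm_real, Real.norm_eq_abs,
              abs_of_nonneg (by linarith)]
            have h3 : ((n : ℝ) - (m + 1)) ≤ n + 1 := by linarith [(m.cast_nonneg : (0 : ℝ) ≤ m)]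
            have h4 := hBρ (n - (m + 1)) (by omega) (by omega)
            have h5 : ‖Y‖ ^ (m + 1) ≤ ‖Y‖ := pow_le_of_le_one (norm_nonneg _) hY1.le (by omega)
            calc _ ≤ ((n : ℝ) + 1) * ‖κ (m + 1)‖ * (|B| * ρ) * ‖Y‖ := by gcongr
              _ = _ := by ring
        _ = (∑ m ∈ range (n - 1), (n + 1) * ‖κ (m + 1)‖ * |B|) * (ρ * ‖Y‖) := by rw [sum_mul]
        _ ≤ S * (ρ * ‖Y‖) := by
            gcongr
            obtain ⟨N, rfl⟩ : ∃ N, n = N + 1 := ⟨n - 1, by omega⟩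
            rw [hS, sum_range_succ', Nat.add_sub_cancel]
            have : 0 ≤ (((N + 1 : ℕ) : ℝ) + 1) * ‖κ 0‖ * |B| := by positivity
            linarith
        _ = _ := by ring
    rw [hV]
    linarith
  have hfin : β * ‖κ 0‖ ≤ V * ‖Y‖ := by
    have := hlow.trans hup
    refine le_of_mul_le_mul_right (a := ρ) ?_ hρ
    linarith
  have : (V + 1) * y = β * ‖κ 0‖ := by rw [hy]; field_simp
  nlinarith [norm_nonneg Y]

end

section

namespace RamanujanD
open MvPolynomial Finset

local notation "QM" => MvPolynomial (Fin 3) ℚ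

lemma iterate_derivative_toPoly {P : QM} {w : ℕ} (h : P.IsWeightedHomogeneous wt w)
    (h0 : ramanujanD (pderiv 0 P) = 0) (b c : ℂ) (n m : ℕ) :
    Polynomial.derivative^[m] (toPoly b c (ramanujanD^[n + m] P)) =
      Polynomial.C (((∏ i ∈ range m, ((n + i + 1) * (2 * w + n + i) / 12) : ℚ)) : ℂ) *
        toPoly b c (ramanujanD^[n] P) := by
  induction m with
  | zero => simp
  | succ m ih =>
    rw [Function.iterate_succ_apply, derivative_toPoly, ← add_assoc, pderiv_iterate_D h h0,
      map_mul, toPoly_C, Polynomial.iterate_derivative_C_mul, ih, prod_range_succ, ← mul_assoc,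
      ← Polynomial.C_mul]
    congr 2
    simp only [eq_ratCast]
    push_cast
    ring

lemma eval_iterate_derivative (p : Polynomial ℂ) (a : ℂ) (m : ℕ) :
    (Polynomial.derivative^[m] p).eval a =
      m.factorial * (Polynomial.taylor a p).coeff m := by
  rw [← Polynomial.factorial_smul_hasseDeriv, LinearMap.smul_apply, Polynomial.eval_smul,
    Polynomial.taylor_coeff, nsmul_eq_mul]

lemma taylor_coeff_toPoly {P : QM} {w : ℕ} (h : P.IsWeightedHomogeneous wt w)
    (h0 : ramanujanD (pderiv 0 P) = 0) (a b c : ℂ) (n m : ℕ) :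
    (Polynomial.taylor a (toPoly b c (ramanujanD^[n + m] P))).coeff m =
      (((∏ i ∈ range m, ((n + i + 1) * (2 * w + n + i) / 12) : ℚ) / m.factorial : ℚ) : ℂ) *
        aeval ![a, b, c] (ramanujanD^[n] P) := by
  have hm : (m.factorial : ℂ) ≠ 0 := by exact_mod_cast m.factorial_ne_zero
  have := congrArg (Polynomial.eval a) (iterate_derivative_toPoly h h0 b c n m)
  rw [eval_iterate_derivative, Polynomial.eval_mul, Polynomial.eval_C, eval_toPoly] at this
  push_cast at this ⊢
  rw [div_mul_eq_mul_div, eq_div_iff hm, mul_comm, this]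

lemma natDegree_toPoly_le {P : QM} {w : ℕ} (h : P.IsWeightedHomogeneous wt w) {ε : ℚ}
    (h0 : pderiv 0 P = C ε) (b c : ℂ) (n : ℕ) :
    (toPoly b c (ramanujanD^[n] P)).natDegree ≤ n + 1 := by
  induction n with
  | zero =>
    have : (toPoly b c P).derivative = Polynomial.C (algebraMap ℚ ℂ ε) := by
      rw [derivative_toPoly, h0, toPoly_C]
    have h1 := Polynomial.natDegree_derivative (toPoly b c P)
    rw [this, Polynomial.natDegree_C] at h1
    simpa using (by omega : (toPoly b c P).natDegree ≤ 1)
  | succ n ih =>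
    have h1 := Polynomial.natDegree_derivative (toPoly b c (ramanujanD^[n + 1] P))
    rw [derivative_toPoly, pderiv_iterate_D h (by rw [h0, derivation_C]), map_mul, toPoly_C] at h1
    have := Polynomial.natDegree_C_mul_le (algebraMap ℚ ℂ ((n + 1) * (2 * w + n) / 12))
      (toPoly b c (ramanujanD^[n] P))
    omega

lemma taylor_coeff_top {P : QM} {w : ℕ} (h : P.IsWeightedHomogeneous wt w) {ε : ℚ}
    (h0 : pderiv 0 P = C ε) (a b c : ℂ) (n : ℕ) :
    (Polynomial.taylor a (toPoly b c (ramanujanD^[n] P))).coeff (n + 1) =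
      (((∏ i ∈ range n, ((i + 1) * (2 * w + i) / 12) : ℚ) * ε / (n + 1).factorial : ℚ) : ℂ) := by
  have hm : ((n + 1).factorial : ℂ) ≠ 0 := by exact_mod_cast (n + 1).factorial_ne_zero
  have h1 := iterate_derivative_toPoly h (by rw [h0, derivation_C]) b c 0 n
  rw [zero_add] at h1
  have := congrArg (fun p => Polynomial.eval a (Polynomial.derivative p)) h1
  rw [← Function.iterate_succ_apply' (f := Polynomial.derivative),
    eval_iterate_derivative, Polynomial.derivative_C_mul,
    Function.iterate_zero, id, derivative_toPoly, h0, toPoly_C] at this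
  simp only [Polynomial.eval_mul, Polynomial.eval_C, Nat.cast_zero, zero_add, add_zero, eq_ratCast] at this
  push_cast at this ⊢
  rw [eq_div_iff (by exact_mod_cast hm), mul_comm, this]

/-- The coefficients of the Taylor expansion of `Dⁿ P` in the variable `E₂`. -/
noncomputable def taylorCoeff (w n m : ℕ) : ℚ :=
  (∏ i ∈ range m, (((n - m : ℕ) + i + 1) * (2 * w + (n - m : ℕ) + i) / 12) : ℚ) / m.factorial

lemma taylorCoeff_ne_zero {w : ℕ} (hw : 1 ≤ w) (n m : ℕ) : taylorCoeff w n m ≠ 0 := by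
  have : 0 < taylorCoeff w n m := by
    have : (1 : ℚ) ≤ w := by exact_mod_cast hw
    unfold taylorCoeff
    positivity
  exact this.ne'

lemma sum_coeff_taylor {P : QM} {w : ℕ} (h : P.IsWeightedHomogeneous wt w) {ε : ℚ}
    (h0 : pderiv 0 P = C ε) (n : ℕ) : ∃ α : ℂ, ∀ (a b c : ℂ) (g : ℕ → ℂ → ℂ), (∀ m, g m 0 = 0) →
    (Polynomial.taylor a (toPoly b c (ramanujanD^[n] P))).sum g = g (n + 1) α +
      g n (taylorCoeff w n n * aeval ![a, b, c] P) +
      ∑ m ∈ range n, g m (taylorCoeff w n m * aeval ![a, b, c] (ramanujanD^[n - m] P)) := by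
  refine ⟨(((∏ i ∈ range n, ((i + 1) * (2 * w + i) / 12) : ℚ) * ε / (n + 1).factorial : ℚ) : ℂ),
    fun a b c g hg => ?_⟩
  rw [Polynomial.sum_over_range' _ hg (n + 2), sum_range_succ, taylor_coeff_top h h0,
    sum_range_succ]
  · have key : ∀ m ≤ n, (Polynomial.taylor a (toPoly b c (ramanujanD^[n] P))).coeff m =
        taylorCoeff w n m * aeval ![a, b, c] (ramanujanD^[n - m] P) := by
      intro m hm
      have := taylor_coeff_toPoly h (by rw [h0, derivation_C]) a b c (n - m) m
      rwa [Nat.sub_add_cancel hm] at this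
    rw [key n le_rfl, Nat.sub_self, Function.iterate_zero, id,
      sum_congr rfl fun m hm => by rw [key m (mem_range.1 hm).le]]
    ring
  · rw [Polynomial.natDegree_taylor]
    exact (natDegree_toPoly_le h h0 b c n).trans_lt (by omega)

/-- Along a degeneration to the cusp, `Dⁿ P` has no double root in the variable `E₂`. -/
lemma eventually_no_double_root {P : QM} {w : ℕ} (hw : 1 ≤ w) (h : P.IsWeightedHomogeneous wt w)
    {ε : ℚ} (h0 : pderiv 0 P = C ε) {n : ℕ} (hn : 1 ≤ n) {B β : ℝ} (hβ : 0 < β) :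
    ∃ δ > 0, ∀ (a b c : ℂ) (ρ : ℝ), 0 < ρ → ρ < δ → 1 / 2 ≤ ‖aeval ![a, b, c] P‖ →
      (∀ j, 1 ≤ j → j ≤ n → ‖aeval ![a, b, c] (ramanujanD^[j] P)‖ ≤ B * ρ) →
      β * ρ ≤ ‖aeval ![a, b, c] (ramanujanD^[n] P)‖ → ∀ x : ℂ,
      (toPoly b c (ramanujanD^[n] P)).eval x = 0 →
      (toPoly b c (ramanujanD^[n] P)).derivative.eval x ≠ 0 := by
  obtain ⟨α, hα⟩ := sum_coeff_taylor h h0 n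
  obtain ⟨δ, hδ, H⟩ := no_double_root_of_small (n := n) hn α (fun m => (taylorCoeff w n m : ℂ))
    (by exact_mod_cast taylorCoeff_ne_zero hw n 0) (by exact_mod_cast taylorCoeff_ne_zero hw n n)
    (B := B) hβ
  refine ⟨δ, hδ, fun a b c ρ hρ hρδ he0 he hen x hx hx' => ?_⟩
  refine H (fun j => aeval ![a, b, c] (ramanujanD^[j] P)) ρ hρ hρδ he0 he hen (x - a) ?_ ?_
  · have := hα a b c (fun m z => z * (x - a) ^ m) (by simp)
    rw [← Polynomial.eval_eq_sum, Polynomial.taylor_eval] at this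
    simp only [sub_add_cancel] at this
    exact this.symm.trans hx
  · have := hα a b c (fun m z => (z * m * (x - a) ^ (m - 1)) * (x - a)) (by simp)
    have hd := Polynomial.derivative_eval
      (Polynomial.taylor a (toPoly b c (ramanujanD^[n] P))) (x - a)
    rw [Polynomial.taylor_apply, Polynomial.derivative_comp, Polynomial.derivative_add,
      Polynomial.derivative_X, Polynomial.derivative_C, add_zero, one_mul, Polynomial.eval_comp,
      Polynomial.eval_add, Polynomial.eval_X, Polynomial.eval_C, sub_add_cancel, hx',
      ← Polynomial.taylor_apply, Polynomial.sum_def] at hd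
    rw [Polynomial.sum_def, ← sum_mul, ← hd, zero_mul] at this
    rw [this]
    have hp : ∀ (m : ℕ) (z : ℂ), z * m * (x - a) ^ (m - 1) * (x - a) = m * z * (x - a) ^ m := by
      intro m z
      rcases m with _ | m
      · simp
      · rw [Nat.add_sub_cancel, pow_succ]; ring
    simp only [hp]
    push_cast
    congr 1
    · simp [mul_assoc]
    · exact sum_congr rfl fun m _ => by ring


end RamanujanD

end

section

open Polynomial in
/-- If the specialisations of `f` at points near `t₀` are squarefree, so is the specialisation at
any transcendental number. -/
lemma Polynomial.no_double_root_of_transcendental (f : ℚ[X][X]) {l : Filter ℂ} [l.NeBot]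
    {t₀ : ℂ} (hl : l ≤ nhdsWithin t₀ {t₀}ᶜ)
    (h : ∀ᶠ s in l, ∀ x, (f.map (aeval s : ℚ[X] →ₐ[ℚ] ℂ).toRingHom).eval x = 0 →
      (f.map (aeval s : ℚ[X] →ₐ[ℚ] ℂ).toRingHom).derivative.eval x ≠ 0) {t x : ℂ}
    (ht : Transcendental ℚ t) (hx : (f.map (aeval t : ℚ[X] →ₐ[ℚ] ℂ).toRingHom).eval x = 0) :
    (f.map (aeval t : ℚ[X] →ₐ[ℚ] ℂ).toRingHom).derivative.eval x ≠ 0 := by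
  intro hx'
  have hev : ∀ g : ℚ[X], g ≠ 0 → ∀ᶠ s in l, aeval s g ≠ 0 := by
    intro g hg
    have hfin : {s : ℂ | aeval s g = 0}.Finite := by
      have : {s : ℂ | aeval s g = 0} = (g.rootSet ℂ : Set ℂ) := by
        ext s; simp [mem_rootSet, hg]
      rw [this]; exact rootSet_finite g ℂ
    have : ({s : ℂ | aeval s g = 0} \ {t₀})ᶜ ∈ nhds t₀ :=
      (hfin.subset Set.sdiff_subset).isClosed.isOpen_compl.mem_nhds (by simp)
    refine hl ?_
    filter_upwards [mem_nhdsWithin_of_mem_nhds this, self_mem_nhdsWithin] with s hs hs' h0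
    exact hs ⟨h0, hs'⟩
  have hdeg : ∀ g : ℚ[X][X], ∀ᶠ s in l,
      (g.map (aeval s : ℚ[X] →ₐ[ℚ] ℂ).toRingHom).natDegree = g.natDegree := by
    intro g
    rcases eq_or_ne g 0 with rfl | hg
    · simp
    · filter_upwards [hev _ (leadingCoeff_ne_zero.2 hg)] with s hs
      exact natDegree_map_of_leadingCoeff_ne_zero _ hs
  have hinj : Function.Injective (aeval t : ℚ[X] →ₐ[ℚ] ℂ).toRingHom :=
    transcendental_iff_injective.1 ht
  have hf0 : f ≠ 0 := by
    rintro rfl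
    obtain ⟨s, hs⟩ := h.exists
    exact hs 0 (by simp) (by simp)
  have hR : resultant f f.derivative = 0 := by
    refine hinj ?_
    rw [map_zero, ← resultant_map_map, ← derivative_map]
    have h1 : (f.map (aeval t : ℚ[X] →ₐ[ℚ] ℂ).toRingHom).natDegree = f.natDegree :=
      natDegree_map_eq_of_injective hinj _
    have h2 : (f.map (aeval t : ℚ[X] →ₐ[ℚ] ℂ).toRingHom).derivative.natDegree =
        f.derivative.natDegree := by
      rw [derivative_map]; exact natDegree_map_eq_of_injective hinj _
    rw [← h1, ← h2, resultant_eq_zero_iff]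
    refine ⟨Or.inl ((Polynomial.map_ne_zero_iff hinj).2 hf0), fun ⟨a, b, hab⟩ => ?_⟩
    have := congrArg (eval x) hab
    rw [eval_add, eval_mul, eval_mul, hx, hx'] at this
    simp at this
  obtain ⟨s, hs, h1, h2, h3⟩ := (h.and ((hdeg f).and ((hdeg f.derivative).and
    (hev _ (leadingCoeff_ne_zero.2 hf0))))).exists
  have h4 : resultant (f.map (aeval s : ℚ[X] →ₐ[ℚ] ℂ).toRingHom)
      (f.derivative.map (aeval s : ℚ[X] →ₐ[ℚ] ℂ).toRingHom) = 0 := by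
    rw [h1, h2, resultant_map_map, hR, map_zero]
  rw [resultant_eq_zero_iff] at h4
  refine h4.2 ?_
  rw [Polynomial.isCoprime_iff_aeval_ne_zero_of_isAlgClosed ℂ ℂ]
  intro y
  by_contra! hy
  rw [← derivative_map] at hy
  exact hs y (by simpa using hy.1) (by simpa using hy.2)

end

section

open MvPolynomial in
/-- The derivation of `ℤ[x, y, w, A, B]` with `x' = y`, `y' = 6x² - A`, `w' = -x - B`. -/
noncomputable def ellD :
    Derivation ℤ (MvPolynomial (Fin 5) ℤ) (MvPolynomial (Fin 5) ℤ) :=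
  mkDerivation ℤ ![X 1, 6 * X 0 ^ 2 - X 3, - X 0 - X 4, 0, 0]

namespace EllD
open MvPolynomial

local notation "ZE" => MvPolynomial (Fin 5) ℤ

/-- `HasSize D b p` says that `p` has degree at most `D` and length at most `b`. -/
inductive HasSize : ℕ → ℕ → ZE → Prop
  | zero (D b) : HasSize D b 0
  | one : HasSize 0 1 1
  | X (i) : HasSize 1 1 (X i)
  | neg {D b p} : HasSize D b p → HasSize D b (-p)
  | add {D b b' p p'} : HasSize D b p → HasSize D b' p' → HasSize D (b + b') (p + p')
  | mul {D D' b b' p p'} : HasSize D b p → HasSize D' b' p' → HasSize (D + D') (b * b') (p * p')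
  | mono {D D' b b' p} : HasSize D b p → D ≤ D' → b ≤ b' → HasSize D' b' p

lemma HasSize.pow {D b : ℕ} {p : ZE} (h : HasSize D b p) (n : ℕ) :
    HasSize (n * D) (b ^ n) (p ^ n) := by
  induction n with
  | zero => simpa using HasSize.one
  | succ n ih => rw [pow_succ, pow_succ, Nat.succ_mul]; exact ih.mul h

lemma HasSize.ellD_X (i : Fin 5) : HasSize 2 7 (ellD (MvPolynomial.X i)) := by
  have hX : ∀ i, HasSize 2 1 (MvPolynomial.X i) := fun i => (HasSize.X i).mono (by norm_num) le_rfl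
  rw [ellD, mkDerivation_X]
  fin_cases i
  · exact (hX 1).mono le_rfl (by norm_num)
  · have h2 : HasSize 2 1 ((MvPolynomial.X 0 : ZE) ^ 2) := (HasSize.X 0).pow 2
    have h6 : HasSize 2 6 (6 * (MvPolynomial.X 0 : ZE) ^ 2) := by
      have := ((((h2.add h2).add h2).add h2).add h2).add h2
      convert this using 1
      ring
    simpa [sub_eq_add_neg] using h6.add (hX 3).neg
  · simpa [sub_eq_add_neg] using ((hX 0).neg.add (hX 4).neg).mono le_rfl (by norm_num : 2 ≤ 7)
  · exact .zero _ _
  · exact .zero _ _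

lemma HasSize.ellD {D b : ℕ} {p : ZE} (h : HasSize D b p) :
    HasSize (D + 1) (7 * D * b) (_root_.ellD p) := by
  induction h with
  | zero => rw [map_zero]; exact .zero _ _
  | one => rw [Derivation.map_one_eq_zero]; exact .zero _ _
  | X i => simpa using HasSize.ellD_X i
  | neg _ ih => rw [map_neg]; exact ih.neg
  | add _ _ ih ih' => rw [map_add, mul_add]; exact ih.add ih'
  | @mul D D' b b' p p' h h' ih ih' =>
    rw [Derivation.leibniz, smul_eq_mul, smul_eq_mul]
    have := (h.mul ih').add ((h'.mul ih).mono (by omega : _ ≤ D + (D' + 1)) le_rfl)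
    exact this.mono (by omega) (le_of_eq (by ring))
  | mono _ h1 h2 ih => exact ih.mono (by omega) (by gcongr)

lemma HasSize.iterate_ellD {D b : ℕ} {p : ZE} (h : HasSize D b p) (m : ℕ) :
    HasSize (D + m) ((7 * (D + m)) ^ m * b) (_root_.ellD^[m] p) := by
  induction m with
  | zero => simpa using h
  | succ m ih =>
    rw [Function.iterate_succ_apply']
    refine ih.ellD.mono (by omega) ?_
    rw [pow_succ', ← mul_assoc]
    gcongr <;> omega

/-- The size of the derivatives of `xⁱ wʲ`. -/
lemma hasSize_iterate_ellD_monomial (i j m : ℕ) :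
    HasSize (i + j + m) ((7 * (i + j + m)) ^ m) (ellD^[m] (MvPolynomial.X 0 ^ i * MvPolynomial.X 2 ^ j)) := by
  have := (((HasSize.X 0).pow i).mul ((HasSize.X 2).pow j)).iterate_ellD m
  simpa using this

lemma HasSize.norm_aeval_le {D b : ℕ} {p : ZE} (hp : HasSize D b p) {A : Type*}
    [NormedField A] {v : Fin 5 → A} {h : ℝ} (h1 : 1 ≤ h) (hv : ∀ i, ‖v i‖ ≤ h) :
    ‖aeval v p‖ ≤ b * h ^ D := by
  induction hp with
  | zero D b => rw [map_zero, norm_zero]; positivity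
  | one => simp
  | X i => simpa using hv i
  | neg _ ih => rwa [map_neg, norm_neg]
  | add _ _ ih ih' =>
    rw [map_add, Nat.cast_add, add_mul]; exact (norm_add_le _ _).trans (add_le_add ih ih')
  | mul _ _ ih ih' =>
    rw [map_mul, norm_mul, Nat.cast_mul, pow_add, mul_mul_mul_comm]
    gcongr
  | mono _ hD hb ih => exact ih.trans (by gcongr)

lemma HasSize.isIntegral_aeval {D b : ℕ} {p : ZE} (hp : HasSize D b p) {A : Type*}
    [CommRing A] {v : Fin 5 → A} {d : ℕ} (hv : ∀ i, IsIntegral ℤ ((d : A) * v i)) :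
    IsIntegral ℤ ((d : A) ^ D * aeval v p) := by
  have hd : IsIntegral ℤ (d : A) := by
    simpa using (isIntegral_algebraMap (R := ℤ) (A := A) (x := (d : ℤ)))
  induction hp with
  | zero D b => rw [map_zero, mul_zero]; exact isIntegral_zero
  | one => simpa using isIntegral_one
  | X i => simpa using hv i
  | neg _ ih => rw [map_neg, mul_neg]; exact ih.neg
  | add _ _ ih ih' => rw [map_add, mul_add]; exact ih.add ih'
  | mul _ _ ih ih' => rw [map_mul, pow_add, mul_mul_mul_comm]; exact ih.mul ih'
  | @mono D D' b b' p _ hD hb ih =>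
    rw [← Nat.sub_add_cancel hD, pow_add, mul_assoc]
    exact (hd.pow _).mul ih

end EllD

end

section

namespace EllD
open MvPolynomial NumberField

variable {K : Type*} [Field K] [NumberField K]

lemma house_le_of_forall {α : K} {B : ℝ} (hB : 0 ≤ B) (h : ∀ φ : K →+* ℂ, ‖φ α‖ ≤ B) :
    house α ≤ B := (pi_norm_le_iff_of_nonneg hB).2 h

lemma exists_common_denominator (v : Fin 5 → K) :
    ∃ d : ℕ, 0 < d ∧ ∀ i, IsIntegral ℤ ((d : K) * v i) := by
  have h : ∀ i, ∃ y : ℤ, y ≠ 0 ∧ IsIntegral ℤ (y • v i) := fun i =>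
    ((IsFractionRing.isAlgebraic_iff ℤ ℚ K).2
      (Algebra.IsAlgebraic.isAlgebraic (R := ℚ) (v i))).exists_integral_multiple
  choose y hy hintegral using h
  refine ⟨∏ i, (y i).natAbs, Finset.prod_pos fun i _ => Int.natAbs_pos.2 (hy i), fun i => ?_⟩
  have hdvd : y i ∣ ((∏ i, (y i).natAbs : ℕ) : ℤ) :=
    Int.dvd_natCast.2 (Finset.dvd_prod_of_mem _ (Finset.mem_univ i))
  obtain ⟨z, hz⟩ := hdvd
  have : ((∏ i, (y i).natAbs : ℕ) : K) * v i = z • (y i • v i) := by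
    rw [smul_smul, zsmul_eq_mul, mul_comm z, ← hz, Int.cast_natCast]
  rw [this]
  exact (hintegral i).smul z

/-- Values of derivatives of monomials in `x, w` have small denominators and houses. -/
lemma exists_entry_bound (v : Fin 5 → K) : ∃ d : ℕ, 0 < d ∧ ∃ C : ℝ, 0 ≤ C ∧
    ∀ M : ℕ, 1 ≤ M → ∀ i j m : ℕ, i + j ≤ 2 * M → m ≤ M →
      IsIntegral ℤ ((d : K) ^ (3 * M) * aeval v (ellD^[m] (X 0 ^ i * X 2 ^ j))) ∧
      house ((d : K) ^ (3 * M) * aeval v (ellD^[m] (X 0 ^ i * X 2 ^ j))) ≤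
        Real.exp (C * (M * (1 + Real.log M))) := by
  obtain ⟨d, hd, hintegral⟩ := exists_common_denominator v
  obtain ⟨h, h1, hv⟩ : ∃ h : ℝ, 1 ≤ h ∧ ∀ i, house (v i) ≤ h := by
    refine ⟨1 + ∑ i, house (v i), ?_, fun i => ?_⟩
    · have : 0 ≤ ∑ i, house (v i) := Finset.sum_nonneg fun i _ => house_nonneg _
      linarith
    · have := Finset.single_le_sum (f := fun i => house (v i)) (fun i _ => house_nonneg _)
        (Finset.mem_univ i)
      linarith
  have hd1 : (1 : ℝ) ≤ d := by exact_mod_cast hd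
  refine ⟨d, hd, 3 * Real.log (d * h) + Real.log 21 + 1, ?_, ?_⟩
  · have : 0 ≤ Real.log (d * h) := Real.log_nonneg (by nlinarith)
    have : 0 ≤ Real.log 21 := Real.log_nonneg (by norm_num)
    positivity
  intro M hM i j m hij hm
  have hM1 : (1 : ℝ) ≤ M := by exact_mod_cast hM
  have hs : HasSize (3 * M) ((21 * M) ^ M) (ellD^[m] (X 0 ^ i * X 2 ^ j)) := by
    refine (hasSize_iterate_ellD_monomial i j m).mono (by omega) ?_
    calc (7 * (i + j + m)) ^ m ≤ (21 * M) ^ m := Nat.pow_le_pow_left (by omega) _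
      _ ≤ (21 * M) ^ M := Nat.pow_le_pow_right (by omega) hm
  refine ⟨hs.isIntegral_aeval hintegral, house_le_of_forall (Real.exp_nonneg _) fun φ => ?_⟩
  have hφ : φ (aeval v (ellD^[m] (X 0 ^ i * X 2 ^ j))) =
      aeval (fun i => φ (v i)) (ellD^[m] (X 0 ^ i * X 2 ^ j)) := by
    have := MvPolynomial.map_aeval v (φ : K →+* ℂ) (ellD^[m] (X 0 ^ i * X 2 ^ j))
    rw [this, aeval_def, coe_eval₂Hom]
    congr 1
    exact Subsingleton.elim _ _
  have hb := hs.norm_aeval_le (v := fun i => φ (v i)) h1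
    fun i => (norm_embedding_le_house (v i) φ).trans (hv i)
  rw [map_mul, map_pow, map_natCast, hφ, norm_mul, norm_pow, Complex.norm_natCast]
  calc (d : ℝ) ^ (3 * M) * ‖aeval (fun i => φ (v i)) (ellD^[m] (X 0 ^ i * X 2 ^ j))‖
      ≤ (d : ℝ) ^ (3 * M) * (((21 * M) ^ M : ℕ) * h ^ (3 * M)) := by gcongr
    _ = (d * h) ^ (3 * M) * (21 * M) ^ M := by push_cast; rw [mul_pow (d : ℝ)]; ring
    _ = Real.exp (M * (3 * Real.log (d * h) + (Real.log 21 + Real.log M))) := by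
      rw [mul_add, Real.exp_add, ← Real.log_mul (by norm_num) (by positivity),
        ← mul_assoc, mul_comm (M : ℝ) 3]
      have e1 : (3 : ℝ) * M = ((3 * M : ℕ) : ℝ) := by push_cast; ring
      rw [e1, ← Real.log_pow, ← Real.log_pow, Real.exp_log (by positivity),
        Real.exp_log (by positivity)]
    _ ≤ _ := by
      apply Real.exp_le_exp.2
      have hl : 0 ≤ Real.log M := Real.log_nonneg hM1
      have h2 : 0 ≤ Real.log (d * h) := Real.log_nonneg (by nlinarith)
      have h3 : 0 ≤ Real.log 21 := Real.log_nonneg (by norm_num)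
      have : 3 * Real.log (d * h) + (Real.log 21 + Real.log M) ≤
          (3 * Real.log (d * h) + Real.log 21 + 1) * (1 + Real.log M) := by nlinarith
      nlinarith


variable (K) in
lemma exists_siegel_const : ∃ c : ℝ, 0 ≤ c ∧ ∀ (T : ℕ), 0 < T → ∀ (α β : Type) [Fintype α]
    [Fintype β] (a : Matrix α β (𝓞 K)), a ≠ 0 → Fintype.card α = T → Fintype.card β = 2 * T →
    ∀ A : ℝ, (∀ k l, house (algebraMap (𝓞 K) K (a k l)) ≤ A) →
      ∃ ξ : β → 𝓞 K, ξ ≠ 0 ∧ a.mulVec ξ = 0 ∧ ∀ l, house (ξ l : K) ≤ c * (T * A) := by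
  classical
  obtain ⟨c, hc⟩ : ∃ c : ℝ, ∀ (T : ℕ), 0 < T → ∀ (α β : Type) [Fintype α]
    [Fintype β] (a : Matrix α β (𝓞 K)), a ≠ 0 → Fintype.card α = T → Fintype.card β = 2 * T →
    ∀ A : ℝ, (∀ k l, house (algebraMap (𝓞 K) K (a k l)) ≤ A) →
      ∃ ξ : β → 𝓞 K, ξ ≠ 0 ∧ a.mulVec ξ = 0 ∧ ∀ l, house (ξ l : K) ≤
        c * ((c * (2 * T : ℕ) * A) ^ ((T : ℝ) / ((2 * T : ℕ) - T))) :=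
    ⟨_, fun T hT α β _ _ a ha hα hβ A hA => NumberField.house.exists_ne_zero_int_vec_house_le K a ha
      hT (by omega) hβ hA hα⟩
  refine ⟨c ^ 2 * 2, by positivity, fun T hT α β _ _ a ha hα hβ A hA => ?_⟩
  obtain ⟨ξ, h0, h1, h2⟩ := hc T hT α β a ha hα hβ A hA
  refine ⟨ξ, h0, h1, fun l => (h2 l).trans (le_of_eq ?_)⟩
  have hT' : (0 : ℝ) < T := by exact_mod_cast hT
  have : (T : ℝ) / ((2 * T : ℕ) - T) = 1 := by
    push_cast; rw [two_mul, add_sub_cancel_right, div_self hT'.ne']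
  rw [this, Real.rpow_one]
  push_cast; ring

/-- Construction of the auxiliary polynomial. -/
lemma exists_auxiliary (v : Fin 5 → K) : ∃ C : ℝ, 0 ≤ C ∧ ∀ n : ℕ, 1 ≤ n →
    ∃ p : Fin (2 * n) × Fin (2 * n) → 𝓞 K, p ≠ 0 ∧
      (∀ m < 2 * n ^ 2, ∑ ij, (p ij : K) * aeval v (ellD^[m] (X 0 ^ ij.1.1 * X 2 ^ ij.2.1)) = 0) ∧
      ∀ ij, house (p ij : K) ≤
        Real.exp (C * ((2 * n ^ 2 : ℕ) * (1 + Real.log (2 * n ^ 2 : ℕ)))) := by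
  obtain ⟨d, hd, C, hC, H⟩ := exists_entry_bound v
  obtain ⟨c, hc, hs⟩ := exists_siegel_const K
  refine ⟨C + 1 + c, by positivity, fun n hn => ?_⟩
  set T := 2 * n ^ 2 with hT
  have hT1 : 1 ≤ T := by have := Nat.one_le_pow 2 n hn; omega
  have hT1' : (1 : ℝ) ≤ T := by exact_mod_cast hT1
  have hij : ∀ ij : Fin (2 * n) × Fin (2 * n), ij.1.1 + ij.2.1 ≤ 2 * T := by
    intro ij
    have h1 := ij.1.2
    have h2 := ij.2.2
    nlinarith
  have hd0 : (d : K) ≠ 0 := by exact_mod_cast hd.ne'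
  let a : Matrix (Fin T) (Fin (2 * n) × Fin (2 * n)) (𝓞 K) := fun m ij =>
    ⟨_, (H T hT1 ij.1.1 ij.2.1 m.1 (hij ij) m.2.le).1⟩
  have ha : a ≠ 0 := by
    intro h
    have := congrArg (fun x : 𝓞 K => (x : K))
      (congrFun (congrFun h ⟨0, by omega⟩) (⟨0, by omega⟩, ⟨0, by omega⟩))
    simp [a, hd0] at this
  obtain ⟨ξ, h0, h1, h2⟩ := hs T hT1 _ _ a ha (by simp) (by simp [hT]; ring) _
    (fun k l => (H T hT1 l.1.1 l.2.1 k.1 (hij l) k.2.le).2)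
  refine ⟨ξ, h0, fun m hm => ?_, fun l => (h2 l).trans ?_⟩
  · have := congrArg (fun x : 𝓞 K => (x : K)) (congrFun h1 ⟨m, hm⟩)
    simp only [Matrix.mulVec, dotProduct, Pi.zero_apply, map_sum, map_mul, map_zero] at this
    refine (mul_eq_zero.1 ?_).resolve_left (pow_ne_zero (3 * T) hd0)
    rw [← this, Finset.mul_sum]
    refine Finset.sum_congr rfl fun ij _ => ?_
    change _ = ((d : K) ^ (3 * T) * _) * (ξ ij : K)
    ring
  · have hl : 0 ≤ Real.log T := Real.log_nonneg hT1'
    have e1 : (T : ℝ) ≤ Real.exp (1 * (T * (1 + Real.log T))) := by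
      rw [one_mul]
      refine le_trans ?_ (Real.add_one_le_exp _)
      nlinarith
    have e2 : c ≤ Real.exp (c * (T * (1 + Real.log T))) := by
      refine le_trans ?_ (Real.add_one_le_exp _)
      have : 1 ≤ T * (1 + Real.log T) := by nlinarith
      nlinarith
    rw [add_mul, add_mul, Real.exp_add, Real.exp_add]
    calc c * (T * Real.exp (C * (T * (1 + Real.log T))))
        ≤ Real.exp (c * (T * (1 + Real.log T))) * (Real.exp (1 * (T * (1 + Real.log T))) *
          Real.exp (C * (T * (1 + Real.log T)))) := by gcongr
      _ = _ := by ring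

/-- A Liouville type lower bound for the first nonvanishing derivative. -/
lemma exists_lower_bound (v : Fin 5 → K) (σ : K →+* ℂ) {C₀ : ℝ} (hC₀ : 0 ≤ C₀) :
    ∃ C : ℝ, 0 ≤ C ∧ ∀ n : ℕ, 1 ≤ n → ∀ M : ℕ, 2 * n ^ 2 ≤ M →
    ∀ p : Fin (2 * n) × Fin (2 * n) → 𝓞 K,
      (∀ ij, house (p ij : K) ≤ Real.exp (C₀ * (M * (1 + Real.log M)))) →
      ∑ ij, (p ij : K) * aeval v (ellD^[M] (X 0 ^ ij.1.1 * X 2 ^ ij.2.1)) ≠ 0 →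
      Real.exp (-(C * (M * (1 + Real.log M)))) ≤
        ‖σ (∑ ij, (p ij : K) * aeval v (ellD^[M] (X 0 ^ ij.1.1 * X 2 ^ ij.2.1)))‖ := by
  obtain ⟨d, hd, C, hC, H⟩ := exists_entry_bound v
  have hd1 : (1 : ℝ) ≤ d := by exact_mod_cast hd
  have hld : 0 ≤ Real.log d := Real.log_nonneg hd1
  set N := Module.finrank ℚ K - 1
  refine ⟨N * (C₀ + C + 2) + 3 * Real.log d, by positivity, fun n hn M hM p hp hne => ?_⟩
  set γ := ∑ ij, (p ij : K) * aeval v (ellD^[M] (X 0 ^ ij.1.1 * X 2 ^ ij.2.1)) with hγ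
  have hM1 : 1 ≤ M := by have := Nat.one_le_pow 2 n hn; omega
  have hM1' : (1 : ℝ) ≤ M := by exact_mod_cast hM1
  have hl : 0 ≤ Real.log M := Real.log_nonneg hM1'
  have hij : ∀ ij : Fin (2 * n) × Fin (2 * n), ij.1.1 + ij.2.1 ≤ 2 * M := by
    intro ij
    have h1 := ij.1.2
    have h2 := ij.2.2
    nlinarith
  set Z : ℝ := M * (1 + Real.log M) with hZ
  have hZ1 : 1 ≤ Z := by nlinarith
  have hMZ : (M : ℝ) ≤ Z := by nlinarith
  have hd0 : (d : K) ≠ 0 := by exact_mod_cast hd.ne'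
  have hsum : (d : K) ^ (3 * M) * γ = ∑ ij, (p ij : K) *
      ((d : K) ^ (3 * M) * aeval v (ellD^[M] (X 0 ^ ij.1.1 * X 2 ^ ij.2.1))) := by
    rw [hγ, Finset.mul_sum]
    exact Finset.sum_congr rfl fun ij _ => by ring
  have hintegral : IsIntegral ℤ ((d : K) ^ (3 * M) * γ) := by
    rw [hsum]
    exact IsIntegral.sum _ fun ij _ => (p ij).2.mul (H M hM1 _ _ M (hij ij) le_rfl).1
  have hne' : (d : K) ^ (3 * M) * γ ≠ 0 := mul_ne_zero (pow_ne_zero _ hd0) hne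
  have hhouse : house ((d : K) ^ (3 * M) * γ) ≤ Real.exp ((C₀ + C + 2) * Z) := by
    rw [hsum]
    calc _ ≤ ∑ ij : Fin (2 * n) × Fin (2 * n), Real.exp (C₀ * Z) * Real.exp (C * Z) := by
          refine (house_sum_le_sum_house _ _).trans (Finset.sum_le_sum fun ij _ => ?_)
          refine (house_mul_le _ _).trans ?_
          gcongr
          · exact house_nonneg _
          · exact hp ij
          · exact (H M hM1 _ _ M (hij ij) le_rfl).2
      _ = (4 * n ^ 2 : ℕ) * (Real.exp (C₀ * Z) * Real.exp (C * Z)) := by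
          rw [Finset.sum_const, nsmul_eq_mul]
          simp
          ring_nf
      _ ≤ Real.exp (2 * Z) * (Real.exp (C₀ * Z) * Real.exp (C * Z)) := by
          gcongr
          calc ((4 * n ^ 2 : ℕ) : ℝ) ≤ (2 * M : ℕ) := by exact_mod_cast (by omega)
            _ ≤ 2 * Z + 1 := by push_cast; linarith
            _ ≤ _ := Real.add_one_le_exp _
      _ = _ := by rw [← Real.exp_add, ← Real.exp_add]; ring_nf
  have hnorm : (1 : ℝ) ≤ ‖Algebra.norm ℚ ((d : K) ^ (3 * M) * γ)‖ := by
    have h1 : Algebra.norm ℚ ((d : K) ^ (3 * M) * γ) ≠ 0 := Algebra.norm_ne_zero_iff.2 hne'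
    obtain ⟨z, hz⟩ := IsIntegrallyClosed.isIntegral_iff.1 (Algebra.isIntegral_norm ℚ hintegral)
    rw [← hz] at h1 ⊢
    have hz0 : z ≠ 0 := by rintro rfl; simp at h1
    have : ‖algebraMap ℤ ℚ z‖ = |(z : ℝ)| := by
      rw [← Rat.norm_cast_real]; simp
    rw [this]
    exact_mod_cast Int.one_le_abs hz0
  have hmain := hnorm.trans (norm_norm_le_norm_mul_house_pow _ σ)
  rw [map_mul, norm_mul, map_pow, map_natCast, norm_pow, Complex.norm_natCast] at hmain
  have h1 : (1 : ℝ) ≤ Real.exp (3 * Real.log d * Z) * ‖σ γ‖ * Real.exp (N * (C₀ + C + 2) * Z) := by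
    refine hmain.trans ?_
    have e1 : (d : ℝ) ^ (3 * M) ≤ Real.exp (3 * Real.log d * Z) := by
      calc (d : ℝ) ^ (3 * M) = Real.exp ((3 * M : ℕ) * Real.log d) := by
            rw [← Real.log_pow, Real.exp_log (by positivity)]
        _ ≤ _ := by
          apply Real.exp_le_exp.2; push_cast; nlinarith
    have e2 : house ((d : K) ^ (3 * M) * γ) ^ N ≤ Real.exp (N * (C₀ + C + 2) * Z) := by
      calc _ ≤ Real.exp ((C₀ + C + 2) * Z) ^ N := by
            gcongr
            exact house_nonneg _
        _ = _ := by rw [← Real.exp_nat_mul]; ring_nf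
    gcongr
    exact pow_nonneg (house_nonneg _) _
  rw [add_mul, neg_add, Real.exp_add, Real.exp_neg, Real.exp_neg]
  rw [← mul_inv, inv_le_iff_one_le_mul₀ (by positivity)]
  linarith

end EllD

end

section

open Filter Topology

lemma iteratedDeriv_sub_pow_mul {a : ℂ} (M : ℕ) :
    ∀ {f g : ℂ → ℂ}, AnalyticAt ℂ g a → f =ᶠ[𝓝 a] (fun u => (u - a) ^ M * g u) →
      iteratedDeriv M f a = M.factorial * g a := by
  induction M with
  | zero => intro f g _ h; simpa using h.eq_of_nhds
  | succ M ih =>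
    intro f g hg h
    have hd : deriv f =ᶠ[𝓝 a] fun u => (u - a) ^ M * ((M + 1) * g u + (u - a) * deriv g u) := by
      refine h.deriv.trans ?_
      filter_upwards [hg.eventually_analyticAt] with u hu
      have h1 : HasDerivAt (fun u => (u - a) ^ (M + 1)) (((M + 1 : ℕ) : ℂ) * (u - a) ^ M * 1) u := by
        exact ((hasDerivAt_id u).sub_const a).fun_pow (M + 1)
      rw [(h1.fun_mul hu.differentiableAt.hasDerivAt).deriv]
      push_cast
      ring
    have han : AnalyticAt ℂ (fun u => ((M : ℂ) + 1) * g u + (u - a) * deriv g u) a := by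
      have := hg.deriv
      fun_prop
    rw [iteratedDeriv_succ', ih han hd, Nat.factorial_succ]
    push_cast
    simp
    ring

lemma exists_eq_sub_pow_mul_of_le_analyticOrderAt {a : ℂ} (M : ℕ) :
    ∀ {f : ℂ → ℂ}, Differentiable ℂ f → (M : ℕ∞) ≤ analyticOrderAt f a →
      ∃ g : ℂ → ℂ, Differentiable ℂ g ∧ ∀ u, f u = (u - a) ^ M * g u := by
  induction M with
  | zero => intro f hf _; exact ⟨f, hf, by simp⟩
  | succ M ih =>
    intro f hf h
    have h0 : f a = 0 := by
      apply apply_eq_zero_of_analyticOrderAt_ne_zero (𝕜 := ℂ)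
      intro h'
      rw [h'] at h
      simp at h
    have hd : Differentiable ℂ (dslope f a) := differentiableOn_univ.1
      ((Complex.differentiableOn_dslope univ_mem).2 hf.differentiableOn)
    have he : ∀ u, f u = (u - a) * dslope f a u := fun u => by
      have := sub_smul_dslope f a u
      rw [h0, sub_zero, smul_eq_mul] at this
      exact this.symm
    have ho : analyticOrderAt f a = 1 + analyticOrderAt (dslope f a) a := by
      have : f = (fun u => u - a) * dslope f a := funext he
      conv_lhs => rw [this]
      rw [analyticOrderAt_mul (by fun_prop) (hd.analyticAt a)]
      congr 1
      exact analyticOrderAt_id_sub_const_self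
    obtain ⟨g, hg, hfg⟩ := ih hd (by
      rw [ho, Nat.cast_succ, add_comm] at h
      exact (ENat.add_le_add_iff_left ENat.one_ne_top).1 h)
    exact ⟨g, hg, fun u => by rw [he, hfg]; ring⟩

lemma exists_eq_prod_sub_pow_mul {M : ℕ} (S : Finset ℂ) {f : ℂ → ℂ} (hf : Differentiable ℂ f)
    (h : ∀ a ∈ S, (M : ℕ∞) ≤ analyticOrderAt f a) :
    ∃ g : ℂ → ℂ, Differentiable ℂ g ∧ ∀ u, f u = (∏ a ∈ S, (u - a) ^ M) * g u := by
  classical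
  induction S using Finset.induction_on with
  | empty => exact ⟨f, hf, by simp⟩
  | insert b S hb ih =>
    obtain ⟨g, hg, hfg⟩ := ih fun a ha => h a (Finset.mem_insert_of_mem ha)
    have ho : analyticOrderAt f b = analyticOrderAt g b := by
      have : f = (fun u => ∏ a ∈ S, (u - a) ^ M) * g := funext hfg
      have h1 : AnalyticAt ℂ (fun u : ℂ => ∏ a ∈ S, (u - a) ^ M) b := by fun_prop
      rw [this, analyticOrderAt_mul h1 (hg.analyticAt b), h1.analyticOrderAt_eq_zero.2, zero_add]
      refine Finset.prod_ne_zero_iff.2 fun a ha => pow_ne_zero _ (sub_ne_zero.2 ?_)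
      rintro rfl
      exact hb ha
    obtain ⟨g', hg', hgg'⟩ := exists_eq_sub_pow_mul_of_le_analyticOrderAt M hg
      (ho ▸ h b (Finset.mem_insert_self _ _))
    exact ⟨g', hg', fun u => by rw [hfg, hgg', Finset.prod_insert hb]; ring⟩

/-- Schwarz lemma for an entire function with zeros of order `M` at `N` equally spaced points. -/
lemma norm_iteratedDeriv_le_of_zeros {H : ℂ → ℂ} (hH : Differentiable ℂ H) {a : ℂ} {N M : ℕ}
    (hN : 1 ≤ N) (hz : ∀ j < N, (M : ℕ∞) ≤ analyticOrderAt H (a + j)) {B : ℝ}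
    (hB : ∀ u, ‖u - a‖ ≤ 3 * N → ‖H u‖ ≤ B) :
    ‖iteratedDeriv M H a‖ ≤ M.factorial * (B / 2 ^ (N * M)) := by
  classical
  have hinj : Function.Injective fun j : ℕ => a + (j : ℂ) := fun i j h => by simpa using h
  obtain ⟨g, hg, hHg⟩ := exists_eq_prod_sub_pow_mul (M := M)
    ((Finset.range N).image fun j : ℕ => a + (j : ℂ)) hH (by
      intro b hb
      obtain ⟨j, hj, rfl⟩ := Finset.mem_image.1 hb
      exact hz j (Finset.mem_range.1 hj))
  simp only [Finset.prod_image hinj.injOn] at hHg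
  have hN0 : (0 : ℝ) < N := by exact_mod_cast hN
  have hB0 : 0 ≤ B := (norm_nonneg _).trans (hB a (by simp))
  have hga : ‖g a‖ ≤ B / (2 * N) ^ (N * M) := by
    have hcl : a ∈ closure (Metric.ball a (3 * N)) :=
      subset_closure (Metric.mem_ball_self (by positivity))
    refine Complex.norm_le_of_forall_mem_frontier_norm_le Metric.isBounded_ball hg.diffContOnCl ?_ hcl
    intro u hu
    rw [frontier_ball _ (by positivity), mem_sphere_iff_norm] at hu
    rw [le_div_iff₀ (by positivity)]
    refine le_trans ?_ (hB u hu.le)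
    rw [hHg u, norm_mul, mul_comm, norm_prod, mul_comm N M, pow_mul]
    gcongr
    calc ((2 * N : ℝ) ^ M) ^ N = ∏ j ∈ Finset.range N, (2 * N : ℝ) ^ M := by simp
      _ ≤ _ := by
        refine Finset.prod_le_prod (fun _ _ => by positivity) fun j hj => ?_
        rw [norm_pow]
        gcongr
        have hj' : (j : ℝ) ≤ N := by exact_mod_cast (Finset.mem_range.1 hj).le
        have h1 := norm_sub_norm_le (u - a) (j : ℂ)
        rw [hu, Complex.norm_natCast] at h1
        calc (2 * N : ℝ) ≤ 3 * N - j := by linarith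
          _ ≤ ‖u - a - j‖ := h1
          _ = _ := by rw [sub_sub]
  obtain ⟨N, rfl⟩ : ∃ N', N = N' + 1 := ⟨N - 1, by omega⟩
  have hd := iteratedDeriv_sub_pow_mul (a := a) (f := H) M
    (g := fun u => (∏ j ∈ Finset.range N, (u - (a + (j + 1 : ℕ))) ^ M) * g u)
    (by have := hg.analyticAt a; fun_prop)
    (Eventually.of_forall fun u => by
      rw [hHg u, Finset.prod_range_succ']
      push_cast
      ring)
  rw [hd, norm_mul, Complex.norm_natCast]
  gcongr
  rw [norm_mul, norm_prod]
  calc (∏ j ∈ Finset.range N, ‖(a - (a + (j + 1 : ℕ))) ^ M‖) * ‖g a‖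
      ≤ ((N + 1 : ℕ) : ℝ) ^ ((N + 1) * M) * (B / (2 * (N + 1 : ℕ)) ^ ((N + 1) * M)) := by
        gcongr
        calc (∏ j ∈ Finset.range N, ‖(a - (a + (j + 1 : ℕ))) ^ M‖)
            ≤ ∏ j ∈ Finset.range N, ((N + 1 : ℕ) : ℝ) ^ M := by
              refine Finset.prod_le_prod (fun _ _ => norm_nonneg _) fun j hj => ?_
              rw [norm_pow, sub_add_cancel_left, norm_neg, Complex.norm_natCast]
              have := Finset.mem_range.1 hj
              gcongr
          _ = ((N + 1 : ℕ) : ℝ) ^ (N * M) := by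
              rw [Finset.prod_const, Finset.card_range, ← pow_mul, mul_comm]
          _ ≤ _ := by
              apply pow_le_pow_right₀
              · exact_mod_cast hN
              · gcongr; omega
    _ = _ := by
        rw [mul_pow]
        field_simp

end

section

open Filter Topology MvPolynomial

namespace EllD

variable {x y w : ℂ → ℂ} {μ A B : ℂ}

lemma hasDerivAt_aeval {u : ℂ} (hx : HasDerivAt x (μ * y u) u)
    (hy : HasDerivAt y (μ * (6 * x u ^ 2 - A)) u) (hw : HasDerivAt w (-(μ * (x u + B))) u)
    (Q : MvPolynomial (Fin 5) ℤ) :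
    HasDerivAt (fun u => aeval ![x u, y u, w u, A, B] Q)
      (μ * aeval ![x u, y u, w u, A, B] (ellD Q)) u := by
  induction Q using MvPolynomial.induction_on with
  | C a =>
    have : ellD (C a) = 0 := by rw [← algebraMap_eq, Derivation.map_algebraMap]
    rw [this]
    simpa using hasDerivAt_const u _
  | add p q hp hq =>
    simp only [map_add, mul_add]
    exact hp.add hq
  | mul_X p i hp =>
    have hX : HasDerivAt (fun u => (![x u, y u, w u, A, B] : Fin 5 → ℂ) i)
      (μ * aeval ![x u, y u, w u, A, B] (ellD (X i))) u := by
      fin_cases i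
      · simpa [ellD] using hx
      · simpa [ellD] using hy
      · refine HasDerivAt.congr_deriv (f := w) hw ?_
        change _ = μ * aeval ![x u, y u, w u, A, B] (ellD (X 2))
        simp [ellD]
        ring
      · simpa [ellD] using hasDerivAt_const u A
      · simpa [ellD] using hasDerivAt_const u B
    simp only [map_mul, aeval_X, Derivation.leibniz, smul_eq_mul, map_add]
    refine (hp.fun_mul hX).congr_deriv ?_
    ring

lemma iteratedDeriv_sum_aeval {a : ℂ} {ι : Type*} (s : Finset ι) (c : ι → ℂ)
    (hx : ∀ᶠ u in 𝓝 a, HasDerivAt x (μ * y u) u)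
    (hy : ∀ᶠ u in 𝓝 a, HasDerivAt y (μ * (6 * x u ^ 2 - A)) u)
    (hw : ∀ᶠ u in 𝓝 a, HasDerivAt w (-(μ * (x u + B))) u) (m : ℕ) :
    ∀ Q : ι → MvPolynomial (Fin 5) ℤ,
    iteratedDeriv m (fun u => ∑ i ∈ s, c i * aeval ![x u, y u, w u, A, B] (Q i)) =ᶠ[𝓝 a]
      fun u => μ ^ m * ∑ i ∈ s, c i * aeval ![x u, y u, w u, A, B] (ellD^[m] (Q i)) := by
  induction m with
  | zero => intro Q; simp
  | succ m ih =>
    intro Q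
    rw [iteratedDeriv_succ]
    refine (ih Q).deriv.trans ?_
    filter_upwards [hx, hy, hw] with u h1 h2 h3
    have := (HasDerivAt.fun_sum fun i (_ : i ∈ s) =>
      (hasDerivAt_aeval h1 h2 h3 (ellD^[m] (Q i))).const_mul (c i)).const_mul (μ ^ m)
    rw [this.deriv, pow_succ, mul_assoc, Finset.mul_sum _ _ μ]
    congr 1
    refine Finset.sum_congr rfl fun i _ => ?_
    rw [Function.iterate_succ_apply']
    ring

end EllD

lemma analyticOrderAt_add_const_of_periodic {H : ℂ → ℂ}
    (hp : ∀ u, H (u + 1) = H u) (a : ℂ) (j : ℕ) :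
    analyticOrderAt H (a + j) = analyticOrderAt H a := by
  have hp' : H ∘ (fun u => u + (j : ℂ)) = H := by
    funext u
    have : Function.Periodic H 1 := hp
    simpa using this.nat_mul j u
  have h1 : AnalyticAt ℂ (fun u : ℂ => u + (j : ℂ)) a := by fun_prop
  have := analyticOrderAt_comp_of_deriv_ne_zero (f := H) h1 (by simp)
  rw [hp'] at this
  exact this.symm

lemma exists_forall_lt_mul_log_two (C : ℝ) :
    ∃ N₀ : ℕ, 1 ≤ N₀ ∧ ∀ N : ℕ, N₀ ≤ N → C * (1 + 4 * Real.log (N + 1)) < N * Real.log 2 := by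
  have h1 : Tendsto (fun N : ℕ => Real.log ((N : ℝ) + 1) / ((N : ℝ) + 1)) atTop (𝓝 0) := by
    have h := (Real.isLittleO_log_id_atTop.tendsto_div_nhds_zero).comp
      (tendsto_atTop_add_const_right atTop (1 : ℝ) tendsto_natCast_atTop_atTop)
    exact h
  have h2 : Tendsto (fun N : ℕ => ((N : ℝ) + 1)⁻¹) atTop (𝓝 0) :=
    tendsto_inv_atTop_zero.comp (tendsto_atTop_add_const_right atTop (1 : ℝ)
      tendsto_natCast_atTop_atTop)
  have h3 : Tendsto (fun N : ℕ => C * (((N : ℝ) + 1)⁻¹ + 4 * (Real.log ((N : ℝ) + 1) /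
      ((N : ℝ) + 1))) + Real.log 2 * ((N : ℝ) + 1)⁻¹) atTop (𝓝 0) := by
    simpa using ((h2.add (h1.const_mul 4)).const_mul C).add (h2.const_mul (Real.log 2))
  have hl := Real.log_pos one_lt_two
  obtain ⟨N₀, hN₀⟩ := eventually_atTop.1 (h3.eventually_lt_const hl)
  refine ⟨N₀ + 1, by omega, fun N hN => ?_⟩
  have := hN₀ N (by omega)
  have hpos : (0 : ℝ) < N + 1 := by positivity
  have h4 := mul_lt_mul_of_pos_right this hpos
  field_simp at h4
  linarith

end

section

open Filter Topology MvPolynomial NumberField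

/-- The final comparison of the upper and lower bounds in Schneider's method. -/
lemma schneider_growth_bound {n M N : ℕ} {t m C₂ C₀ G h : ℝ} (ht : 0 < t) (hm : 0 < m)
    (hG : 0 ≤ G) (hn : 1 ≤ n) (hnM : 2 * n ^ 2 ≤ M) (hNM : N ^ 4 ≤ M)
    (hlow : Real.exp (-(C₂ * (M * (1 + Real.log M)))) ≤ h)
    (hup : t ^ (6 * n) * (m ^ M * h) ≤ M.factorial * ((4 * n ^ 2 : ℕ) *
      (Real.exp (C₀ * (M * (1 + Real.log M))) * Real.exp (G * N ^ 2) ^ (6 * n)) / 2 ^ (N * M))) :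
    N * Real.log 2 ≤ (6 * |Real.log t| + |Real.log m| + C₂ + 3 + C₀ + 6 * G) *
      (1 + Real.log M) := by
  have hM1 : 1 ≤ M := by have := Nat.one_le_pow 2 n hn; omega
  have hM1' : (1 : ℝ) ≤ M := by exact_mod_cast hM1
  have hl : 0 ≤ Real.log M := Real.log_nonneg hM1'
  set Z : ℝ := M * (1 + Real.log M) with hZ
  have hMZ : (M : ℝ) ≤ Z := by nlinarith
  have hnM' : n ≤ M := by nlinarith
  have hn' : (n : ℝ) ≤ Z := le_trans (by exact_mod_cast hnM') hMZ
  have hnN : (n * N ^ 2 : ℝ) ≤ Z := by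
    have : n * N ^ 2 ≤ M := by
      have h1 : (n * N ^ 2) ^ 2 ≤ M ^ 2 := by
        calc (n * N ^ 2) ^ 2 = n ^ 2 * N ^ 4 := by ring
          _ ≤ M * M := Nat.mul_le_mul (by omega) hNM
          _ = _ := by ring
      exact (Nat.pow_le_pow_iff_left two_ne_zero).1 h1
    exact le_trans (by exact_mod_cast this) hMZ
  have e1 : Real.exp (-(6 * |Real.log t| * Z)) ≤ t ^ (6 * n) := by
    rw [← Real.exp_log (pow_pos ht (6 * n)), Real.log_pow]
    apply Real.exp_le_exp.2
    push_cast
    have h1 := neg_abs_le (Real.log t)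
    have h2 := abs_nonneg (Real.log t)
    have h3 : (n : ℝ) * |Real.log t| ≤ Z * |Real.log t| := by gcongr
    have h4 : (n : ℝ) * (-|Real.log t|) ≤ n * Real.log t := by gcongr
    nlinarith
  have e2 : Real.exp (-(|Real.log m| * Z)) ≤ m ^ M := by
    rw [← Real.exp_log (pow_pos hm M), Real.log_pow]
    apply Real.exp_le_exp.2
    have h1 := neg_abs_le (Real.log m)
    have h2 := abs_nonneg (Real.log m)
    have h3 : (M : ℝ) * |Real.log m| ≤ Z * |Real.log m| := by gcongr
    have h4 : (M : ℝ) * (-|Real.log m|) ≤ M * Real.log m := by gcongr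
    nlinarith
  have e3 : (M.factorial : ℝ) ≤ Real.exp Z := by
    calc (M.factorial : ℝ) ≤ (M : ℝ) ^ M := by exact_mod_cast M.factorial_le_pow
      _ = Real.exp (M * Real.log M) := by
        rw [← Real.log_pow, Real.exp_log (by positivity)]
      _ ≤ _ := Real.exp_le_exp.2 (by nlinarith)
  have e4 : ((4 * n ^ 2 : ℕ) : ℝ) ≤ Real.exp (2 * Z) := by
    calc ((4 * n ^ 2 : ℕ) : ℝ) ≤ (2 * M : ℕ) := by exact_mod_cast (by omega)
      _ ≤ 2 * Z + 1 := by push_cast; linarith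
      _ ≤ _ := Real.add_one_le_exp _
  have e5 : Real.exp (G * N ^ 2) ^ (6 * n) ≤ Real.exp (6 * G * Z) := by
    rw [← Real.exp_nat_mul]
    apply Real.exp_le_exp.2
    push_cast
    nlinarith
  have e6 : (2 : ℝ) ^ (N * M) = Real.exp (N * M * Real.log 2) := by
    rw [← Real.exp_log (pow_pos two_pos (N * M)), Real.log_pow]
    push_cast; ring_nf
  have key : Real.exp (-(6 * |Real.log t| * Z)) * (Real.exp (-(|Real.log m| * Z)) *
      Real.exp (-(C₂ * Z))) ≤ Real.exp Z * (Real.exp (2 * Z) *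
        (Real.exp (C₀ * Z) * Real.exp (6 * G * Z)) / Real.exp (N * M * Real.log 2)) := by
    rw [← e6]
    refine le_trans ?_ (hup.trans ?_) <;> gcongr
  rw [← Real.exp_add, ← Real.exp_add, ← Real.exp_add, ← Real.exp_add, ← Real.exp_sub,
    ← Real.exp_add, Real.exp_le_exp] at key
  have : (M : ℝ) * (N * Real.log 2) ≤ M * ((6 * |Real.log t| + |Real.log m| + C₂ + 3 + C₀ + 6 * G) *
      (1 + Real.log M)) := by
    have : (6 * |Real.log t| + |Real.log m| + C₂ + 3 + C₀ + 6 * G) * Z = M * ((6 * |Real.log t| + |Real.log m| + C₂ + 3 + C₀ + 6 * G) *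
      (1 + Real.log M)) := by rw [hZ]; ring
    rw [← this]
    linarith
  exact le_of_mul_le_mul_left this (by positivity)

end

section

open Filter Topology MvPolynomial NumberField

/-- Schneider's theorem in the form of an inconsistency: a Weierstrass function `x = Xh / Θ ^ 2`,
its derivative and its zeta function `w = Wh / Θ` cannot take algebraic values simultaneously
when the invariants are algebraic and one period of `x` leaves `w` fixed. -/
theorem schneider_false {Θ Xh Wh y : ℂ → ℂ} {a μ A B : ℂ} (hΘ : Differentiable ℂ Θ)
    (hX : Differentiable ℂ Xh) (hW : Differentiable ℂ Wh)
    (pΘ : ∀ u, Θ (u + 1) = -Θ u) (pX : ∀ u, Xh (u + 1) = Xh u) (pW : ∀ u, Wh (u + 1) = -Wh u)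
    {Cg : ℝ} (hCg : 0 ≤ Cg)
    (gΘ : ∀ u, ‖Θ u‖ ≤ Real.exp (Cg * (1 + ‖u‖ ^ 2)))
    (gX : ∀ u, ‖Xh u‖ ≤ Real.exp (Cg * (1 + ‖u‖ ^ 2)))
    (gW : ∀ u, ‖Wh u‖ ≤ Real.exp (Cg * (1 + ‖u‖ ^ 2)))
    (hΘa : Θ a ≠ 0) (hμ : μ ≠ 0)
    (hx : ∀ᶠ u in 𝓝 a, HasDerivAt (fun u => Xh u / Θ u ^ 2) (μ * y u) u)
    (hy : ∀ᶠ u in 𝓝 a, HasDerivAt y (μ * (6 * (Xh u / Θ u ^ 2) ^ 2 - A)) u)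
    (hw : ∀ᶠ u in 𝓝 a, HasDerivAt (fun u => Wh u / Θ u) (-(μ * (Xh u / Θ u ^ 2 + B))) u)
    (ax : IsAlgebraic ℚ (Xh a / Θ a ^ 2)) (ay : IsAlgebraic ℚ (y a))
    (aw : IsAlgebraic ℚ (Wh a / Θ a)) (aA : IsAlgebraic ℚ A) (aB : IsAlgebraic ℚ B)
    (hne : ∀ (n : ℕ) (p : Fin (2 * n) × Fin (2 * n) → ℂ), p ≠ 0 →
      ∃ u, ∑ ij, p ij * (Xh u ^ ij.1.1 * Wh u ^ ij.2.1 *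
        Θ u ^ (6 * n - (2 * ij.1.1 + ij.2.1))) ≠ 0) : False := by
  set vals : Fin 5 → ℂ := ![Xh a / Θ a ^ 2, y a, Wh a / Θ a, A, B] with hvals
  have halg : ∀ i, IsAlgebraic ℚ (vals i) := by
    intro i; fin_cases i <;> simpa [hvals]
  let K := IntermediateField.adjoin ℚ (Set.range vals)
  have : FiniteDimensional ℚ K := IntermediateField.finiteDimensional_adjoin (by
    rintro _ ⟨i, rfl⟩
    exact (halg i).isIntegral)
  have : NumberField K := ⟨⟩
  let v : Fin 5 → K := fun i => ⟨vals i, IntermediateField.subset_adjoin _ _ ⟨i, rfl⟩⟩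
  let σ : K →+* ℂ := algebraMap K ℂ
  have hσ : ∀ Q : MvPolynomial (Fin 5) ℤ, σ (aeval v Q) = aeval vals Q := fun Q =>
    (MvPolynomial.aeval_algebraMap_apply ℂ v Q).symm
  obtain ⟨C₀, hC₀, haux⟩ := EllD.exists_auxiliary v
  obtain ⟨C₂, hC₂, hlow⟩ := EllD.exists_lower_bound v σ hC₀
  set G := Cg * (19 + 2 * ‖a‖ ^ 2) with hG
  set C₃ := 6 * |Real.log ‖Θ a‖| + |Real.log ‖μ‖| + C₂ + 3 + C₀ + 6 * G with hC₃
  have hG0 : 0 ≤ G := by positivity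
  have hC₃0 : 0 ≤ C₃ := by positivity
  obtain ⟨N₀, hN₀, hbig⟩ := exists_forall_lt_mul_log_two C₃
  set n := N₀ ^ 2 with hn
  have hn1 : 1 ≤ n := Nat.one_le_pow _ _ hN₀
  obtain ⟨p, hp0, hpz, hph⟩ := haux n hn1
  let c : Fin (2 * n) × Fin (2 * n) → ℂ := fun ij => σ (p ij)
  have hc0 : c ≠ 0 := by
    intro h
    apply hp0
    funext ij
    have : σ (p ij) = 0 := congrFun h ij
    simpa using this
  let H : ℂ → ℂ := fun u => ∑ ij, c ij * (Xh u ^ ij.1.1 * Wh u ^ ij.2.1 *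
        Θ u ^ (6 * n - (2 * ij.1.1 + ij.2.1)))
  let F : ℂ → ℂ := fun u => ∑ ij, c ij *
    aeval ![Xh u / Θ u ^ 2, y u, Wh u / Θ u, A, B] (X 0 ^ ij.1.1 * X 2 ^ ij.2.1 :
      MvPolynomial (Fin 5) ℤ)
  have hHd : Differentiable ℂ H := by
    simp only [H]
    fun_prop
  have hexp : ∀ ij : Fin (2 * n) × Fin (2 * n), 2 * ij.1.1 + ij.2.1 ≤ 6 * n := by
    intro ij; have := ij.1.2; have := ij.2.2; omega
  have hHF : ∀ u, Θ u ≠ 0 → H u = Θ u ^ (6 * n) * F u := by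
    intro u hu
    simp only [H, F, Finset.mul_sum]
    refine Finset.sum_congr rfl fun ij _ => ?_
    simp only [map_mul, map_pow, aeval_X, Matrix.cons_val_zero, Matrix.cons_val]
    have : Θ u ^ (6 * n) = Θ u ^ (6 * n - (2 * ij.1.1 + ij.2.1)) *
        ((Θ u ^ 2) ^ ij.1.1 * Θ u ^ ij.2.1) := by
      rw [← pow_mul, ← pow_add, ← pow_add, Nat.sub_add_cancel (hexp ij)]
    rw [this, div_pow, div_pow]
    field_simp
  have hHp : ∀ u, H (u + 1) = H u := by
    intro u
    simp only [H]
    refine Finset.sum_congr rfl fun ij _ => ?_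
    rw [pΘ, pX, pW, neg_pow (Wh u), neg_pow (Θ u)]
    have : (-1 : ℂ) ^ ij.2.1 * (-1) ^ (6 * n - (2 * ij.1.1 + ij.2.1)) = 1 := by
      rw [← pow_add]
      apply Even.neg_one_pow
      have := hexp ij
      exact ⟨3 * n - ij.1.1, by omega⟩
    linear_combination (c ij * Xh u ^ ij.1.1 * Wh u ^ ij.2.1 *
        Θ u ^ (6 * n - (2 * ij.1.1 + ij.2.1))) * this
  have hΘev : ∀ᶠ u in 𝓝 a, Θ u ≠ 0 := hΘ.continuous.continuousAt.eventually_ne hΘa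
  have hFe : F =ᶠ[𝓝 a] fun u => H u / Θ u ^ (6 * n) := by
    filter_upwards [hΘev] with u hu
    rw [hHF u hu, mul_div_cancel_left₀ _ (pow_ne_zero _ hu)]
  have hFan : AnalyticAt ℂ F a := AnalyticAt.congr
    ((hHd.analyticAt a).fun_div ((hΘ.analyticAt a).fun_pow _) (pow_ne_zero _ hΘa)) hFe.symm
  have hFder : ∀ m, iteratedDeriv m F a = μ ^ m * σ (∑ ij, (p ij : K) *
      aeval v (ellD^[m] (X 0 ^ ij.1.1 * X 2 ^ ij.2.1))) := by
    intro m
    rw [(EllD.iteratedDeriv_sum_aeval Finset.univ c hx hy hw m _).eq_of_nhds, map_sum]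
    simp only [map_mul, hσ]
    rfl
  have hFtop : analyticOrderAt F a ≠ ⊤ := by
    intro h
    obtain ⟨u, hu⟩ := hne n c hc0
    apply hu
    have h1 : H =ᶠ[𝓝 a] fun _ => 0 := by
      filter_upwards [analyticOrderAt_eq_top.1 h, hΘev] with u h1 h2
      rw [hHF u h2, h1, mul_zero]
    exact congrFun ((hHd.differentiableOn.analyticOnNhd isOpen_univ).eq_of_eventuallyEq
      (fun _ _ => analyticAt_const) h1) u
  set M := analyticOrderNatAt F a with hM
  have hMo : analyticOrderAt F a = M := (Nat.cast_analyticOrderNatAt hFtop).symm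
  have hTM : 2 * n ^ 2 ≤ M := by
    have := (natCast_le_analyticOrderAt_iff_iteratedDeriv_eq_zero hFan (n := 2 * n ^ 2)).2
      fun m hm => by rw [hFder, hpz m hm, map_zero, mul_zero]
    rw [hMo] at this
    exact_mod_cast this
  obtain ⟨g, hg, hga, hFg⟩ := hFan.analyticOrderAt_eq_natCast.1 hMo
  simp only [smul_eq_mul] at hFg
  have hFM := iteratedDeriv_sub_pow_mul M hg hFg
  have hHg : H =ᶠ[𝓝 a] fun u => (u - a) ^ M * (Θ u ^ (6 * n) * g u) := by
    filter_upwards [hFg, hΘev] with u h1 h2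
    rw [hHF u h2, h1]; ring
  have hHan : AnalyticAt ℂ (fun u => Θ u ^ (6 * n) * g u) a := by
    have := hΘ.analyticAt a
    fun_prop
  have hHM := iteratedDeriv_sub_pow_mul M hHan hHg
  have hHo : (M : ℕ∞) ≤ analyticOrderAt H a :=
    (natCast_le_analyticOrderAt (hHd.analyticAt a)).2 ⟨_, hHan, hHg⟩
  set γ := ∑ ij, (p ij : K) * aeval v (ellD^[M] (X 0 ^ ij.1.1 * X 2 ^ ij.2.1)) with hγ
  have hγ0 : γ ≠ 0 := by
    intro h
    have := hFder M
    rw [hFM, ← hγ, h, map_zero, mul_zero] at this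
    exact mul_ne_zero (Nat.cast_ne_zero.2 M.factorial_ne_zero) hga this
  have hM1 : 1 ≤ M := by have := Nat.one_le_pow 2 n hn1; omega
  set N := Nat.sqrt (Nat.sqrt M) with hN
  have hN4 : N ^ 4 ≤ M := by
    have h1 := Nat.sqrt_le' M
    have h2 := Nat.sqrt_le' (Nat.sqrt M)
    calc N ^ 4 = (N ^ 2) ^ 2 := by ring
      _ ≤ _ := (Nat.pow_le_pow_left h2 2).trans h1
  have hN4' : M ≤ (N + 1) ^ 4 := by
    have h1 := (Nat.lt_succ_sqrt' M).le
    have h2 : Nat.sqrt M + 1 ≤ (N + 1) ^ 2 := Nat.lt_succ_sqrt' (Nat.sqrt M)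
    calc M ≤ (Nat.sqrt M + 1) ^ 2 := h1
      _ ≤ ((N + 1) ^ 2) ^ 2 := Nat.pow_le_pow_left h2 2
      _ = _ := by ring
  have hNN : N₀ ≤ N := by
    rw [hN, Nat.le_sqrt', Nat.le_sqrt']
    rw [← hn]; omega
  have hN1 : 1 ≤ N := hN₀.trans hNN
  have hN1' : (1 : ℝ) ≤ N := by exact_mod_cast hN1
  have hTM' : ((2 * n ^ 2 : ℕ) : ℝ) ≤ M := by exact_mod_cast hTM
  have hT1' : (1 : ℝ) ≤ (2 * n ^ 2 : ℕ) := by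
    exact_mod_cast (by have := Nat.one_le_pow 2 n hn1; omega)
  have hph' : ∀ ij, house (p ij : K) ≤ Real.exp (C₀ * (M * (1 + Real.log M))) := by
    intro ij
    refine (hph ij).trans (Real.exp_le_exp.2 ?_)
    have : 0 ≤ Real.log (2 * n ^ 2 : ℕ) := Real.log_nonneg hT1'
    gcongr
  have hlowM := hlow n hn1 M hTM p hph' hγ0
  have hup := norm_iteratedDeriv_le_of_zeros hHd (a := a) (N := N) (M := M)
    (B := (4 * n ^ 2 : ℕ) *
      (Real.exp (C₀ * (M * (1 + Real.log M))) * Real.exp (G * N ^ 2) ^ (6 * n))) hN1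
    (fun j _ => by rw [analyticOrderAt_add_const_of_periodic hHp]; exact hHo) (by
      intro u hu
      have hu2 : Cg * (1 + ‖u‖ ^ 2) ≤ G * N ^ 2 := by
        have h1 : ‖u‖ ≤ ‖a‖ + 3 * N := by
          have := norm_sub_norm_le u a
          linarith
        have h2 : ‖u‖ ^ 2 ≤ (‖a‖ + 3 * N) ^ 2 := by gcongr
        rw [hG, mul_assoc]
        gcongr
        nlinarith [sq_nonneg (‖a‖ - 3 * N), sq_nonneg ‖a‖, mul_le_mul hN1' hN1' zero_le_one (by positivity),
          mul_nonneg (sq_nonneg ‖a‖) (by nlinarith : (0 : ℝ) ≤ N ^ 2 - 1)]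
      set E := Real.exp (G * N ^ 2)
      have hE1 : 1 ≤ E := Real.one_le_exp (by positivity)
      have b1 : ‖Θ u‖ ≤ E := (gΘ u).trans (Real.exp_le_exp.2 hu2)
      have b2 : ‖Xh u‖ ≤ E := (gX u).trans (Real.exp_le_exp.2 hu2)
      have b3 : ‖Wh u‖ ≤ E := (gW u).trans (Real.exp_le_exp.2 hu2)
      refine (norm_sum_le _ _).trans ?_
      calc _ ≤ ∑ ij : Fin (2 * n) × Fin (2 * n), (Real.exp (C₀ * (M * (1 + Real.log M))) *
            E ^ (6 * n)) := by
            refine Finset.sum_le_sum fun ij _ => ?_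
            rw [norm_mul]
            gcongr
            · exact (norm_embedding_le_house _ σ).trans (hph' ij)
            · rw [norm_mul, norm_mul, norm_pow, norm_pow, norm_pow]
              calc _ ≤ E ^ ij.1.1 * E ^ ij.2.1 * E ^ (6 * n - (2 * ij.1.1 + ij.2.1)) := by gcongr
                _ = E ^ (ij.1.1 + ij.2.1 + (6 * n - (2 * ij.1.1 + ij.2.1))) := by
                  rw [pow_add, pow_add]
                _ ≤ E ^ (6 * n) := by
                  apply pow_le_pow_right₀ hE1
                  have := hexp ij
                  omega
        _ = _ := by
            rw [Finset.sum_const, nsmul_eq_mul]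
            simp
            ring_nf
            tauto)
  rw [hHM] at hup
  have hFM' : Θ a ^ (6 * n) * (μ ^ M * σ γ) = M.factorial * (Θ a ^ (6 * n) * g a) := by
    rw [hγ, ← hFder M, hFM]; ring
  rw [← hFM', norm_mul, norm_mul, norm_pow, norm_pow] at hup
  have hfin := schneider_growth_bound (norm_pos_iff.2 hΘa) (norm_pos_iff.2 hμ) hG0 hn1 hTM hN4
    hlowM hup
  have hb := hbig N hNN
  have hlog : Real.log M ≤ 4 * Real.log (N + 1) := by
    have : (4 : ℝ) * Real.log (N + 1) = Real.log ((N + 1) ^ 4) := by rw [Real.log_pow]; norm_num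
    rw [this]
    apply Real.log_le_log (by exact_mod_cast hM1)
    exact_mod_cast hN4'
  have : C₃ * (1 + Real.log M) ≤ C₃ * (1 + 4 * Real.log (N + 1)) := by gcongr
  linarith

end

section

open Filter Topology Complex

/-- The quadratic differential operator `g ↦ g'² - g g''`, which turns products into sums after
division by `g²`. -/
noncomputable def logDeriv₂ (g : ℂ → ℂ) (u : ℂ) : ℂ := deriv g u ^ 2 - g u * deriv (deriv g) u

theorem logDeriv₂_mul {g h : ℂ → ℂ} (hg : Differentiable ℂ g) (hh : Differentiable ℂ h) (u : ℂ) :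
    logDeriv₂ (fun u => g u * h u) u = logDeriv₂ g u * h u ^ 2 + g u ^ 2 * logDeriv₂ h u := by
  have hg' : Differentiable ℂ (deriv g) := hg.deriv
  have hh' : Differentiable ℂ (deriv h) := hh.deriv
  have e1 : deriv (fun u => g u * h u) = fun u => deriv g u * h u + g u * deriv h u := by
    ext v; exact ((hg v).hasDerivAt.mul (hh v).hasDerivAt).deriv
  have e2 : deriv (deriv fun u => g u * h u) u =
      deriv (deriv g) u * h u + deriv g u * deriv h u + (deriv g u * deriv h u +
        g u * deriv (deriv h) u) := by
    rw [e1]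
    exact (((hg' u).hasDerivAt.mul (hh u).hasDerivAt).add
      ((hg u).hasDerivAt.mul (hh' u).hasDerivAt)).deriv
  simp only [logDeriv₂, e2]
  rw [e1]
  ring

theorem logDeriv₂_comp_neg {g : ℂ → ℂ} (hg : Differentiable ℂ g) (u : ℂ) :
    logDeriv₂ (fun u => g (-u)) u = logDeriv₂ g (-u) := by
  have e1 : deriv (fun u => g (-u)) = fun u => - deriv g (-u) := by
    ext v; simpa [Function.comp_def] using ((hg (-v)).hasDerivAt.comp v (hasDerivAt_neg v)).deriv
  have e2 : deriv (deriv fun u => g (-u)) u = deriv (deriv g) (-u) := by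
    rw [e1]
    have := ((hg.deriv (-u)).hasDerivAt.comp u (hasDerivAt_neg u)).fun_neg.deriv
    simpa using this
  simp only [logDeriv₂, e2]
  rw [e1]
  ring

/-- `e(u) = exp (2πiu)`. -/
noncomputable def expTwoPi (u : ℂ) : ℂ := cexp (2 * Real.pi * I * u)

theorem expTwoPi_add (u v : ℂ) : expTwoPi (u + v) = expTwoPi u * expTwoPi v := by
  simp only [expTwoPi, mul_add, Complex.exp_add]

theorem expTwoPi_one : expTwoPi 1 = 1 := by simp [expTwoPi]

theorem expTwoPi_zero : expTwoPi 0 = 1 := by simp [expTwoPi]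

theorem expTwoPi_ne_zero (u : ℂ) : expTwoPi u ≠ 0 := Complex.exp_ne_zero _

theorem expTwoPi_neg (u : ℂ) : expTwoPi (-u) = (expTwoPi u)⁻¹ := by
  simp [expTwoPi, Complex.exp_neg]

theorem norm_expTwoPi (u : ℂ) : ‖expTwoPi u‖ = Real.exp (-(2 * Real.pi * u.im)) := by
  rw [expTwoPi, Complex.norm_exp]
  simp

theorem hasDerivAt_expTwoPi (u : ℂ) :
    HasDerivAt expTwoPi (2 * Real.pi * I * expTwoPi u) u := by
  have := ((hasDerivAt_id u).const_mul (2 * Real.pi * I : ℂ)).cexp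
  rw [id, mul_one] at this
  rw [mul_comm _ (expTwoPi u)]
  exact this

theorem differentiable_expTwoPi : Differentiable ℂ expTwoPi :=
  fun u => (hasDerivAt_expTwoPi u).differentiableAt

theorem norm_expTwoPi_le {u : ℂ} {Y : ℝ} (h : -Y ≤ u.im) :
    ‖expTwoPi u‖ ≤ Real.exp (2 * Real.pi * Y) := by
  rw [norm_expTwoPi]
  apply Real.exp_le_exp.2
  nlinarith [Real.pi_pos]

/-- The product `∏_{n ≥ 1} (1 - qⁿ e(u))`. -/
noncomputable def thetaProd (q u : ℂ) : ℂ := ∏' n : ℕ, (1 + -(q ^ (n + 1) * expTwoPi u))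

namespace ThetaProd

variable {q : ℂ}

theorem summable_geom (hq : ‖q‖ < 1) (c : ℝ) : Summable fun n : ℕ => ‖q‖ ^ (n + 1) * c :=
  (((summable_geometric_of_lt_one (norm_nonneg q) hq).comp_injective
    (add_left_injective 1))).mul_right c

theorem summable_term (hq : ‖q‖ < 1) (u : ℂ) :
    Summable fun n : ℕ => ‖-(q ^ (n + 1) * expTwoPi u)‖ := by
  simpa [norm_mul, norm_pow] using summable_geom hq ‖expTwoPi u‖

theorem multipliable (hq : ‖q‖ < 1) (u : ℂ) :
    Multipliable fun n : ℕ => 1 + -(q ^ (n + 1) * expTwoPi u) :=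
  multipliable_one_add_of_summable (summable_term hq u)

/-- The partial products of `thetaProd`. -/
noncomputable def partialProd (q : ℂ) (N : ℕ) (u : ℂ) : ℂ :=
  ∏ n ∈ Finset.range N, (1 + -(q ^ (n + 1) * expTwoPi u))

theorem differentiable_partialProd (q : ℂ) (N : ℕ) : Differentiable ℂ (partialProd q N) := by
  unfold partialProd
  have := differentiable_expTwoPi
  fun_prop

theorem tendstoLocallyUniformlyOn (hq : ‖q‖ < 1) :
    TendstoLocallyUniformlyOn (partialProd q) (thetaProd q) atTop Set.univ := by
  have key : ∀ Y : ℝ, TendstoLocallyUniformlyOn (partialProd q) (thetaProd q) atTop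
      {u : ℂ | -Y < u.im} := by
    intro Y
    have := (Summable.hasProdLocallyUniformlyOn_nat_one_add (K := {u : ℂ | -Y < u.im})
      (f := fun n u => -(q ^ (n + 1) * expTwoPi u))
      (isOpen_lt continuous_const Complex.continuous_im)
      (summable_geom hq (Real.exp (2 * Real.pi * Y)))
      (Eventually.of_forall fun n x hx => by
        rw [norm_neg, norm_mul, norm_pow]
        gcongr
        exact norm_expTwoPi_le (le_of_lt hx))
      (fun n => by
        have := differentiable_expTwoPi.continuous
        fun_prop))
    exact this.tendstoLocallyUniformlyOn_finsetRange
  intro v hv x hx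
  obtain ⟨t, ht, h⟩ := key (|x.im| + 1) v hv x (by
    simp only [Set.mem_ofPred_eq]; linarith [neg_abs_le x.im])
  refine ⟨t, ?_, h⟩
  rw [nhdsWithin_univ]
  have : {u : ℂ | -(|x.im| + 1) < u.im} ∈ 𝓝 x :=
    (isOpen_lt continuous_const Complex.continuous_im).mem_nhds (by
      simp only [Set.mem_ofPred_eq]; linarith [neg_abs_le x.im])
  rwa [nhdsWithin_eq_nhds.2 this] at ht

theorem differentiable (hq : ‖q‖ < 1) : Differentiable ℂ (thetaProd q) := by
  rw [← differentiableOn_univ]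
  exact (tendstoLocallyUniformlyOn hq).differentiableOn
    (Eventually.of_forall fun N => (differentiable_partialProd q N).differentiableOn) isOpen_univ

theorem logDeriv₂_term (c u : ℂ) :
    logDeriv₂ (fun u => 1 + -(c * expTwoPi u)) u = -4 * Real.pi ^ 2 * (c * expTwoPi u) := by
  have e1 : deriv (fun u => 1 + -(c * expTwoPi u)) =
      fun u => -(c * (2 * Real.pi * I * expTwoPi u)) := by
    ext v
    exact ((((hasDerivAt_expTwoPi v).const_mul c).fun_neg).const_add 1).deriv
  have e2 : deriv (deriv fun u => 1 + -(c * expTwoPi u)) u =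
      -(c * (2 * Real.pi * I * (2 * Real.pi * I * expTwoPi u))) := by
    rw [e1]
    exact ((((hasDerivAt_expTwoPi u).const_mul _).const_mul c).fun_neg).deriv
  simp only [logDeriv₂, e2]
  rw [e1]
  ring_nf
  simp only [I_sq]
  ring

theorem logDeriv₂_partialProd (q : ℂ) (N : ℕ) {u : ℂ}
    (hu : ∀ n : ℕ, q ^ (n + 1) * expTwoPi u ≠ 1) :
    logDeriv₂ (partialProd q N) u = partialProd q N u ^ 2 *
      ∑ n ∈ Finset.range N, -4 * Real.pi ^ 2 *
        (q ^ (n + 1) * expTwoPi u / (1 - q ^ (n + 1) * expTwoPi u) ^ 2) := by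
  induction N with
  | zero =>
    have : partialProd q 0 = fun _ => 1 := by ext; simp [partialProd]
    simp [this, logDeriv₂]
  | succ N ih =>
    have e : partialProd q (N + 1) =
        fun u => partialProd q N u * (1 + -(q ^ (N + 1) * expTwoPi u)) := by
      ext v; simp [partialProd, Finset.prod_range_succ]
    have hd : Differentiable ℂ fun u => (1 + -(q ^ (N + 1) * expTwoPi u)) := by
      have := differentiable_expTwoPi
      fun_prop
    have h1 : 1 - q ^ (N + 1) * expTwoPi u ≠ 0 := sub_ne_zero.2 (hu N).symm
    rw [e, logDeriv₂_mul (differentiable_partialProd q N) hd, ih, logDeriv₂_term,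
      Finset.sum_range_succ]
    generalize ∑ n ∈ Finset.range N, -4 * (Real.pi : ℂ) ^ 2 *
      (q ^ (n + 1) * expTwoPi u / (1 - q ^ (n + 1) * expTwoPi u) ^ 2) = s
    have h2 : q ^ (N + 1) * expTwoPi u / (1 - q ^ (N + 1) * expTwoPi u) ^ 2 *
        (1 - q ^ (N + 1) * expTwoPi u) ^ 2 = q ^ (N + 1) * expTwoPi u :=
      div_mul_cancel₀ _ (pow_ne_zero 2 h1)
    linear_combination (4 * Real.pi ^ 2 * partialProd q N u ^ 2 : ℂ) * h2

theorem summable_rational (hq : ‖q‖ < 1) (v : ℂ) :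
    Summable fun n : ℕ => q ^ (n + 1) * v / (1 - q ^ (n + 1) * v) ^ 2 := by
  have h0 : Tendsto (fun n : ℕ => ‖q ^ (n + 1) * v‖) atTop (𝓝 0) := by
    have := (summable_geom hq ‖v‖).tendsto_atTop_zero
    simpa [norm_mul, norm_pow] using this
  apply Summable.of_norm_bounded_eventually_nat (g := fun n => 4 * (‖q‖ ^ (n + 1) * ‖v‖))
    ((summable_geom hq ‖v‖).mul_left 4)
  filter_upwards [h0.eventually (gt_mem_nhds (show (0:ℝ) < 1 / 2 by norm_num))] with n hn
  have h1 : 1 / 2 ≤ ‖1 - q ^ (n + 1) * v‖ := by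
    have := norm_sub_norm_le (1 : ℂ) (q ^ (n + 1) * v)
    rw [norm_one] at this
    linarith
  rw [norm_div, norm_pow, div_le_iff₀ (by positivity), ← norm_pow, ← norm_mul]
  nlinarith [norm_nonneg (q ^ (n + 1) * v), mul_self_nonneg (‖1 - q ^ (n + 1) * v‖ - 1/2),
    mul_le_mul h1 h1 (by norm_num) (norm_nonneg _)]

theorem logDeriv₂_eq (hq : ‖q‖ < 1) {u : ℂ} (hu : ∀ n : ℕ, q ^ (n + 1) * expTwoPi u ≠ 1) :
    logDeriv₂ (thetaProd q) u = thetaProd q u ^ 2 * ∑' n : ℕ, -4 * Real.pi ^ 2 *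
        (q ^ (n + 1) * expTwoPi u / (1 - q ^ (n + 1) * expTwoPi u) ^ 2) := by
  have t0 := tendstoLocallyUniformlyOn hq
  have t1 := t0.deriv
    (Eventually.of_forall fun N => (differentiable_partialProd q N).differentiableOn) isOpen_univ
  have t2 := t1.deriv
    (Eventually.of_forall fun N => (differentiable_partialProd q N).deriv.differentiableOn)
    isOpen_univ
  have s0 := t0.tendsto_at (Set.mem_univ u)
  have s1 := t1.tendsto_at (Set.mem_univ u)
  have s2 := t2.tendsto_at (Set.mem_univ u)
  have s : Tendsto (fun N => logDeriv₂ (partialProd q N) u) atTop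
      (𝓝 (logDeriv₂ (thetaProd q) u)) := (s1.pow 2).sub (s0.mul s2)
  refine tendsto_nhds_unique s ?_
  simp only [logDeriv₂_partialProd q _ hu]
  exact (s0.pow 2).mul
    (((summable_rational hq (expTwoPi u)).mul_left (-4 * Real.pi ^ 2 : ℂ)).hasSum.tendsto_sum_nat)

theorem eq_mul (hq : ‖q‖ < 1) {τ : ℂ} (hτ : expTwoPi τ = q) (u : ℂ) :
    thetaProd q u = (1 - q * expTwoPi u) * thetaProd q (u + τ) := by
  have e : ∀ n : ℕ, 1 + -(q ^ (n + 1) * expTwoPi (u + τ)) =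
      1 + -(q ^ (n + 1 + 1) * expTwoPi u) := fun n => by rw [expTwoPi_add, hτ]; ring
  have := tprod_eq_zero_mul' (f := fun n : ℕ => 1 + -(q ^ (n + 1) * expTwoPi u))
    (by simpa only [e] using multipliable hq (u + τ))
  rw [thetaProd, this, thetaProd]
  simp only [e]
  ring

theorem add_one (q u : ℂ) : thetaProd q (u + 1) = thetaProd q u := by
  simp [thetaProd, expTwoPi_add, expTwoPi_one]

theorem ne_zero (hq : ‖q‖ < 1) {u : ℂ} (hu : ∀ n : ℕ, q ^ (n + 1) * expTwoPi u ≠ 1) :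
    thetaProd q u ≠ 0 :=
  tprod_one_add_ne_zero_of_summable (fun n => by
    rw [← sub_eq_add_neg]; exact sub_ne_zero.2 (hu n).symm) (summable_term hq u)

theorem exists_bound (hq : ‖q‖ < 1) : ∃ B : ℝ, 1 ≤ B ∧ ∀ u : ℂ, 0 ≤ u.im →
    ‖thetaProd q u‖ ≤ B := by
  set S := ∑' n : ℕ, ‖q‖ ^ (n + 1) * 1
  have hS : 0 ≤ S := tsum_nonneg fun n => by positivity
  refine ⟨Real.exp S, Real.one_le_exp hS, fun u hu => ?_⟩
  refine le_of_tendsto ((tendstoLocallyUniformlyOn hq).tendsto_at (Set.mem_univ u)).norm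
    (Eventually.of_forall fun N => ?_)
  have h1 := Finset.norm_prod_one_add_sub_one_le (Finset.range N)
    (fun n => -(q ^ (n + 1) * expTwoPi u))
  have h2 : ∑ n ∈ Finset.range N, ‖-(q ^ (n + 1) * expTwoPi u)‖ ≤ S := by
    refine le_trans (Finset.sum_le_sum fun n _ => ?_)
      ((summable_geom hq 1).sum_le_tsum (Finset.range N) fun n _ => by positivity)
    rw [norm_neg, norm_mul, norm_pow]
    gcongr
    simpa using norm_expTwoPi_le (u := u) (Y := 0) (by simpa using hu)
  have h3 := norm_sub_norm_le (partialProd q N u) 1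
  rw [norm_one] at h3
  have h4 := Real.exp_le_exp.2 h2
  have : ‖partialProd q N u - 1‖ ≤ _ := h1
  linarith

theorem norm_le (hq : ‖q‖ < 1) {τ : ℂ} (hτ : expTwoPi τ = q) {B : ℝ}
    (hB : ∀ u : ℂ, 0 ≤ u.im → ‖thetaProd q u‖ ≤ B) {Y : ℝ} (hY : 0 ≤ Y) (m : ℕ) :
    ∀ u : ℂ, -Y ≤ u.im → -(m * τ.im) ≤ u.im → 0 ≤ τ.im →
      ‖thetaProd q u‖ ≤ B * (2 * Real.exp (2 * Real.pi * Y)) ^ m := by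
  have hE : 1 ≤ Real.exp (2 * Real.pi * Y) := Real.one_le_exp (by positivity)
  induction m with
  | zero => intro u _ h2 _; simpa using hB u (by simpa using h2)
  | succ m ih =>
    intro u h1 h2 h3
    rw [eq_mul hq hτ, norm_mul, pow_succ]
    have hi := ih (u + τ) (by simp; linarith) (by push_cast at h2; simp; linarith) h3
    have hf : ‖1 - q * expTwoPi u‖ ≤ 2 * Real.exp (2 * Real.pi * Y) := by
      refine (norm_sub_le _ _).trans ?_
      rw [norm_one, norm_mul]
      have := norm_expTwoPi_le h1
      nlinarith [norm_nonneg (expTwoPi u), norm_nonneg q]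
    calc _ ≤ (2 * Real.exp (2 * Real.pi * Y)) * (B * (2 * Real.exp (2 * Real.pi * Y)) ^ m) :=
          mul_le_mul hf hi (norm_nonneg _) (by positivity)
      _ = _ := by ring

end ThetaProd

/-- Entire functions of order at most two and finite type, in the crude form used below. -/
def HasGrowth (f : ℂ → ℂ) : Prop := ∃ C : ℝ, 0 ≤ C ∧ ∀ u, ‖f u‖ ≤ Real.exp (C * (1 + ‖u‖ ^ 2))

namespace HasGrowth

variable {f g : ℂ → ℂ}

theorem of_bound {K c : ℝ} (hK : 0 < K) (hc : 0 ≤ c)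
    (h : ∀ u, ‖f u‖ ≤ K * Real.exp (c * (1 + ‖u‖ ^ 2))) : HasGrowth f := by
  refine ⟨|Real.log K| + c, by positivity, fun u => (h u).trans ?_⟩
  nth_rw 1 [← Real.exp_log hK]
  rw [← Real.exp_add]
  apply Real.exp_le_exp.2
  nlinarith [le_abs_self (Real.log K), abs_nonneg (Real.log K), sq_nonneg ‖u‖,
    mul_nonneg (abs_nonneg (Real.log K)) (sq_nonneg ‖u‖)]

theorem mul (hf : HasGrowth f) (hg : HasGrowth g) : HasGrowth fun u => f u * g u := by
  obtain ⟨C, hC, h⟩ := hf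
  obtain ⟨C', hC', h'⟩ := hg
  refine ⟨C + C', by positivity, fun u => ?_⟩
  rw [norm_mul, add_mul, Real.exp_add]
  exact mul_le_mul (h u) (h' u) (norm_nonneg _) (Real.exp_pos _).le

theorem const (c : ℂ) : HasGrowth fun _ => c :=
  of_bound (K := ‖c‖ + 1) (c := 0) (by positivity) le_rfl fun u => by simp

theorem add (hf : HasGrowth f) (hg : HasGrowth g) : HasGrowth fun u => f u + g u := by
  obtain ⟨C, hC, h⟩ := hf
  obtain ⟨C', hC', h'⟩ := hg
  refine of_bound (K := 2) (c := C + C') (by norm_num) (by positivity) fun u => ?_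
  refine (norm_add_le _ _).trans ?_
  have h1 : Real.exp (C * (1 + ‖u‖ ^ 2)) ≤ Real.exp ((C + C') * (1 + ‖u‖ ^ 2)) := by
    gcongr; linarith
  have h2 : Real.exp (C' * (1 + ‖u‖ ^ 2)) ≤ Real.exp ((C + C') * (1 + ‖u‖ ^ 2)) := by
    gcongr; linarith
  linarith [h u, h' u]

theorem sub (hf : HasGrowth f) (hg : HasGrowth g) : HasGrowth fun u => f u - g u := by
  have := hf.add ((const (-1)).mul hg)
  simpa [sub_eq_add_neg] using this

theorem comp_neg (hf : HasGrowth f) : HasGrowth fun u => f (-u) := by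
  obtain ⟨C, hC, h⟩ := hf
  exact ⟨C, hC, fun u => by simpa using h (-u)⟩

theorem deriv (hf : HasGrowth f) (hd : Differentiable ℂ f) : HasGrowth (deriv f) := by
  obtain ⟨C, hC, h⟩ := hf
  refine ⟨3 * C, by positivity, fun u => ?_⟩
  have := Complex.norm_deriv_le_of_forall_mem_sphere_norm_le (c := u) (R := 1) (f := f)
    (C := Real.exp (3 * C * (1 + ‖u‖ ^ 2))) one_pos hd.diffContOnCl (fun z hz => by
      refine (h z).trans (Real.exp_le_exp.2 ?_)
      have h1 : ‖z‖ ≤ ‖u‖ + 1 := by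
        have h2 : ‖z - u‖ = 1 := by simpa [dist_eq_norm] using hz
        have := norm_add_le (z - u) u
        rw [sub_add_cancel, h2] at this
        linarith
      have h3 : ‖z‖ ^ 2 ≤ 2 * ‖u‖ ^ 2 + 2 := by
        nlinarith [norm_nonneg z, norm_nonneg u, sq_nonneg (‖u‖ - 1)]
      nlinarith [sq_nonneg ‖u‖])
  simpa using this

theorem exp_mul (c : ℂ) : HasGrowth fun u => cexp (c * u) := by
  refine ⟨‖c‖, norm_nonneg _, fun u => ?_⟩
  rw [Complex.norm_exp]
  apply Real.exp_le_exp.2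
  refine (Complex.re_le_norm _).trans ?_
  rw [norm_mul]
  gcongr
  nlinarith [sq_nonneg (‖u‖ - 1), sq_nonneg ‖u‖]

theorem thetaProd {q τ : ℂ} (hτ : 0 < τ.im) (hq : ‖q‖ < 1) (hqτ : expTwoPi τ = q) :
    HasGrowth (thetaProd q) := by
  obtain ⟨B, hB1, hB⟩ := ThetaProd.exists_bound hq
  refine of_bound (K := B) (c := (1 + 2 * Real.pi) * (1 / τ.im + 1) * 2) (by linarith)
    (by positivity) fun u => ?_
  have hm := Nat.le_ceil (‖u‖ / τ.im)
  have hm' := Nat.ceil_lt_add_one (a := ‖u‖ / τ.im) (by positivity)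
  set m := ⌈‖u‖ / τ.im⌉₊
  have him : -‖u‖ ≤ u.im := by
    have := Complex.abs_im_le_norm u
    have := neg_abs_le u.im
    linarith
  have h1 := ThetaProd.norm_le hq hqτ hB (norm_nonneg u) m u him (by
    rw [div_le_iff₀ hτ] at hm; linarith) hτ.le
  refine h1.trans ?_
  gcongr
  have h2 : 2 * Real.exp (2 * Real.pi * ‖u‖) ≤ Real.exp (1 + 2 * Real.pi * ‖u‖) := by
    rw [Real.exp_add]
    have := Real.add_one_le_exp (1 : ℝ)
    gcongr
    linarith
  calc (2 * Real.exp (2 * Real.pi * ‖u‖)) ^ m ≤ Real.exp (1 + 2 * Real.pi * ‖u‖) ^ m := by gcongr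
    _ = Real.exp (m * (1 + 2 * Real.pi * ‖u‖)) := by rw [Real.exp_nat_mul]
    _ ≤ _ := by
      apply Real.exp_le_exp.2
      have hu := norm_nonneg u
      have hp := Real.pi_pos
      calc (m : ℝ) * (1 + 2 * Real.pi * ‖u‖)
          ≤ ((1 / τ.im + 1) * (1 + ‖u‖)) * ((1 + 2 * Real.pi) * (1 + ‖u‖)) := by
            gcongr
            · have : (1 / τ.im + 1) * (1 + ‖u‖) = ‖u‖ / τ.im + 1 + (1 / τ.im + ‖u‖) := by
                field_simp; ring
              have : 0 < 1 / τ.im := by positivity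
              linarith
            · nlinarith
        _ = (1 + 2 * Real.pi) * (1 / τ.im + 1) * (1 + ‖u‖) ^ 2 := by ring
        _ ≤ (1 + 2 * Real.pi) * (1 / τ.im + 1) * (2 * (1 + ‖u‖ ^ 2)) := by
            gcongr
            nlinarith [sq_nonneg (‖u‖ - 1)]
        _ = _ := by ring

end HasGrowth

end

section

open Filter Topology Complex

/-- The rational function `t / (1 - t)²`. -/
noncomputable def koebe (t : ℂ) : ℂ := t / (1 - t) ^ 2

theorem koebe_inv (t : ℂ) : koebe t⁻¹ = koebe t := by
  by_cases h : t = 0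
  · simp [h]
  by_cases h1 : t = 1
  · simp [h1]
  have h2 : 1 - t ≠ 0 := sub_ne_zero.2 (Ne.symm h1)
  have h3 : t - 1 ≠ 0 := sub_ne_zero.2 h1
  unfold koebe
  rw [show 1 - t⁻¹ = (t - 1) / t by field_simp]
  field_simp
  ring

theorem koebe_one : koebe 1 = 0 := by simp [koebe]

theorem summable_int_inv_sq (w : ℂ) : Summable fun m : ℤ => 1 / (w + m) ^ 2 := by
  have := EisensteinSeries.linear_right_summable w 1 (k := 2) le_rfl
  simpa using this

theorem tsum_int_inv_sq_zero : ∑' m : ℤ, 1 / (m : ℂ) ^ 2 = (Real.pi : ℂ) ^ 2 / 3 := by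
  have := two_mul_riemannZeta_eq_tsum_int_inv_pow_of_even (k := 2) le_rfl even_two
  simp only [one_div, ← this]
  push_cast
  rw [riemannZeta_two]
  ring

theorem hasSum_int_inv_sq {w : ℂ} (hw : w.im ≠ 0) :
    HasSum (fun m : ℤ => 1 / (w + m) ^ 2) (-4 * Real.pi ^ 2 * koebe (expTwoPi w)) := by
  have pos : ∀ w : ℂ, 0 < w.im →
      HasSum (fun m : ℤ => 1 / (w + m) ^ 2) (-4 * Real.pi ^ 2 * koebe (expTwoPi w)) := by
    intro w hw
    have h := EisensteinSeries.qExpansion_identity (k := 1) le_rfl ⟨w, hw⟩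
    have hn : ‖expTwoPi w‖ < 1 := by
      rw [norm_expTwoPi, Real.exp_lt_one_iff]
      have := Real.pi_pos
      have : 0 < 2 * Real.pi * w.im := by positivity
      linarith
    have h2 := tsum_coe_mul_geometric_of_norm_lt_one hn
    simp only [pow_one] at h
    rw [expTwoPi] at h2
    rw [h2] at h
    rw [(summable_int_inv_sq w).hasSum_iff, h, koebe, expTwoPi]
    simp only [Nat.factorial_one, Nat.cast_one, div_one]
    ring_nf
    rw [I_sq]
    ring
  rcases lt_or_gt_of_ne hw with h | h
  · have := pos (-w) (by simpa using h)
    rw [expTwoPi_neg, koebe_inv] at this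
    rw [← (Equiv.neg ℤ).hasSum_iff] at this
    convert! this using 2 with m
    simp only [Function.comp, Equiv.neg_apply]
    push_cast
    rw [← neg_add, neg_sq]
  · exact pos w h

section

variable (τ : ℂ)

/-- The lattice `ℤ + ℤτ`. -/
noncomputable def tauPair (hτ : 0 < τ.im) : PeriodPair where
  ω₁ := 1
  ω₂ := τ
  indep := by
    rw [LinearIndependent.pair_iff]
    intro s t h
    have h1 := congrArg Complex.im h
    have h2 := congrArg Complex.re h
    simp at h1 h2
    rcases h1 with h1 | h1
    · simp [h1] at h2
      exact ⟨h2, h1⟩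
    · exact absurd h1 hτ.ne'

/-- `π²/3 - 8π² ∑_{n ≥ 1} qⁿ/(1 - qⁿ)²`, the conditionally convergent weight two lattice sum. -/
noncomputable def latticeG2 : ℂ :=
  Real.pi ^ 2 / 3 - 8 * Real.pi ^ 2 * ∑' n : ℕ, koebe (expTwoPi τ ^ (n + 1))

variable {τ}

theorem norm_expTwoPi_lt_one (hτ : 0 < τ.im) : ‖expTwoPi τ‖ < 1 := by
  rw [norm_expTwoPi, Real.exp_lt_one_iff]
  have := Real.pi_pos
  have : 0 < 2 * Real.pi * τ.im := by positivity
  linarith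

theorem expTwoPi_nat_mul (n : ℕ) (u : ℂ) : expTwoPi (n * u) = expTwoPi u ^ n := by
  rw [expTwoPi, expTwoPi, ← Complex.exp_nat_mul]
  congr 1
  ring

theorem weierstrassP_add_latticeG2 (hτ : 0 < τ.im) {u : ℂ} (h0 : 0 < u.im) (h1 : u.im < τ.im) :
    (tauPair τ hτ).weierstrassP u + latticeG2 τ = -4 * Real.pi ^ 2 *
      (koebe (expTwoPi u) + ∑' n : ℕ, koebe (expTwoPi τ ^ (n + 1) * expTwoPi u) +
        ∑' n : ℕ, koebe (expTwoPi τ ^ (n + 1) * expTwoPi (-u))) := by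
  have hq := norm_expTwoPi_lt_one hτ
  have H := (tauPair τ hτ).hasSum_weierstrassP u
  rw [← ((tauPair τ hτ).latticeEquivProd.symm.toEquiv).hasSum_iff,
    ← (Equiv.prodComm ℤ ℤ).hasSum_iff] at H
  have row : ∀ n : ℤ, HasSum (fun m : ℤ => ((fun l : (tauPair τ hτ).lattice =>
      (1 / (u - l) ^ 2 - 1 / (l : ℂ) ^ 2)) ∘ (tauPair τ hτ).latticeEquivProd.symm.toEquiv ∘
      (Equiv.prodComm ℤ ℤ)) (n, m))
      (-4 * Real.pi ^ 2 * (koebe (expTwoPi (u - n * τ)) - koebe (expTwoPi (n * τ))) -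
        if n = 0 then (Real.pi ^ 2 / 3 : ℂ) else 0) := by
    intro n
    have e : ∀ m : ℤ, ((fun l : (tauPair τ hτ).lattice =>
      (1 / (u - l) ^ 2 - 1 / (l : ℂ) ^ 2)) ∘ (tauPair τ hτ).latticeEquivProd.symm.toEquiv ∘
      (Equiv.prodComm ℤ ℤ)) (n, m) = 1 / ((n * τ - u) + m) ^ 2 - 1 / (n * τ + m) ^ 2 := by
      intro m
      simp only [Function.comp, Equiv.prodComm_apply, Prod.swap_prod_mk, LinearEquiv.coe_toEquiv]
      rw [(tauPair τ hτ).latticeEquiv_symm_apply]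
      simp only [tauPair]
      congr 2 <;> ring
    simp only [e]
    have hn : (n * τ - u : ℂ).im ≠ 0 := by
      simp only [sub_im, mul_im, intCast_re, intCast_im, zero_mul, add_zero]
      intro h
      rcases le_or_gt n 0 with h2 | h2
      · have : (n : ℝ) ≤ 0 := by exact_mod_cast h2
        nlinarith
      · have : (1 : ℝ) ≤ n := by exact_mod_cast h2
        nlinarith
    have s1 := hasSum_int_inv_sq hn
    rw [show (n * τ - u : ℂ) = -(u - n * τ) by ring, expTwoPi_neg, koebe_inv] at s1
    have s2 : HasSum (fun m : ℤ => 1 / (n * τ + m) ^ 2)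
        (-4 * Real.pi ^ 2 * koebe (expTwoPi (n * τ)) +
          if n = 0 then (Real.pi ^ 2 / 3 : ℂ) else 0) := by
      by_cases h : n = 0
      · subst h
        simp only [Int.cast_zero, zero_mul, zero_add, expTwoPi_zero, koebe_one, mul_zero, if_true]
        rw [← tsum_int_inv_sq_zero]
        simpa using (summable_int_inv_sq 0).hasSum
      · rw [if_neg h, add_zero]
        apply hasSum_int_inv_sq
        simp [h, hτ.ne']
    convert! s1.sub s2 using 1
    · simp [neg_sub]
    · ring
  have K := HasSum.prod_fiberwise H row
  have S1 := ThetaProd.summable_rational hq (expTwoPi u)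
  have S2 := ThetaProd.summable_rational hq (expTwoPi (-u))
  have S3 := ThetaProd.summable_rational hq 1
  simp only [mul_one] at S3
  have K2 : HasSum (fun n : ℤ => -4 * Real.pi ^ 2 * (koebe (expTwoPi (u - n * τ)) -
      koebe (expTwoPi (n * τ)))) (-4 * Real.pi ^ 2 *
      ((koebe (expTwoPi u) + (∑' n : ℕ, koebe (expTwoPi τ ^ (n + 1) * expTwoPi (-u)) -
        ∑' n : ℕ, koebe (expTwoPi τ ^ (n + 1)))) +
      (∑' n : ℕ, koebe (expTwoPi τ ^ (n + 1) * expTwoPi u) -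
        ∑' n : ℕ, koebe (expTwoPi τ ^ (n + 1))))) := by
    apply HasSum.mul_left
    apply HasSum.of_nat_of_neg_add_one
    · rw [← hasSum_nat_add_iff' 1]
      simp only [Finset.sum_range_one, Nat.cast_zero, Int.cast_zero, zero_mul, sub_zero,
        expTwoPi_zero, koebe_one, add_sub_cancel_left]
      convert! S2.hasSum.sub S3.hasSum using 1
      ext n
      have := expTwoPi_nat_mul (n + 1) τ
      push_cast at this ⊢
      rw [← koebe_inv (expTwoPi (u - _)), ← expTwoPi_neg, neg_sub,
        sub_eq_add_neg ((_ : ℂ) * τ), expTwoPi_add, this, koebe, koebe]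
    · convert! S1.hasSum.sub S3.hasSum using 1
      ext n
      have := expTwoPi_nat_mul (n + 1) τ
      push_cast at this ⊢
      rw [show u - -((n : ℂ) + 1) * τ = (n + 1) * τ + u by ring, neg_mul, expTwoPi_add,
        expTwoPi_neg, koebe_inv, this, koebe, koebe]
  have K3 := K2.sub (hasSum_ite_eq (0 : ℤ) (Real.pi ^ 2 / 3 : ℂ))
  rw [K.unique K3, latticeG2]
  ring

end

end

section

open Filter Topology Complex

/-- Algebraic independence, in homogeneous form, of an elliptic function and a quasi-periodic
one. -/
theorem exists_sum_ne_zero_of_quasiperiodic {Θ Xh Wh c : ℂ → ℂ} {τ δ : ℂ} (cΘ : Continuous Θ)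
    (cX : Continuous Xh) (h0 : Θ 0 = 0) (hne : ∀ᶠ u in 𝓝[≠] (0 : ℂ), Θ u ≠ 0) (hX0 : Xh 0 ≠ 0)
    (hδ : δ ≠ 0) (hc : ∀ u, c u ≠ 0) (tΘ : ∀ u, Θ (u + τ) = c u * Θ u)
    (tX : ∀ u, Xh (u + τ) = c u ^ 2 * Xh u) (tW : ∀ u, Wh (u + τ) = c u * (Wh u - δ * Θ u))
    (n : ℕ) (p : Fin (2 * n) × Fin (2 * n) → ℂ) (hp : p ≠ 0) :
    ∃ u, ∑ ij, p ij * (Xh u ^ ij.1.1 * Wh u ^ ij.2.1 * Θ u ^ (6 * n - (2 * ij.1.1 + ij.2.1))) ≠ 0 := by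
  by_contra! hcon
  have dehom : ∀ u, Θ u ≠ 0 →
      ∑ ij, p ij * ((Xh u / Θ u ^ 2) ^ ij.1.1 * (Wh u / Θ u) ^ ij.2.1) = 0 := by
    intro u hu
    have h := hcon u
    have : ∑ ij, p ij * (Xh u ^ ij.1.1 * Wh u ^ ij.2.1 * Θ u ^ (6 * n - (2 * ij.1.1 + ij.2.1))) =
        Θ u ^ (6 * n) * ∑ ij, p ij * ((Xh u / Θ u ^ 2) ^ ij.1.1 * (Wh u / Θ u) ^ ij.2.1) := by
      rw [Finset.mul_sum]
      refine Finset.sum_congr rfl fun ij _ => ?_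
      have h1 := ij.1.2
      have h2 := ij.2.2
      rw [show Θ u ^ (6 * n) = Θ u ^ (6 * n - (2 * ij.1.1 + ij.2.1)) * (Θ u ^ 2) ^ ij.1.1 *
          Θ u ^ ij.2.1 by rw [← pow_mul, ← pow_add, ← pow_add]; congr 1; omega,
        div_pow, div_pow]
      field_simp
    rw [this] at h
    exact (mul_eq_zero.1 h).resolve_left (pow_ne_zero _ hu)
  have shift : ∀ (u : ℂ) (k : ℕ), Θ u ≠ 0 → Θ (u + k * τ) ≠ 0 ∧
      Xh (u + k * τ) / Θ (u + k * τ) ^ 2 = Xh u / Θ u ^ 2 ∧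
      Wh (u + k * τ) / Θ (u + k * τ) = Wh u / Θ u - k * δ := by
    intro u k hu
    induction k with
    | zero => simp [hu]
    | succ k ih =>
      obtain ⟨i1, i2, i3⟩ := ih
      have e : u + ((k + 1 : ℕ) : ℂ) * τ = (u + k * τ) + τ := by push_cast; ring
      have hck := hc (u + k * τ)
      rw [e, tΘ, tX, tW]
      refine ⟨mul_ne_zero hck i1, ?_, ?_⟩
      · rw [← i2]; field_simp
      · push_cast
        rw [add_mul, one_mul, ← sub_sub, ← i3]
        field_simp
  have col : ∀ u, Θ u ≠ 0 → ∀ j, ∑ i, p (i, j) * (Xh u / Θ u ^ 2) ^ i.1 = 0 := by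
    intro u hu
    set x := Xh u / Θ u ^ 2
    let Q : Polynomial ℂ :=
      ∑ j : Fin (2 * n), Polynomial.monomial j.1 (∑ i, p (i, j) * x ^ i.1)
    have hQ : Q = 0 := by
      refine Polynomial.eq_zero_of_infinite_isRoot Q (Set.Infinite.mono (s := Set.range
        fun k : ℕ => Wh u / Θ u - k * δ) ?_ (Set.infinite_range_of_injective fun a b hab => ?_))
      · rintro _ ⟨k, rfl⟩
        obtain ⟨h1, h2, h3⟩ := shift u k hu
        have := dehom _ h1
        rw [h2, h3] at this
        simp only [Set.mem_ofPred_eq, Polynomial.IsRoot, Q, Polynomial.eval_finsetSum,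
          Polynomial.eval_monomial]
        rw [← this, Fintype.sum_prod_type_right]
        refine Finset.sum_congr rfl fun j _ => ?_
        rw [Finset.sum_mul]
        exact Finset.sum_congr rfl fun i _ => by ring
      · have : ((a : ℂ) - b) * δ = 0 := by linear_combination -hab
        have := (mul_eq_zero.1 this).resolve_right hδ
        exact_mod_cast sub_eq_zero.1 this
    intro j
    have := congrArg (fun P => Polynomial.coeff P j.1) hQ
    simpa [Q, Polynomial.finsetSum_coeff, Polynomial.coeff_monomial, Fin.val_inj] using this
  have lim : Tendsto (fun u => ‖Xh u / Θ u ^ 2‖) (𝓝[≠] (0 : ℂ)) atTop := by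
    simp only [norm_div]
    apply Tendsto.pos_mul_atTop (C := ‖Xh 0‖) (norm_pos_iff.2 hX0)
    · exact (cX.tendsto 0).norm.mono_left nhdsWithin_le_nhds
    · apply Tendsto.inv_tendsto_nhdsGT_zero
      rw [tendsto_nhdsWithin_iff]
      constructor
      · have := ((cΘ.tendsto 0).pow 2).norm.mono_left (nhdsWithin_le_nhds (s := {0}ᶜ))
        simpa [h0] using this
      · filter_upwards [hne] with u hu
        exact norm_pos_iff.2 (pow_ne_zero 2 hu)
  apply hp
  ext ⟨i, j⟩
  let R : Polynomial ℂ := ∑ i : Fin (2 * n), Polynomial.monomial i.1 (p (i, j))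
  have hR : ∀ᶠ u in 𝓝[≠] (0 : ℂ), R.eval (Xh u / Θ u ^ 2) = 0 := by
    filter_upwards [hne] with u hu
    simpa [R, Polynomial.eval_finsetSum] using col u hu j
  have hR0 : R = 0 := by
    rcases le_or_gt R.degree 0 with hd | hd
    · rw [Polynomial.eq_C_of_degree_le_zero hd] at hR ⊢
      obtain ⟨u, hu⟩ := hR.exists
      rw [Polynomial.eval_C] at hu
      rw [hu, Polynomial.C_0]
    · have h1 := Polynomial.tendsto_norm_atTop R hd lim
      have h2 : Tendsto (fun u => ‖R.eval (Xh u / Θ u ^ 2)‖) (𝓝[≠] (0 : ℂ)) (𝓝 0) :=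
        tendsto_const_nhds.congr' (by filter_upwards [hR] with u hu; rw [hu, norm_zero])
      exact (not_tendsto_nhds_of_tendsto_atTop h1 0 h2).elim
  have := congrArg (fun P => Polynomial.coeff P i.1) hR0
  simpa [R, Polynomial.finsetSum_coeff, Polynomial.coeff_monomial, Fin.val_inj] using this

/-- The Jacobi theta function `sin (πu) ∏_{n ≥ 1} (1 - qⁿ e(u)) (1 - qⁿ e(-u))`. -/
noncomputable def theta (τ u : ℂ) : ℂ :=
  Complex.sin (Real.pi * u) * (thetaProd (expTwoPi τ) u * thetaProd (expTwoPi τ) (-u))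

namespace Theta

variable {τ : ℂ}

theorem differentiable_sin : Differentiable ℂ fun u : ℂ => Complex.sin (Real.pi * u) := by
  fun_prop

theorem differentiable_prod (hτ : 0 < τ.im) :
    Differentiable ℂ fun u => thetaProd (expTwoPi τ) u * thetaProd (expTwoPi τ) (-u) := by
  have := ThetaProd.differentiable (norm_expTwoPi_lt_one hτ)
  fun_prop

theorem differentiable (hτ : 0 < τ.im) : Differentiable ℂ (theta τ) :=
  differentiable_sin.fun_mul (differentiable_prod hτ)

theorem hasGrowth (hτ : 0 < τ.im) : HasGrowth (theta τ) := by
  have h1 := HasGrowth.thetaProd hτ (norm_expTwoPi_lt_one hτ) rfl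
  have h2 : HasGrowth fun u : ℂ => Complex.sin (Real.pi * u) := by
    have := ((HasGrowth.exp_mul (-(Real.pi * I))).sub (HasGrowth.exp_mul (Real.pi * I))).mul
      (HasGrowth.const (I / 2))
    convert! this using 2 with u
    rw [Complex.sin]
    ring_nf
  exact h2.mul (h1.mul h1.comp_neg)

theorem add_one (τ u : ℂ) : theta τ (u + 1) = -theta τ u := by
  have : thetaProd (expTwoPi τ) (-(u + 1)) = thetaProd (expTwoPi τ) (-u) := by
    rw [← ThetaProd.add_one _ (-(u + 1))]
    congr 1
    ring
  rw [theta, theta, ThetaProd.add_one, this, mul_add, mul_one, Complex.sin_add_pi]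
  ring

theorem neg (τ u : ℂ) : theta τ (-u) = -theta τ u := by
  rw [theta, theta, neg_neg, mul_neg, Complex.sin_neg]
  ring

/-- The factor of automorphy of `theta` under translation by `τ`. -/
noncomputable def factor (τ u : ℂ) : ℂ := -cexp (-(Real.pi * I * τ)) * expTwoPi (-u)

theorem factor_ne_zero (τ u : ℂ) : factor τ u ≠ 0 :=
  mul_ne_zero (neg_ne_zero.2 (Complex.exp_ne_zero _)) (expTwoPi_ne_zero _)

theorem sin_factor (τ u : ℂ) : Complex.sin (Real.pi * (u + τ)) * (1 - expTwoPi (-u)) =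
    factor τ u * (1 - expTwoPi τ * expTwoPi u) * Complex.sin (Real.pi * u) := by
  set E := cexp (Real.pi * I * u) with hE
  set F := cexp (Real.pi * I * τ) with hF
  have hE0 : E ≠ 0 := Complex.exp_ne_zero _
  have hF0 : F ≠ 0 := Complex.exp_ne_zero _
  have e1 : expTwoPi u = E ^ 2 := by
    rw [expTwoPi, hE, ← Complex.exp_nat_mul]; congr 1; push_cast; ring
  have e2 : expTwoPi τ = F ^ 2 := by
    rw [expTwoPi, hF, ← Complex.exp_nat_mul]; congr 1; push_cast; ring
  have s1 : Complex.sin (Real.pi * u) = (E⁻¹ - E) * I / 2 := by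
    rw [Complex.sin, hE, ← Complex.exp_neg]; ring_nf
  have s2 : Complex.sin (Real.pi * (u + τ)) = ((E * F)⁻¹ - E * F) * I / 2 := by
    rw [Complex.sin, hE, hF, ← Complex.exp_add, ← Complex.exp_neg]; ring_nf
  rw [factor, Complex.exp_neg, expTwoPi_neg, ← hF, e1, e2, s1, s2]
  field_simp
  ring

theorem add_tau (hτ : 0 < τ.im) (u : ℂ) : theta τ (u + τ) = factor τ u * theta τ u := by
  have hq := norm_expTwoPi_lt_one hτ
  have h1 := ThetaProd.eq_mul hq rfl u
  have h2 := ThetaProd.eq_mul hq rfl (-(u + τ))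
  rw [neg_add, neg_add_cancel_right, ← neg_add, neg_add, expTwoPi_add, mul_comm,
    expTwoPi_neg τ, mul_comm (expTwoPi (-u)), mul_inv_cancel_left₀ (expTwoPi_ne_zero τ),
    ← neg_add] at h2
  rw [theta, theta, h1, h2]
  linear_combination thetaProd (expTwoPi τ) (u + τ) * thetaProd (expTwoPi τ) (-u) * sin_factor τ u

theorem hasDerivAt_factor (τ u : ℂ) :
    HasDerivAt (factor τ) (-(2 * Real.pi * I) * factor τ u) u := by
  have := ((hasDerivAt_expTwoPi (-u)).comp u (hasDerivAt_neg u)).const_mul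
    (-cexp (-(Real.pi * I * τ)))
  convert! this using 1
  rw [factor]
  ring

theorem deriv_add_tau (hτ : 0 < τ.im) (u : ℂ) : deriv (theta τ) (u + τ) =
    factor τ u * (deriv (theta τ) u - 2 * Real.pi * I * theta τ u) := by
  rw [← deriv_comp_add_const, funext (add_tau hτ)]
  have := ((hasDerivAt_factor τ u).mul ((differentiable hτ) u).hasDerivAt).deriv
  refine this.trans ?_
  ring

theorem logDeriv₂_factor (τ u : ℂ) : logDeriv₂ (factor τ) u = 0 := by
  have e : deriv (factor τ) = fun u => -(2 * Real.pi * I) * factor τ u :=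
    funext fun u => (hasDerivAt_factor τ u).deriv
  have e2 : deriv (deriv (factor τ)) u = -(2 * Real.pi * I) * (-(2 * Real.pi * I) * factor τ u) := by
    rw [e]; exact ((hasDerivAt_factor τ u).const_mul _).deriv
  rw [logDeriv₂, e2, e]
  ring

theorem logDeriv₂_add_tau (hτ : 0 < τ.im) (u : ℂ) :
    logDeriv₂ (theta τ) (u + τ) = factor τ u ^ 2 * logDeriv₂ (theta τ) u := by
  have h : logDeriv₂ (fun u => theta τ (u + τ)) u = logDeriv₂ (theta τ) (u + τ) := by
    have e1 : deriv (fun u => theta τ (u + τ)) = fun u => deriv (theta τ) (u + τ) :=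
      funext fun u => deriv_comp_add_const _ _ _
    have e2 : deriv (deriv (fun u => theta τ (u + τ))) u = deriv (deriv (theta τ)) (u + τ) := by
      rw [e1]; exact deriv_comp_add_const _ _ _
    rw [logDeriv₂, e2, e1, logDeriv₂]
  rw [← h, funext (add_tau hτ), logDeriv₂_mul
    (fun u => (hasDerivAt_factor τ u).differentiableAt) (differentiable hτ), logDeriv₂_factor]
  ring

theorem logDeriv₂_sin (u : ℂ) : logDeriv₂ (fun u => Complex.sin (Real.pi * u)) u = Real.pi ^ 2 := by
  have d : ∀ u : ℂ, HasDerivAt (fun u : ℂ => (Real.pi : ℂ) * u) Real.pi u := fun u => by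
    simpa using (hasDerivAt_id u).const_mul (Real.pi : ℂ)
  have e1 : deriv (fun u : ℂ => Complex.sin (Real.pi * u)) =
      fun u => Complex.cos (Real.pi * u) * Real.pi := funext fun u => (d u).csin.deriv
  have e2 : deriv (deriv (fun u : ℂ => Complex.sin (Real.pi * u))) u =
      -Complex.sin (Real.pi * u) * Real.pi * Real.pi := by
    rw [e1]; exact ((d u).ccos.mul_const _).deriv
  rw [logDeriv₂, e2, e1]
  linear_combination (Real.pi : ℂ) ^ 2 * Complex.sin_sq_add_cos_sq (Real.pi * u)

theorem pow_mul_expTwoPi_ne_one {u : ℂ} (hτ : 0 < τ.im) (hu : |u.im| < τ.im) (n : ℕ) :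
    expTwoPi τ ^ (n + 1) * expTwoPi u ≠ 1 := by
  rw [← expTwoPi_nat_mul, ← expTwoPi_add]
  intro h
  have h1 := congrArg norm h
  rw [norm_expTwoPi, norm_one, Real.exp_eq_one_iff] at h1
  have h2 : 0 < (((n + 1 : ℕ) : ℂ) * τ + u).im := by
    simp only [add_im, mul_im, natCast_re, natCast_im, zero_mul, add_zero]
    have := neg_abs_le u.im
    push_cast
    nlinarith [Nat.cast_nonneg (α := ℝ) n]
  have := Real.pi_pos
  nlinarith [mul_pos this h2]

theorem logDeriv₂_eq (hτ : 0 < τ.im) {u : ℂ} (hu : |u.im| < τ.im) :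
    logDeriv₂ (theta τ) u = Real.pi ^ 2 * (thetaProd (expTwoPi τ) u *
        thetaProd (expTwoPi τ) (-u)) ^ 2 - 4 * Real.pi ^ 2 * theta τ u ^ 2 *
      (∑' n : ℕ, koebe (expTwoPi τ ^ (n + 1) * expTwoPi u) +
        ∑' n : ℕ, koebe (expTwoPi τ ^ (n + 1) * expTwoPi (-u))) := by
  have hq := norm_expTwoPi_lt_one hτ
  have hd := ThetaProd.differentiable hq
  have h1 := ThetaProd.logDeriv₂_eq hq (pow_mul_expTwoPi_ne_one hτ hu)
  have h2 := ThetaProd.logDeriv₂_eq hq (u := -u) (pow_mul_expTwoPi_ne_one hτ (by simpa using hu))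
  rw [tsum_mul_left] at h1 h2
  have h3 : logDeriv₂ (theta τ) u = _ :=
    logDeriv₂_mul differentiable_sin (differentiable_prod hτ) u
  rw [h3, logDeriv₂_mul hd (by fun_prop), logDeriv₂_sin, logDeriv₂_comp_neg hd, h1, h2, theta]
  simp only [koebe]
  ring

theorem logDeriv₂_eq_weierstrassP_of_im_pos (hτ : 0 < τ.im) {u : ℂ} (h0 : 0 < u.im)
    (h1 : u.im < τ.im) :
    logDeriv₂ (theta τ) u =
      ((tauPair τ hτ).weierstrassP u + latticeG2 τ) * theta τ u ^ 2 := by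
  rw [logDeriv₂_eq hτ (by rwa [abs_of_pos h0]), weierstrassP_add_latticeG2 hτ h0 h1]
  have hv : expTwoPi u ≠ 0 := expTwoPi_ne_zero u
  have hv1 : 1 - expTwoPi u ≠ 0 := by
    intro h
    have := congrArg norm (sub_eq_zero.1 h)
    have h2 := norm_expTwoPi_lt_one h0
    rw [norm_one] at this
    linarith
  have hs : Complex.sin (Real.pi * u) ^ 2 * koebe (expTwoPi u) = -1 / 4 := by
    have e1 : expTwoPi u = cexp (Real.pi * u * I) ^ 2 := by
      rw [expTwoPi, ← Complex.exp_nat_mul]; congr 1; push_cast; ring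
    have hE : cexp (Real.pi * u * I) ≠ 0 := Complex.exp_ne_zero _
    rw [Complex.sin, neg_mul, Complex.exp_neg, koebe]
    rw [e1] at hv1 ⊢
    field_simp
    rw [I_sq]
    ring
  rw [theta]
  linear_combination (4 * Real.pi ^ 2 * (thetaProd (expTwoPi τ) u *
        thetaProd (expTwoPi τ) (-u)) ^ 2) * hs

theorem logDeriv₂_neg (hτ : 0 < τ.im) (u : ℂ) :
    logDeriv₂ (theta τ) (-u) = logDeriv₂ (theta τ) u := by
  rw [← logDeriv₂_comp_neg (differentiable hτ)]
  have : (fun u => theta τ (-u)) = fun u => -theta τ u := funext (neg τ)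
  rw [this, logDeriv₂, logDeriv₂]
  have e : deriv (fun u => -theta τ u) = fun u => -deriv (theta τ) u := by
    ext u; exact deriv.fun_neg
  rw [e, deriv.fun_neg]
  ring

theorem continuous_logDeriv₂ (hτ : 0 < τ.im) : Continuous (logDeriv₂ (theta τ)) := by
  have h := differentiable hτ
  exact (h.deriv.continuous.pow 2).sub (h.continuous.mul h.deriv.deriv.continuous)

theorem logDeriv₂_eq_weierstrassP (hτ : 0 < τ.im) {u : ℂ} (hu : |u.im| < τ.im)
    (hl : u ∉ (tauPair τ hτ).lattice) :
    logDeriv₂ (theta τ) u =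
      ((tauPair τ hτ).weierstrassP u + latticeG2 τ) * theta τ u ^ 2 := by
  rcases lt_trichotomy u.im 0 with h | h | h
  · have := logDeriv₂_eq_weierstrassP_of_im_pos hτ (u := -u) (by simpa using h)
      (by rw [abs_of_neg h] at hu; simpa using hu)
    rwa [logDeriv₂_neg hτ, (tauPair τ hτ).weierstrassP_neg, neg, neg_sq] at this
  · have hlim : Tendsto (fun t : ℝ => u + t * I) (𝓝[>] 0) (𝓝 u) := by
      have : Continuous fun t : ℝ => u + t * I := by fun_prop
      simpa using (this.tendsto 0).mono_left (nhdsWithin_le_nhds (s := Set.Ioi 0))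
    have hcw : ContinuousAt (tauPair τ hτ).weierstrassP u :=
      ((tauPair τ hτ).differentiableOn_weierstrassP.differentiableAt
        ((tauPair τ hτ).isClosed_lattice.isOpen_compl.mem_nhds hl)).continuousAt
    have t1 := ((continuous_logDeriv₂ hτ).tendsto u).comp hlim
    have t2 : Tendsto (fun u => ((tauPair τ hτ).weierstrassP u + latticeG2 τ) * theta τ u ^ 2)
        (𝓝 u) (𝓝 (((tauPair τ hτ).weierstrassP u + latticeG2 τ) * theta τ u ^ 2)) :=
      (hcw.tendsto.add_const _).mul (((differentiable hτ).continuous.tendsto u).pow 2)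
    refine tendsto_nhds_unique (t1.congr' ?_) (t2.comp hlim)
    have : Set.Ioo (0 : ℝ) τ.im ∈ 𝓝[>] (0 : ℝ) := Ioo_mem_nhdsGT hτ
    filter_upwards [this] with t ht
    exact logDeriv₂_eq_weierstrassP_of_im_pos hτ (by simpa [h] using ht.1) (by simpa [h] using ht.2)
  · exact logDeriv₂_eq_weierstrassP_of_im_pos hτ h (by rwa [abs_of_pos h] at hu)

theorem zero (τ : ℂ) : theta τ 0 = 0 := by simp [theta]

theorem logDeriv₂_zero (hτ : 0 < τ.im) : logDeriv₂ (theta τ) 0 ≠ 0 := by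
  have := ThetaProd.ne_zero (norm_expTwoPi_lt_one hτ)
    (pow_mul_expTwoPi_ne_one hτ (u := 0) (by simpa using hτ))
  rw [logDeriv₂_eq hτ (by simpa using hτ), zero]
  simp [this]

theorem half_ne_zero (hτ : 0 < τ.im) : theta τ (1 / 2) ≠ 0 := by
  have hi : |(1 / 2 : ℂ).im| < τ.im := by simpa using hτ
  have h1 := ThetaProd.ne_zero (norm_expTwoPi_lt_one hτ) (pow_mul_expTwoPi_ne_one hτ hi)
  have h2 := ThetaProd.ne_zero (norm_expTwoPi_lt_one hτ)
    (pow_mul_expTwoPi_ne_one hτ (u := -(1 / 2)) (by simpa using hτ))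
  refine mul_ne_zero ?_ (mul_ne_zero h1 h2)
  rw [mul_one_div, Complex.sin_pi_div_two]
  exact one_ne_zero

theorem deriv_half (τ : ℂ) : deriv (theta τ) (1 / 2) = 0 := by
  have e : (fun u => theta τ (1 - u)) = theta τ := by
    ext u
    rw [sub_eq_neg_add, add_one, neg, neg_neg]
  have h := deriv_comp_const_sub (f := theta τ) (a := 1) (x := 1 / 2)
  rw [e] at h
  norm_num at h ⊢
  exact self_eq_neg.1 h

end Theta

end

section

open Filter Topology Complex

theorem isAlgebraic_of_cubic {x α β : ℂ} (hα : IsAlgebraic ℚ α) (hβ : IsAlgebraic ℚ β)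
    (h : x ^ 3 - α * x - β = 0) : IsAlgebraic ℚ x := by
  let a : integralClosure ℚ ℂ := ⟨α, hα.isIntegral⟩
  let b : integralClosure ℚ ℂ := ⟨β, hβ.isIntegral⟩
  have hx : IsIntegral (integralClosure ℚ ℂ) x := by
    refine ⟨Polynomial.X ^ 3 - (Polynomial.C a * Polynomial.X + Polynomial.C b), ?_, ?_⟩
    · apply Polynomial.monic_X_pow_sub
      compute_degree!
    · have ha : algebraMap (integralClosure ℚ ℂ) ℂ a = α := rfl
      have hb : algebraMap (integralClosure ℚ ℂ) ℂ b = β := rfl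
      simp only [Polynomial.eval₂_sub, Polynomial.eval₂_add, Polynomial.eval₂_mul,
        Polynomial.eval₂_pow, Polynomial.eval₂_X, Polynomial.eval₂_C, ha, hb]
      linear_combination h
  exact (isIntegral_trans x hx).isAlgebraic

namespace Theta

variable {τ : ℂ}

theorem eventually_ne_zero (hτ : 0 < τ.im) : ∀ᶠ u in 𝓝[≠] (0 : ℂ), theta τ u ≠ 0 := by
  have h := logDeriv₂_zero hτ
  rw [logDeriv₂, zero, zero_mul, sub_zero] at h
  have := ((differentiable hτ) 0).hasDerivAt.eventually_ne (c := 0)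
    (fun h' => h (by rw [h']; ring))
  simpa [zero] using this

theorem half_notMem (hτ : 0 < τ.im) : (1 / 2 : ℂ) ∉ (tauPair τ hτ).lattice :=
  (tauPair τ hτ).ω₁_div_two_notMem_lattice

theorem eventually_nhds_half (hτ : 0 < τ.im) : ∀ᶠ u in 𝓝 (1 / 2 : ℂ),
    u ∉ (tauPair τ hτ).lattice ∧ theta τ u ≠ 0 ∧
      logDeriv₂ (theta τ) u / theta τ u ^ 2 = (tauPair τ hτ).weierstrassP u + latticeG2 τ := by
  have h1 : ∀ᶠ u in 𝓝 (1 / 2 : ℂ), u ∉ (tauPair τ hτ).lattice :=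
    (tauPair τ hτ).isClosed_lattice.isOpen_compl.mem_nhds (half_notMem hτ)
  have h2 : ∀ᶠ u in 𝓝 (1 / 2 : ℂ), theta τ u ≠ 0 :=
    (differentiable hτ).continuous.continuousAt.eventually_ne (half_ne_zero hτ)
  have h3 : ∀ᶠ u in 𝓝 (1 / 2 : ℂ), |u.im| < τ.im :=
    (isOpen_lt (by fun_prop) continuous_const).mem_nhds (by simpa using hτ)
  filter_upwards [h1, h2, h3] with u g1 g2 g3
  exact ⟨g1, g2, by rw [logDeriv₂_eq_weierstrassP hτ g3 g1]; field_simp⟩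

theorem not_eventually_derivWeierstrassP_eq_zero (hτ : 0 < τ.im) :
    ¬ ∀ᶠ u in 𝓝 (1 / 2 : ℂ), (tauPair τ hτ).derivWeierstrassP u = 0 := by
  intro h
  set L := tauPair τ hτ
  have hd := differentiable hτ
  obtain ⟨ε, hε, hball⟩ := Metric.eventually_nhds_iff_ball.1 (h.and (eventually_nhds_half hτ))
  have hconst : ∀ u ∈ Metric.ball (1 / 2 : ℂ) ε, L.weierstrassP u = L.weierstrassP (1 / 2) := by
    intro u hu
    refine (convex_ball (1 / 2 : ℂ) ε).is_const_of_fderivWithin_eq_zero (𝕜 := ℂ)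
      (f := L.weierstrassP)
      (L.differentiableOn_weierstrassP.mono fun v hv => (hball v hv).2.1) (fun v hv => ?_) hu
      (Metric.mem_ball_self hε)
    rw [fderivWithin_of_isOpen Metric.isOpen_ball hv]
    ext
    rw [fderiv_eq_smul_deriv, L.deriv_weierstrassP, (hball v hv).1]
    simp
  have hT : Differentiable ℂ (logDeriv₂ (theta τ)) :=
    (hd.deriv.pow 2).sub (hd.mul hd.deriv.deriv)
  have hR : Differentiable ℂ
      fun u => (L.weierstrassP (1 / 2) + latticeG2 τ) * theta τ u ^ 2 := by fun_prop
  have heq := AnalyticOnNhd.eq_of_eventuallyEq (z₀ := 1 / 2)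
    (fun z _ => hT.analyticAt z) (fun z _ => hR.analyticAt z) (by
      filter_upwards [Metric.ball_mem_nhds (1 / 2 : ℂ) hε] with u hu
      have h1 := (hball u hu).2.2
      rw [← hconst u hu, ← h1.2]
      have := h1.1
      field_simp)
  apply logDeriv₂_zero hτ
  rw [heq]
  simp [zero]

theorem hasDerivAt_weierstrassP (L : PeriodPair) {u : ℂ} (hu : u ∉ L.lattice) :
    HasDerivAt L.weierstrassP (L.derivWeierstrassP u) u := by
  rw [← L.deriv_weierstrassP]
  exact (L.analyticOnNhd_weierstrassP u hu).differentiableAt.hasDerivAt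

theorem eventually_hasDerivAt_derivWeierstrassP (hτ : 0 < τ.im) : ∀ᶠ u in 𝓝 (1 / 2 : ℂ),
    HasDerivAt (tauPair τ hτ).derivWeierstrassP
      (6 * (tauPair τ hτ).weierstrassP u ^ 2 - (tauPair τ hτ).g₂ / 2) u := by
  set L := tauPair τ hτ
  have hopen := L.isClosed_lattice.isOpen_compl
  have a1 := L.analyticOnNhd_weierstrassP _ (half_notMem hτ)
  have a2 := L.analyticOnNhd_derivWeierstrassP _ (half_notMem hτ)
  have a3 : AnalyticAt ℂ (fun u => deriv L.derivWeierstrassP u -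
      (6 * L.weierstrassP u ^ 2 - L.g₂ / 2)) (1 / 2) :=
    a2.deriv.fun_sub (((analyticAt_const.fun_mul (a1.fun_pow 2)).fun_sub analyticAt_const))
  have hl : ∀ᶠ u in 𝓝 (1 / 2 : ℂ), u ∉ L.lattice := hopen.mem_nhds (half_notMem hτ)
  have key : ∀ u, u ∉ L.lattice → L.derivWeierstrassP u * (deriv L.derivWeierstrassP u -
      (6 * L.weierstrassP u ^ 2 - L.g₂ / 2)) = 0 := by
    intro u hu
    have d1 := hasDerivAt_weierstrassP L hu
    have d2 := (L.analyticOnNhd_derivWeierstrassP u hu).differentiableAt.hasDerivAt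
    have e1 := d2.fun_pow 2
    have e2 := (((d1.fun_pow 3).const_mul 4).fun_sub (d1.const_mul L.g₂)).sub_const L.g₃
    have e3 := e1.unique (e2.congr_of_eventuallyEq (by
      filter_upwards [hopen.mem_nhds hu] with v hv
      exact L.derivWeierstrassP_sq v hv))
    push_cast at e3
    simp only [pow_one] at e3
    linear_combination e3 / 2
  have ev : ∀ᶠ u in 𝓝 (1 / 2 : ℂ), deriv L.derivWeierstrassP u -
      (6 * L.weierstrassP u ^ 2 - L.g₂ / 2) = 0 := by
    rcases a3.eventually_eq_zero_or_eventually_ne_zero with h | h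
    · exact h
    exfalso
    rcases a2.eventually_eq_zero_or_eventually_ne_zero with h' | h'
    · exact not_eventually_derivWeierstrassP_eq_zero hτ h'
    · obtain ⟨u, hu1, hu2, hu3⟩ :=
        (h.and (h'.and (hl.filter_mono nhdsWithin_le_nhds))).exists
      exact mul_ne_zero hu2 hu1 (key u hu3)
  filter_upwards [ev, hl] with u hu hu2
  rw [← sub_eq_zero.1 hu]
  exact (L.analyticOnNhd_derivWeierstrassP u hu2).differentiableAt.hasDerivAt

theorem not_isAlgebraic_invariants (hτ : 0 < τ.im) {μ : ℂ} (hμ : μ ≠ 0)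
    (h2 : IsAlgebraic ℚ (latticeG2 τ / μ ^ 2)) (h4 : IsAlgebraic ℚ ((tauPair τ hτ).g₂ / μ ^ 4))
    (h6 : IsAlgebraic ℚ ((tauPair τ hτ).g₃ / μ ^ 6)) : False := by
  set L := tauPair τ hτ with hL
  have hd := differentiable hτ
  have gΘ := hasGrowth hτ
  have gW : HasGrowth fun u => deriv (theta τ) u * (1 / μ) :=
    (gΘ.deriv hd).mul (HasGrowth.const _)
  have gX : HasGrowth fun u => (logDeriv₂ (theta τ) u - latticeG2 τ * theta τ u ^ 2) *
      (1 / μ ^ 2) := by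
    have g1 := gΘ.deriv hd
    have g2 := g1.deriv hd.deriv
    have := (((g1.mul g1).sub (gΘ.mul g2)).sub ((HasGrowth.const (latticeG2 τ)).mul
      (gΘ.mul gΘ))).mul (HasGrowth.const (1 / μ ^ 2))
    simpa only [logDeriv₂, sq] using this
  obtain ⟨C1, hC1, b1⟩ := gΘ
  obtain ⟨C2, hC2, b2⟩ := gX
  obtain ⟨C3, hC3, b3⟩ := gW
  have mono : ∀ {f : ℂ → ℂ} {C : ℝ}, C ≤ C1 + C2 + C3 →
      (∀ u, ‖f u‖ ≤ Real.exp (C * (1 + ‖u‖ ^ 2))) →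
      ∀ u, ‖f u‖ ≤ Real.exp ((C1 + C2 + C3) * (1 + ‖u‖ ^ 2)) := fun hC hf u =>
    (hf u).trans (by gcongr)
  have hT : Differentiable ℂ (logDeriv₂ (theta τ)) :=
    (hd.deriv.pow 2).sub (hd.mul hd.deriv.deriv)
  have hd' := hd.deriv
  have per1 : ∀ u, deriv (theta τ) (u + 1) = -deriv (theta τ) u := fun u => by
    rw [← deriv_comp_add_const, funext (add_one τ), deriv.fun_neg]
  have per2 : ∀ u, deriv (deriv (theta τ)) (u + 1) = -deriv (deriv (theta τ)) u := fun u => by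
    rw [← deriv_comp_add_const, funext per1, deriv.fun_neg]
  have xeq : ∀ᶠ u in 𝓝 (1 / 2 : ℂ), (logDeriv₂ (theta τ) u - latticeG2 τ * theta τ u ^ 2) *
      (1 / μ ^ 2) / theta τ u ^ 2 = L.weierstrassP u / μ ^ 2 := by
    filter_upwards [eventually_nhds_half hτ] with u hu
    have h1 := hu.2.1
    rw [eq_sub_of_add_eq hu.2.2.symm]
    field_simp
  have py : L.derivWeierstrassP (1 / 2) = 0 := by
    have e := L.derivWeierstrassP_add_coe (-(1 / 2)) ⟨_, L.ω₁_mem_lattice⟩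
    have e1 : L.ω₁ = 1 := rfl
    simp only [e1] at e
    rw [L.derivWeierstrassP_neg] at e
    norm_num at e ⊢
    exact self_eq_neg.1 e
  refine schneider_false (Θ := theta τ)
    (Xh := fun u => (logDeriv₂ (theta τ) u - latticeG2 τ * theta τ u ^ 2) * (1 / μ ^ 2))
    (Wh := fun u => deriv (theta τ) u * (1 / μ)) (y := fun u => L.derivWeierstrassP u / μ ^ 3)
    (a := 1 / 2) (μ := μ) (A := L.g₂ / (2 * μ ^ 4)) (B := latticeG2 τ / μ ^ 2)
    hd (by fun_prop) (by fun_prop) (add_one τ) (fun u => ?_) (fun u => ?_)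
    (Cg := C1 + C2 + C3) (by positivity) (mono (by linarith) b1) (mono (by linarith) b2)
    (mono (by linarith) b3) (half_ne_zero hτ) hμ ?_ ?_ ?_ ?_ ?_ ?_ ?_ h2 ?_
  · simp only [logDeriv₂, per1, per2, add_one]
    ring
  · rw [per1]; ring
  · filter_upwards [xeq.eventually_nhds, eventually_nhds_half hτ] with u hu hu2
    refine ((hasDerivAt_weierstrassP L hu2.1).div_const (μ ^ 2)).congr_of_eventuallyEq hu
      |>.congr_deriv ?_
    field_simp
  · filter_upwards [xeq, eventually_hasDerivAt_derivWeierstrassP hτ] with u hu hu2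
    refine (hu2.div_const (μ ^ 3)).congr_deriv ?_
    rw [hu]
    field_simp
    ring
  · filter_upwards [xeq, eventually_nhds_half hτ] with u hu hu2
    have hne := hu2.2.1
    refine (((hd' u).hasDerivAt.mul_const (1 / μ)).fun_div (hd u).hasDerivAt hne).congr_deriv ?_
    rw [hu, eq_sub_of_add_eq hu2.2.2.symm, logDeriv₂]
    field_simp
    ring
  · have hp := L.derivWeierstrassP_sq _ (half_notMem hτ)
    rw [xeq.self_of_nhds]
    refine isAlgebraic_of_cubic (α := L.g₂ / μ ^ 4 * (1 / 4 : ℚ))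
      (β := L.g₃ / μ ^ 6 * (1 / 4 : ℚ)) (h4.mul (isAlgebraic_algebraMap (A := ℂ) _))
      (h6.mul (isAlgebraic_algebraMap (A := ℂ) _)) ?_
    rw [py] at hp
    push_cast
    field_simp
    linear_combination -hp
  · simp only [py, zero_div]
    exact isAlgebraic_zero
  · simp only [deriv_half, zero_mul, zero_div]
    exact isAlgebraic_zero
  · have := h4.mul (isAlgebraic_algebraMap (R := ℚ) (A := ℂ) (1 / 2 : ℚ))
    convert! this using 1
    simp
    field_simp
  · refine exists_sum_ne_zero_of_quasiperiodic (τ := τ) (δ := 2 * Real.pi * I / μ) (c := factor τ)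
      hd.continuous (((hT.continuous).sub (continuous_const.mul (hd.continuous.pow 2))).mul
        continuous_const) (zero τ) (eventually_ne_zero hτ) ?_ ?_ (factor_ne_zero τ)
      (add_tau hτ) (fun u => ?_) (fun u => ?_)
    · simp [zero, logDeriv₂_zero hτ, hμ]
    · simp [hμ, Real.pi_ne_zero]
    · rw [logDeriv₂_add_tau hτ, add_tau hτ]; ring
    · rw [deriv_add_tau hτ]; field_simp

end Theta

end

section

open UpperHalfPlane hiding I
open Complex ArithmeticFunction Filter Topology EisensteinSeries
open scoped ArithmeticFunction.sigma

theorem sum_divisors_eq_sigma (k n : ℕ) :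
    ∑ d ∈ n.divisors, (d : ℂ) ^ k = (σ k n : ℂ) := by
  rw [sigma_apply]
  push_cast
  rfl

theorem tsum_sigma_eq_tsum_pnat (k : ℕ) (q : ℂ) :
    ∑' n : ℕ, (∑ d ∈ n.divisors, (d : ℂ) ^ k) * q ^ n = ∑' n : ℕ+, (σ k n : ℂ) * q ^ (n : ℕ) := by
  simp only [sum_divisors_eq_sigma]
  refine (PNat.coe_injective.tsum_eq (f := fun n : ℕ => (σ k n : ℂ) * q ^ n) fun n hn => ?_).symm
  have h0 : n ≠ 0 := by
    rintro rfl
    simp at hn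
  exact ⟨⟨n, Nat.pos_of_ne_zero h0⟩, rfl⟩

theorem Ek_eq_E {k : ℕ} (hk : 3 ≤ k) (hk2 : Even k) (z : ℍ) :
    Ek k z = ModularForm.E hk z := by
  rw [EisensteinSeries.q_expansion_bernoulli hk hk2, Ek, tsum_sigma_eq_tsum_pnat]
  simp

theorem Ek_two (z : ℍ) : Ek 2 z = E2 z := by
  rw [E2_eq_tsum_cexp, Ek, tsum_sigma_eq_tsum_pnat, bernoulli_two]
  norm_num

/-- The nome `exp (2πiz)`. -/
noncomputable def nome (z : ℂ) : ℂ := exp (2 * Real.pi * I * z)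

theorem nome_ne_zero (z : ℂ) : nome z ≠ 0 := exp_ne_zero _

theorem nome_mem_ball {z : ℂ} (hz : 0 < z.im) : nome z ∈ Metric.ball (0 : ℂ) 1 := by
  have := UpperHalfPlane.norm_exp_two_pi_I_lt_one ⟨z, hz⟩
  simpa [nome] using this

theorem hasDerivAt_nome (z : ℂ) : HasDerivAt nome (2 * Real.pi * I * nome z) z := by
  refine ((hasDerivAt_id z).const_mul (2 * Real.pi * I)).cexp.congr_deriv ?_
  simp [nome, mul_comm]

theorem differentiableOn_tsum_sigma (k : ℕ) :
    DifferentiableOn ℂ (fun q : ℂ => ∑' n : ℕ, (σ k (n + 1) : ℂ) * q ^ n) (Metric.ball 0 1) := by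
  intro q hq
  rw [mem_ball_zero_iff] at hq
  obtain ⟨ρ, hqρ, hρ⟩ := exists_between hq
  have hρ0 : 0 < ρ := (norm_nonneg q).trans_lt hqρ
  have hs : Summable fun n : ℕ => ρ⁻¹ * (((n + 1 : ℕ) : ℝ) ^ (k + 1) * ρ ^ (n + 1)) :=
    ((summable_nat_add_iff 1).2 (summable_pow_mul_geometric_of_norm_lt_one (k + 1)
      (r := ρ) (by rwa [Real.norm_of_nonneg hρ0.le]))).mul_left _
  have h := differentiableOn_tsum_of_summable_norm (U := Metric.ball (0 : ℂ) ρ)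
    (F := fun n q => (σ k (n + 1) : ℂ) * q ^ n) hs (fun n => by fun_prop) Metric.isOpen_ball
    (fun n w hw => by
      rw [mem_ball_zero_iff] at hw
      rw [norm_mul, norm_pow, Complex.norm_natCast, pow_succ ρ]
      have h1 : (σ k (n + 1) : ℝ) ≤ ((n + 1 : ℕ) : ℝ) ^ (k + 1) := by
        exact_mod_cast sigma_le_pow_succ k (n + 1)
      calc _ ≤ ((n + 1 : ℕ) : ℝ) ^ (k + 1) * ρ ^ n := by gcongr
        _ = _ := by field_simp)
  exact ((h q (by simpa using hqρ)).differentiableAt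
    (Metric.isOpen_ball.mem_nhds (by simpa using hqρ))).differentiableWithinAt

theorem bernoulli_ne_zero {k : ℕ} (hk : Even k) (hk2 : 2 ≤ k) : bernoulli k ≠ 0 := by
  intro h
  obtain ⟨m, rfl⟩ := hk
  have h1 := riemannZeta_two_mul_nat (k := m) (by omega)
  rw [two_mul m, h] at h1
  refine riemannZeta_ne_zero_of_one_lt_re (s := 2 * (m : ℂ)) ?_ (by simpa using h1)
  have : (1 : ℝ) ≤ m := by exact_mod_cast (by omega : 1 ≤ m)
  simp
  linarith

theorem exists_Ek_eq_nome {k : ℕ} (hk : Even k) (hk2 : 2 ≤ k) :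
    ∃ h : ℂ → ℂ, DifferentiableOn ℂ h (Metric.ball 0 1) ∧ h 0 ≠ 0 ∧
      ∀ z : ℂ, 0 < z.im → Ek k z = 1 + nome z * h (nome z) := by
  refine ⟨fun q => -(2 * (k : ℂ) / ((bernoulli k : ℚ) : ℂ)) *
    ∑' n : ℕ, (σ (k - 1) (n + 1) : ℂ) * q ^ n,
    (differentiableOn_tsum_sigma _).const_mul _, ?_, fun z hz => ?_⟩
  · beta_reduce
    rw [tsum_eq_single 0 (fun n hn => by simp [hn])]
    have : (k : ℂ) ≠ 0 := by exact_mod_cast (by omega : k ≠ 0)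
    simp [bernoulli_ne_zero hk hk2, this]
  · rw [Ek, tsum_sigma_eq_tsum_pnat, tsum_pnat_eq_tsum_succ
      (f := fun n : ℕ => (σ (k - 1) n : ℂ) * exp (2 * Real.pi * I * z) ^ n), nome]
    simp only [pow_succ, ← mul_assoc, tsum_mul_right]
    ring

theorem exists_iteratedDeriv_Ek_eq_nome {k : ℕ} (hk : Even k) (hk2 : 2 ≤ k) (j : ℕ) :
    ∃ h : ℂ → ℂ, DifferentiableOn ℂ h (Metric.ball 0 1) ∧ h 0 ≠ 0 ∧
      ∀ z : ℂ, 0 < z.im → iteratedDeriv (j + 1) (Ek k) z = nome z * h (nome z) := by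
  have key : ∀ (f h : ℂ → ℂ) (a : ℂ), DifferentiableOn ℂ h (Metric.ball 0 1) → h 0 ≠ 0 →
      (∀ z : ℂ, 0 < z.im → f z = a + nome z * h (nome z)) →
      ∃ h' : ℂ → ℂ, DifferentiableOn ℂ h' (Metric.ball 0 1) ∧ h' 0 ≠ 0 ∧
        ∀ z : ℂ, 0 < z.im → deriv f z = nome z * h' (nome z) := by
    intro f h a hd h0 hf
    refine ⟨fun q => 2 * Real.pi * I * (h q + q * deriv h q), ?_, ?_, fun z hz => ?_⟩
    · exact (hd.add (differentiableOn_id.mul (hd.deriv Metric.isOpen_ball))).const_mul _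
    · simp [h0, Real.pi_ne_zero]
    · have e : f =ᶠ[𝓝 z] fun z => a + nome z * h (nome z) := by
        filter_upwards [(isOpen_lt continuous_const Complex.continuous_im).mem_nhds hz] with w hw
          using hf w hw
      have hh := (hd.differentiableAt (Metric.isOpen_ball.mem_nhds (nome_mem_ball hz))).hasDerivAt
      rw [e.deriv_eq]
      refine ((((hasDerivAt_nome z).mul (hh.comp z (hasDerivAt_nome z))).const_add a).congr_deriv
        ?_).deriv
      simp only [Function.comp]
      ring
  induction j with
  | zero =>
    obtain ⟨h, hd, h0, hh⟩ := exists_Ek_eq_nome hk hk2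
    simpa using key _ h 1 hd h0 hh
  | succ j ih =>
    obtain ⟨h, hd, h0, hh⟩ := ih
    rw [iteratedDeriv_succ]
    exact key _ h 0 hd h0 (by simpa using hh)

end

section

open UpperHalfPlane hiding I
open Complex Filter Topology EisensteinSeries Derivative
open scoped Manifold MatrixGroups ModularForm

theorem tendsto_nome_atImInfty : Tendsto (fun τ : ℍ => nome τ) atImInfty (𝓝 0) := by
  rw [tendsto_zero_iff_norm_tendsto_zero]
  have h : ∀ τ : ℍ, ‖nome τ‖ = Real.exp (-(2 * Real.pi) * τ.im) := fun τ => by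
    rw [nome, norm_exp]
    simp
  simp only [h]
  exact Real.tendsto_exp_atBot.comp (tendsto_comap.const_mul_atTop_of_neg
    (by linarith [Real.pi_pos]))

theorem tendsto_comp_nome {h : ℂ → ℂ} (hd : DifferentiableOn ℂ h (Metric.ball 0 1)) :
    Tendsto (fun τ : ℍ => h (nome τ)) atImInfty (𝓝 (h 0)) :=
  (hd.differentiableAt (Metric.ball_mem_nhds 0 one_pos)).continuousAt.tendsto.comp
    tendsto_nome_atImInfty

theorem tendsto_Ek {k : ℕ} (hk : Even k) (hk2 : 2 ≤ k) :
    Tendsto (fun τ : ℍ => Ek k τ) atImInfty (𝓝 1) := by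
  obtain ⟨h, hd, -, hh⟩ := exists_Ek_eq_nome hk hk2
  have := (tendsto_nome_atImInfty.mul (tendsto_comp_nome hd)).const_add 1
  simp only [zero_mul, add_zero] at this
  exact this.congr fun τ => (hh τ τ.im_pos).symm

theorem tendsto_deriv_Ek {k : ℕ} (hk : Even k) (hk2 : 2 ≤ k) :
    Tendsto (fun τ : ℍ => deriv (Ek k) τ) atImInfty (𝓝 0) := by
  obtain ⟨h, hd, -, hh⟩ := exists_iteratedDeriv_Ek_eq_nome hk hk2 0
  have := tendsto_nome_atImInfty.mul (tendsto_comp_nome hd)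
  simp only [zero_mul] at this
  exact this.congr fun τ => by rw [← hh τ τ.im_pos, zero_add, iteratedDeriv_one]

theorem differentiableAt_Ek {k : ℕ} (hk : Even k) (hk2 : 2 ≤ k) {z : ℂ} (hz : 0 < z.im) :
    DifferentiableAt ℂ (Ek k) z := by
  obtain ⟨h, hd, -, hh⟩ := exists_Ek_eq_nome hk hk2
  have e : Ek k =ᶠ[𝓝 z] fun z => 1 + nome z * h (nome z) := by
    filter_upwards [(isOpen_lt continuous_const Complex.continuous_im).mem_nhds hz] with w hw
      using hh w hw
  have hq := hasDerivAt_nome z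
  exact ((hq.mul ((hd.differentiableAt (Metric.isOpen_ball.mem_nhds
    (nome_mem_ball hz))).hasDerivAt.comp z hq)).const_add 1).differentiableAt.congr_of_eventuallyEq e

theorem normalizedDerivOfComplex_eq {k : ℕ} {F : ℍ → ℂ} (h : ∀ τ : ℍ, Ek k τ = F τ) (τ : ℍ) :
    normalizedDerivOfComplex F τ = (2 * Real.pi * I)⁻¹ * deriv (Ek k) τ := by
  rw [normalizedDerivOfComplex]
  congr 1
  refine Filter.EventuallyEq.deriv_eq ?_
  filter_upwards [(isOpen_lt continuous_const Complex.continuous_im).mem_nhds τ.im_pos] with w hw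
  rw [comp_ofComplex_of_im_pos _ _ hw, ← h]

theorem eq_zero_of_slash_eq_of_tendsto {k : ℤ} (hk : k < 12) {f : ℍ → ℂ} (hd : MDiff f)
    (hs : ∀ γ : SL(2, ℤ), f ∣[k] γ = f) (h0 : Tendsto f atImInfty (𝓝 0)) : f = 0 := by
  let F : CuspForm 𝒮ℒ k :=
    { toFun := f
      slash_action_eq' := by
        rintro _ ⟨γ, rfl⟩
        exact hs γ
      holo' := hd
      zero_at_cusps' := fun hc => by
        rw [Subgroup.IsArithmetic.isCusp_iff_isCusp_SL2Z] at hc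
        rw [OnePoint.isZeroAt_iff_forall_SL2Z hc]
        intro γ _
        rw [hs]
        exact h0 }
  have := rank_zero_iff_forall_zero.mp (CuspForm.rank_eq_zero_of_weight_lt_twelve hk) F
  exact congrArg DFunLike.coe this

theorem ModularForm.slash_SL {k : ℤ} (f : ModularForm 𝒮ℒ k) (γ : SL(2, ℤ)) : ⇑f ∣[k] γ = f :=
  f.slash_action_eq' _ ⟨γ, rfl⟩

theorem serreDerivative_E_add_smul_eq_zero {k l : ℕ} (hk : Even k) (hk2 : 3 ≤ k) {G : ℍ → ℂ}
    (hl : l = k + 2) (hl' : l < 12) (hG : MDiff G) (hGs : ∀ γ : SL(2, ℤ), G ∣[(l : ℤ)] γ = G)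
    (hGt : Tendsto G atImInfty (𝓝 1)) (τ : ℍ) :
    (2 * Real.pi * I)⁻¹ * deriv (Ek k) τ = k / 12 * (Ek 2 τ * Ek k τ - G τ) := by
  have hE := fun τ : ℍ => Ek_eq_E hk2 hk τ
  have h := eq_zero_of_slash_eq_of_tendsto (k := l) (by exact_mod_cast hl')
    (f := serreDerivative (k : ℤ) (ModularForm.E hk2) + ((k : ℂ) / 12) • G) ?_ ?_ ?_
  · have := congrFun h τ
    simp only [Pi.add_apply, Pi.smul_apply, serreDerivative_apply, Pi.zero_apply, smul_eq_mul] at this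
    rw [normalizedDerivOfComplex_eq hE, ← hE, ← Ek_two] at this
    push_cast at this
    linear_combination this
  · exact (serreDerivative_mdifferentiable _ (ModularForm.E hk2).holo').add (hG.const_smul _)
  · intro γ
    have h1 := serreDerivative_slash_invariant (k := k) (ModularForm.E hk2).holo' (γ := γ)
      ((ModularForm.E hk2).slash_SL γ)
    rw [SlashAction.add_slash, ModularForm.SL_smul_slash, hGs]
    have e : (l : ℤ) = (k : ℤ) + 2 := by exact_mod_cast hl
    rw [e]
    congr 1
  · have h2 := (((tendsto_deriv_Ek hk (by omega)).const_mul (2 * Real.pi * I)⁻¹).sub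
      (((tendsto_Ek even_two le_rfl).mul (tendsto_Ek hk (by omega))).const_mul
        ((k : ℂ) / 12))).add (hGt.const_mul ((k : ℂ) / 12))
    simp only [mul_zero, mul_one, zero_sub, neg_add_cancel] at h2
    refine h2.congr fun τ => ?_
    simp only [Pi.add_apply, Pi.smul_apply, serreDerivative_apply, smul_eq_mul]
    rw [normalizedDerivOfComplex_eq hE, ← hE, ← Ek_two]
    push_cast
    ring

theorem deriv_Ek_four (τ : ℍ) :
    (2 * Real.pi * I)⁻¹ * deriv (Ek 4) τ = 1 / 3 * (Ek 2 τ * Ek 4 τ - Ek 6 τ) := by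
  have e6 : Even 6 := by decide
  have h := serreDerivative_E_add_smul_eq_zero (k := 4) (l := 6) (by decide) (by norm_num) rfl
    (by norm_num) (ModularForm.E (k := 6) (by norm_num)).holo' (ModularForm.slash_SL _)
    ((tendsto_Ek e6 (by norm_num)).congr fun τ => Ek_eq_E (by norm_num) e6 τ) τ
  have e := Ek_eq_E (k := 6) (by norm_num) e6 τ
  rw [h]
  erw [← e]
  norm_num

theorem deriv_Ek_six (τ : ℍ) :
    (2 * Real.pi * I)⁻¹ * deriv (Ek 6) τ = 1 / 2 * (Ek 2 τ * Ek 6 τ - Ek 4 τ ^ 2) := by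
  have e4 : Even 4 := by decide
  set f := ModularForm.E (k := 4) (by norm_num) with hf
  have he := fun τ => Ek_eq_E (k := 4) (by norm_num) e4 τ
  have h := serreDerivative_E_add_smul_eq_zero (k := 6) (l := 8) (by decide) (by norm_num) rfl
    (by norm_num) (f.mul f).holo' (ModularForm.slash_SL (f.mul f))
    (by
      have := (tendsto_Ek e4 (by norm_num)).mul (tendsto_Ek e4 (by norm_num))
      rw [one_mul] at this
      refine this.congr fun τ => ?_
      rw [he]
      rfl) τ
  rw [h]
  have : (f.mul f).toSlashInvariantForm τ = f τ * f τ := rfl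
  rw [this, ← he]
  norm_num
  ring

theorem hasDerivAt_D2 (γ : SL(2, ℤ)) (τ : ℍ) :
    normalizedDerivOfComplex (D2 γ) τ = -((γ 1 0 : ℂ) / denom γ τ) ^ 2 := by
  have hz := denom_ne_zero γ τ
  have h : HasDerivAt (fun w : ℂ => 2 * Real.pi * I * (γ 1 0 : ℂ) / ((γ 1 0 : ℂ) * w + γ 1 1))
      (-(2 * Real.pi * I * (γ 1 0 : ℂ) ^ 2) / ((γ 1 0 : ℂ) * τ + γ 1 1) ^ 2) τ := by
    refine ((hasDerivAt_const (τ : ℂ) (2 * Real.pi * I * (γ 1 0 : ℂ))).fun_div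
      (((hasDerivAt_id (τ : ℂ)).const_mul (γ 1 0 : ℂ)).add_const (γ 1 1 : ℂ)) ?_).congr_deriv ?_
    · simpa [denom] using hz
    · simp
      ring
  have e : D2 γ ∘ ofComplex =ᶠ[𝓝 (τ : ℂ)]
      fun w : ℂ => 2 * Real.pi * I * (γ 1 0 : ℂ) / ((γ 1 0 : ℂ) * w + γ 1 1) := by
    filter_upwards [(isOpen_lt continuous_const Complex.continuous_im).mem_nhds τ.im_pos] with w hw
    rw [comp_ofComplex_of_im_pos _ _ hw]
    simp [D2, denom]
  rw [normalizedDerivOfComplex, e.deriv_eq, h.deriv]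
  have : denom γ τ = (γ 1 0 : ℂ) * τ + γ 1 1 := by simp [denom]
  rw [this] at hz ⊢
  have := Real.pi_ne_zero
  field_simp

theorem mdifferentiable_D2 (γ : SL(2, ℤ)) : MDiff (D2 γ) := by
  have h1 := E2_slash_action γ
  have h2 : D2 γ = (2 * riemannZeta 2) • (E2 - E2 ∣[(2 : ℤ)] γ) := by
    have : riemannZeta 2 ≠ 0 := riemannZeta_ne_zero_of_one_lt_re (by simp)
    rw [h1, sub_sub_cancel, smul_smul, mul_one_div_cancel (by simpa using this), one_smul]
  rw [h2]
  exact (E2_mdifferentiable.sub (E2_mdifferentiable.slash _ _)).const_smul _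

theorem deriv_Ek_two (τ : ℍ) :
    (2 * Real.pi * I)⁻¹ * deriv (Ek 2) τ = 1 / 12 * (Ek 2 τ ^ 2 - Ek 4 τ) := by
  have e4 : Even 4 := by decide
  set f := ModularForm.E (k := 4) (by norm_num) with hf
  have he := fun τ => Ek_eq_E (k := 4) (by norm_num) e4 τ
  have h := eq_zero_of_slash_eq_of_tendsto (k := 4) (by norm_num)
    (f := normalizedDerivOfComplex E2 - (1 / 12 : ℂ) • (E2 * E2) + (1 / 12 : ℂ) • ⇑f) ?_ ?_ ?_
  · have := congrFun h τ
    simp only [Pi.add_apply, Pi.smul_apply, Pi.sub_apply, Pi.mul_apply, Pi.zero_apply,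
      smul_eq_mul] at this
    rw [normalizedDerivOfComplex_eq Ek_two, ← Ek_two, ← he] at this
    linear_combination this
  · exact ((normalizedDerivOfComplex_mdifferentiable E2_mdifferentiable).sub
      ((E2_mdifferentiable.mul E2_mdifferentiable).const_smul _)).add (f.holo'.const_smul _)
  · intro γ
    have h1 := normalizedDerivOfComplex_SL_slash (k := 2) E2_mdifferentiable (γ := γ)
    have h2 := E2_slash_action γ
    rw [h2, normalizedDerivOfComplex_sub _ _ E2_mdifferentiable
      ((mdifferentiable_D2 γ).const_smul _),
      normalizedDerivOfComplex_smul _ _ (mdifferentiable_D2 γ)] at h1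
    have h3 := ModularForm.mul_slash_SL2 2 2 γ E2 E2
    rw [h2] at h3
    rw [SlashAction.add_slash, sub_eq_add_neg, SlashAction.add_slash, SlashAction.neg_slash,
      ← sub_eq_add_neg, ModularForm.SL_smul_slash,
      ModularForm.SL_smul_slash]
    have h4 : ⇑f ∣[(4 : ℤ)] γ = f := ModularForm.slash_SL f γ
    rw [h4]
    congr 1
    ext w
    have h5 := congrFun h1 w
    have h6 := congrFun h3 w
    simp only [Pi.sub_apply, Pi.smul_apply, Pi.mul_apply, smul_eq_mul, hasDerivAt_D2] at h5 h6 ⊢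
    norm_num at h5 h6
    rw [h6]
    have hz := denom_ne_zero γ w
    have := Real.pi_ne_zero
    simp only [Pi.add_apply, Pi.neg_apply, Pi.smul_apply, Pi.mul_apply, smul_eq_mul]
    rw [eq_sub_of_add_eq h5, riemannZeta_two, D2]
    field_simp
    ring_nf
    simp only [I_sq]
    ring
  · have h2 := (((tendsto_deriv_Ek even_two le_rfl).const_mul (2 * Real.pi * I)⁻¹).sub
      (((tendsto_Ek even_two le_rfl).mul (tendsto_Ek even_two le_rfl)).const_mul
        (1 / 12 : ℂ))).add ((tendsto_Ek e4 (by norm_num)).const_mul (1 / 12 : ℂ))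
    simp only [mul_zero, mul_one, zero_sub, neg_add_cancel] at h2
    refine h2.congr fun τ => ?_
    simp only [Pi.add_apply, Pi.smul_apply, Pi.sub_apply, Pi.mul_apply, smul_eq_mul]
    rw [normalizedDerivOfComplex_eq Ek_two, ← Ek_two, ← he]

end

section

open UpperHalfPlane hiding I
open Complex Filter Topology MvPolynomial

/-- The vector `(E₂(z), E₄(z), E₆(z))`. -/
noncomputable def eisVec (z : ℂ) : Fin 3 → ℂ := ![Ek 2 z, Ek 4 z, Ek 6 z]

theorem hasDerivAt_eisVec {z : ℂ} (hz : 0 < z.im) (i : Fin 3) :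
    HasDerivAt (fun z => eisVec z i) (2 * Real.pi * I * aeval (eisVec z) (ramanujanD (X i))) z := by
  have hne : 2 * (Real.pi : ℂ) * I ≠ 0 := by simp [Real.pi_ne_zero]
  have h2 := deriv_Ek_two ⟨z, hz⟩
  have h4 := deriv_Ek_four ⟨z, hz⟩
  have h6 := deriv_Ek_six ⟨z, hz⟩
  rw [inv_mul_eq_iff_eq_mul₀ hne] at h2 h4 h6
  have e4 : Even 4 := by decide
  have e6 : Even 6 := by decide
  fin_cases i
  · refine (differentiableAt_Ek even_two le_rfl hz).hasDerivAt.congr_deriv (h2.trans ?_)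
    simp [RamanujanD.D_X0, eisVec]
  · refine (differentiableAt_Ek e4 (by norm_num) hz).hasDerivAt.congr_deriv (h4.trans ?_)
    simp [RamanujanD.D_X1, eisVec]
  · refine (differentiableAt_Ek e6 (by norm_num) hz).hasDerivAt.congr_deriv (h6.trans ?_)
    simp [RamanujanD.D_X2, eisVec]

theorem hasDerivAt_aeval_eisVec (P : MvPolynomial (Fin 3) ℚ) {z : ℂ} (hz : 0 < z.im) :
    HasDerivAt (fun z => aeval (eisVec z) P) (2 * Real.pi * I * aeval (eisVec z) (ramanujanD P))
      z := by
  induction P using MvPolynomial.induction_on with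
  | C a =>
    have : ramanujanD (C a) = 0 := Derivation.map_algebraMap _ a
    simpa [this] using hasDerivAt_const z (a : ℂ)
  | add P Q hP hQ =>
    simpa [mul_add] using hP.fun_add hQ
  | mul_X P i hP =>
    have := hP.fun_mul (hasDerivAt_eisVec hz i)
    simp only [map_mul, aeval_X, Derivation.leibniz, smul_eq_mul, map_add] at this ⊢
    refine this.congr_deriv ?_
    ring

theorem iteratedDeriv_aeval_eisVec {f : ℂ → ℂ} {P : MvPolynomial (Fin 3) ℚ}
    (hf : ∀ z : ℂ, 0 < z.im → f z = aeval (eisVec z) P) (n : ℕ) {z : ℂ} (hz : 0 < z.im) :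
    iteratedDeriv n f z = (2 * Real.pi * I) ^ n * aeval (eisVec z) (ramanujanD^[n] P) := by
  induction n generalizing z with
  | zero => simpa using hf z hz
  | succ n ih =>
    rw [iteratedDeriv_succ, Function.iterate_succ_apply']
    have e : iteratedDeriv n f =ᶠ[𝓝 z]
        fun z => (2 * Real.pi * I) ^ n * aeval (eisVec z) (ramanujanD^[n] P) := by
      filter_upwards [(isOpen_lt continuous_const Complex.continuous_im).mem_nhds hz] with w hw
        using ih hw
    rw [e.deriv_eq, ((hasDerivAt_aeval_eisVec _ hz).const_mul _).deriv]
    ring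

end

section

open UpperHalfPlane hiding I
open Complex Filter Topology EisensteinSeries ModularForm
open scoped MatrixGroups

/-- The ring of power series with rational coefficients, inside `ℂ⟦X⟧`. -/
noncomputable def ratSeries : Subring (PowerSeries ℂ) :=
  (PowerSeries.map (algebraMap ℚ ℂ)).range

theorem E_qExpansion_mem_ratSeries {k : ℕ} (hk : 3 ≤ k) (hk2 : Even k) :
    qExpansion 1 (E hk) ∈ ratSeries := by
  refine ⟨PowerSeries.mk fun m => if m = 0 then 1 else
    -(2 * k / bernoulli k) * ArithmeticFunction.sigma (k - 1) m, ?_⟩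
  ext m
  rw [E_qExpansion_coeff hk hk2, PowerSeries.coeff_map, PowerSeries.coeff_mk]
  split_ifs <;> simp

theorem qExpansion_discriminant :
    qExpansion 1 CuspForm.discriminant =
      PowerSeries.C ((1 / 1728 : ℚ) : ℂ) * (qExpansion 1 E₄ ^ 3 - qExpansion 1 E₆ ^ 2) := by
  have h1 := one_mem_strictPeriods_SL
  have e : ⇑CuspForm.discriminant = (1 / 1728 : ℂ) • ((E₄.pow 3).mcast (b := 12) (by norm_num) -
      (E₆.pow 2).mcast (b := 12) (by norm_num) : ModularForm 𝒮ℒ 12) := by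
    ext τ
    have := discriminant_eq_E₄_cube_sub_E₆_sq τ
    simp only [CuspForm.coe_discriminant, this, Pi.smul_apply, sub_apply, coe_mcast, coe_pow,
      Pi.pow_apply, smul_eq_mul]
    ring
  rw [e, ModularForm.qExpansion_smul one_pos h1, FunLike.coe_sub,
    ModularForm.qExpansion_sub one_pos h1, coe_mcast, coe_mcast,
    ModularForm.qExpansion_pow one_pos h1, ModularForm.qExpansion_pow one_pos h1,
    PowerSeries.smul_eq_C_mul]
  norm_num

theorem qExpansion_discriminant_mem_ratSeries : qExpansion 1 CuspForm.discriminant ∈ ratSeries := by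
  rw [qExpansion_discriminant]
  refine mul_mem ⟨PowerSeries.C (1 / 1728), by simp⟩ (sub_mem (pow_mem ?_ _) (pow_mem ?_ _))
  · exact E_qExpansion_mem_ratSeries _ (by decide)
  · exact E_qExpansion_mem_ratSeries _ (by decide)

theorem mem_ratSeries_of_discriminant_mul {g : PowerSeries ℂ}
    (h : qExpansion 1 CuspForm.discriminant * g ∈ ratSeries) : g ∈ ratSeries := by
  obtain ⟨p, hp⟩ := h
  obtain ⟨d, hd⟩ := qExpansion_discriminant_mem_ratSeries
  have hd0 : PowerSeries.constantCoeff d = 0 := by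
    have h1 := CuspFormClass.qExpansion_coeff_zero CuspForm.discriminant one_pos
      one_mem_strictPeriods_SL
    rw [← hd] at h1
    simpa using h1
  obtain ⟨u, rfl⟩ := PowerSeries.X_dvd_iff.2 hd0
  have hu : PowerSeries.constantCoeff u = 1 := by
    have h1 := discriminant_qExpansion_coeff_one
    rw [← CuspForm.coe_discriminant, ← hd] at h1
    have h2 : (algebraMap ℚ ℂ) (PowerSeries.constantCoeff u) = 1 := by
      rw [← h1, PowerSeries.coeff_map, mul_comm, ← zero_add 1, PowerSeries.coeff_succ_mul_X,
        PowerSeries.coeff_zero_eq_constantCoeff_apply]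
    exact (algebraMap ℚ ℂ).injective (by rw [h2, map_one])
  rw [← hd] at hp
  have hp0 : PowerSeries.constantCoeff p = 0 := by
    have := congrArg (PowerSeries.coeff 0) hp
    rw [PowerSeries.coeff_map, PowerSeries.coeff_zero_eq_constantCoeff_apply,
      PowerSeries.coeff_zero_eq_constantCoeff_apply, map_mul (PowerSeries.constantCoeff),
      map_mul (PowerSeries.map _), map_mul (PowerSeries.constantCoeff), PowerSeries.map_X,
      PowerSeries.constantCoeff_X, zero_mul, zero_mul] at this
    exact (map_eq_zero (algebraMap ℚ ℂ)).1 this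
  obtain ⟨v, rfl⟩ := PowerSeries.X_dvd_iff.2 hp0
  rw [map_mul, map_mul, PowerSeries.map_X, mul_assoc] at hp
  have hv := mul_left_cancel₀ PowerSeries.X_ne_zero hp
  refine ⟨u⁻¹ * v, ?_⟩
  rw [map_mul, hv, ← mul_assoc, ← map_mul, PowerSeries.inv_mul_cancel _ (by simp [hu]), map_one,
    one_mul]

theorem exists_polynomial_of_mem_ratSeries (n : ℕ) : ∀ (k : ℤ), k = 2 * n →
    ∀ f : ModularForm 𝒮ℒ k, qExpansion 1 f ∈ ratSeries →
    ∃ P : MvPolynomial (Fin 3) ℚ, MvPolynomial.pderiv 0 P = 0 ∧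
      P.IsWeightedHomogeneous RamanujanD.wt n ∧
      ∀ τ : ℍ, MvPolynomial.aeval (eisVec τ) P = f τ := by
  have h1 := one_mem_strictPeriods_SL
  have e4 : ∀ τ : ℍ, Ek 4 τ = E₄ τ := fun τ => Ek_eq_E _ (by decide) τ
  have e6 : ∀ τ : ℍ, Ek 6 τ = E₆ τ := fun τ => Ek_eq_E _ (by decide) τ
  have hX1 : (MvPolynomial.X 1 : MvPolynomial (Fin 3) ℚ).IsWeightedHomogeneous RamanujanD.wt 2 :=
    MvPolynomial.isWeightedHomogeneous_X ..
  have hX2 : (MvPolynomial.X 2 : MvPolynomial (Fin 3) ℚ).IsWeightedHomogeneous RamanujanD.wt 3 :=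
    MvPolynomial.isWeightedHomogeneous_X ..
  induction n using Nat.strong_induction_on with | _ n ih =>
  rintro k rfl f hf
  by_cases hn1 : n = 1
  · subst hn1
    have : f = 0 := rank_zero_iff_forall_zero.mp levelOne_weight_two_rank_zero f
    exact ⟨0, by simp, MvPolynomial.isWeightedHomogeneous_zero .., by simp [this]⟩
  obtain ⟨a, b, hab⟩ : ∃ a b : ℕ, 2 * a + 3 * b = n := by
    obtain ⟨m, rfl | rfl⟩ := Nat.even_or_odd' n
    · exact ⟨m, 0, by ring⟩
    · exact ⟨m - 1, 1, by omega⟩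
  let M : ModularForm 𝒮ℒ (2 * n) := ((E₄.pow a).mul (E₆.pow b)).mcast (by
    rw [← hab]; push_cast; ring)
  have hM : qExpansion 1 M = qExpansion 1 E₄ ^ a * qExpansion 1 E₆ ^ b := by
    rw [coe_mcast, ModularForm.qExpansion_mul one_pos h1, ModularForm.qExpansion_pow one_pos h1,
      ModularForm.qExpansion_pow one_pos h1]
  have hMr : qExpansion 1 M ∈ ratSeries := by
    rw [hM]
    exact mul_mem (pow_mem (E_qExpansion_mem_ratSeries _ (by decide)) _)
      (pow_mem (E_qExpansion_mem_ratSeries _ (by decide)) _)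
  have hMv : ∀ τ : ℍ, M τ = Ek 4 τ ^ a * Ek 6 τ ^ b := fun τ => by
    rw [e4, e6, coe_mcast, coe_mul, coe_pow, coe_pow]
    rfl
  have hM0 : (qExpansion 1 M).coeff 0 = 1 := by
    rw [hM, PowerSeries.coeff_zero_eq_constantCoeff_apply, map_mul, map_pow, map_pow,
      ← PowerSeries.coeff_zero_eq_constantCoeff_apply,
      ← PowerSeries.coeff_zero_eq_constantCoeff_apply,
      E_qExpansion_coeff_zero _ (by decide), E_qExpansion_coeff_zero _ (by decide)]
    simp
  obtain ⟨p, hp⟩ := hf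
  set c : ℚ := p.coeff 0 with hc
  set F : ModularForm 𝒮ℒ (2 * n) := f - (c : ℂ) • M with hF
  have hq : qExpansion 1 F = qExpansion 1 f - (c : ℂ) • qExpansion 1 M := by
    rw [hF, FunLike.coe_sub, ModularForm.qExpansion_sub one_pos h1]
    congr 1
    exact ModularForm.qExpansion_smul one_pos h1 _ M
  have h0 : (qExpansion 1 F).coeff 0 = 0 := by
    rw [hq, ← hp, map_sub, PowerSeries.coeff_map, PowerSeries.coeff_smul, hM0]
    simp [hc]
  have hmul := qExpansion_eq_qExpansion_discriminant_mul F h0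
  have happ : ∀ τ, f τ = (c : ℂ) * M τ + discriminant τ *
      CuspForm.discriminantEquiv (toCuspForm F h0) τ := fun τ => by
    rw [discriminant_mul_discriminantEquiv_apply, toCuspForm_apply]
    change f τ = (c : ℂ) * M τ + (f τ - (c : ℂ) * M τ)
    ring
  set g := CuspForm.discriminantEquiv (toCuspForm F h0) with hg
  have hgr : qExpansion 1 g ∈ ratSeries := by
    refine mem_ratSeries_of_discriminant_mul ?_
    rw [CuspForm.coe_discriminant, ← hmul, hq, PowerSeries.smul_eq_C_mul]
    exact sub_mem ⟨p, hp⟩ (mul_mem ⟨PowerSeries.C c, by simp⟩ hMr)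
  have mono : (MvPolynomial.C c * (MvPolynomial.X 1 ^ a * MvPolynomial.X 2 ^ b) :
      MvPolynomial (Fin 3) ℚ).IsWeightedHomogeneous RamanujanD.wt n := by
    have := (MvPolynomial.isWeightedHomogeneous_C RamanujanD.wt c).mul
      ((hX1.pow a).mul (hX2.pow b))
    convert! this using 1
    simp only [smul_eq_mul]
    omega
  by_cases hn : n < 6
  · have hg0 : g = 0 := rank_zero_iff_forall_zero.mp (levelOne_neg_weight_rank_zero (by omega)) g
    refine ⟨MvPolynomial.C c * (MvPolynomial.X 1 ^ a * MvPolynomial.X 2 ^ b), ?_, mono,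
      fun τ => ?_⟩
    · simp [Derivation.leibniz, Derivation.leibniz_pow, MvPolynomial.pderiv_X]
    · rw [happ, hg0, hMv]
      simp [eisVec]
  · obtain ⟨Q, hQ0, hQw, hQ⟩ := ih (n - 6) (by omega) (2 * n - 12) (by omega) g hgr
    have hΔ : (MvPolynomial.X 1 ^ 3 - MvPolynomial.X 2 ^ 2 :
        MvPolynomial (Fin 3) ℚ).IsWeightedHomogeneous RamanujanD.wt 6 :=
      (hX1.pow 3).sub (hX2.pow 2)
    refine ⟨MvPolynomial.C c * (MvPolynomial.X 1 ^ a * MvPolynomial.X 2 ^ b) +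
      MvPolynomial.C (1 / 1728) * (MvPolynomial.X 1 ^ 3 - MvPolynomial.X 2 ^ 2) * Q, ?_,
      mono.add ?_, fun τ => ?_⟩
    · simp [Derivation.leibniz, Derivation.leibniz_pow, MvPolynomial.pderiv_X, hQ0]
    · have := ((MvPolynomial.isWeightedHomogeneous_C RamanujanD.wt (1 / 1728 : ℚ)).mul hΔ).mul hQw
      convert! this using 1
      omega
    · rw [happ, ← hQ, hMv, discriminant_eq_E₄_cube_sub_E₆_sq, ← e4, ← e6]
      simp only [eisVec, map_add, map_mul, map_sub, map_pow, MvPolynomial.aeval_X,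
        MvPolynomial.aeval_C, Matrix.cons_val, eq_ratCast]
      push_cast
      ring

theorem exists_polynomial_Ek {k : ℕ} (hk : Even k) (hk3 : 3 ≤ k) :
    ∃ P : MvPolynomial (Fin 3) ℚ, MvPolynomial.pderiv 0 P = 0 ∧
      P.IsWeightedHomogeneous RamanujanD.wt (k / 2) ∧
      ∀ z : ℂ, 0 < z.im → Ek k z = MvPolynomial.aeval (eisVec z) P := by
  obtain ⟨P, h0, hw, hP⟩ := exists_polynomial_of_mem_ratSeries (k / 2) k
    (by have := Nat.two_mul_div_two_of_even hk; omega) (E hk3) (E_qExpansion_mem_ratSeries hk3 hk)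
  exact ⟨P, h0, hw, fun z hz => (Ek_eq_E hk3 hk ⟨z, hz⟩).trans (hP ⟨z, hz⟩).symm⟩

end

section

open UpperHalfPlane hiding I
open Complex EisensteinSeries
open scoped ArithmeticFunction.sigma

theorem tauPair_G (τ : ℍ) (k : ℕ) :
    (tauPair τ τ.im_pos).G k = ∑' v : Fin 2 → ℤ, eisSummand k v τ := by
  rw [PeriodPair.G, ← (((finTwoArrowEquiv ℤ).trans (Equiv.prodComm ℤ ℤ)).trans
    (tauPair τ τ.im_pos).latticeEquivProd.symm.toEquiv).tsum_eq]
  refine tsum_congr fun v => ?_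
  have := (tauPair τ τ.im_pos).latticeEquiv_symm_apply (v 1, v 0)
  simp only [tauPair] at this
  simp only [eisSummand, zpow_neg, zpow_natCast, Equiv.trans_apply, finTwoArrowEquiv_apply,
    Equiv.prodComm_apply]
  congr 2
  refine this.trans ?_
  ring

theorem tauPair_G_eq_zeta (τ : ℍ) {k : ℕ} (hk : 3 ≤ k) (hk2 : Even k) :
    (tauPair τ τ.im_pos).G k = 2 * riemannZeta k * Ek k τ := by
  rw [tauPair_G, tsum_eisSummand_eq_riemannZeta_mul_eisensteinSeries hk, Ek_eq_E hk hk2]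
  have : ModularForm.E hk τ = (1 / 2 : ℂ) * eisensteinSeriesSIF (N := 1) 0 k τ := rfl
  rw [this, eisensteinSeriesSIF_apply]
  ring

theorem tsum_koebe {q : ℂ} (hq : ‖q‖ < 1) :
    ∑' n : ℕ, koebe (q ^ (n + 1)) = ∑' n : ℕ+, (σ 1 n : ℂ) * q ^ (n : ℕ) := by
  rw [← tsum_prod_pow_eq_tsum_sigma 1 hq,
    tsum_pnat_eq_tsum_succ (f := fun d : ℕ => ∑' c : ℕ+, ((c : ℕ) : ℂ) ^ 1 * q ^ (d * (c : ℕ)))]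
  refine tsum_congr fun n => ?_
  have hn : ‖q ^ (n + 1)‖ < 1 := by
    rw [norm_pow]
    exact pow_lt_one₀ (norm_nonneg _) hq (Nat.succ_ne_zero _)
  rw [koebe, ← tsum_coe_mul_geometric_of_norm_lt_one hn]
  refine Eq.trans ?_ (tsum_congr fun c : ℕ+ => by rw [pow_one, pow_mul])
  refine (PNat.coe_injective.tsum_eq (f := fun c : ℕ => (c : ℂ) * (q ^ (n + 1)) ^ c)
    fun c hc => ?_).symm
  exact ⟨⟨c, Nat.pos_of_ne_zero (by rintro rfl; simp at hc)⟩, rfl⟩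

theorem latticeG2_eq (τ : ℍ) : latticeG2 τ = Real.pi ^ 2 / 3 * Ek 2 τ := by
  rw [latticeG2, tsum_koebe (norm_expTwoPi_lt_one τ.im_pos), Ek_two, E2_eq_tsum_cexp]
  simp only [expTwoPi]
  ring

theorem riemannZeta_six : riemannZeta 6 = Real.pi ^ 6 / 945 := by
  have := riemannZeta_two_mul_nat (k := 3) (by norm_num)
  norm_num at this
  rw [this, bernoulli_eq_bernoulli'_of_ne_one (by norm_num)]
  have h6 : bernoulli' 6 = 1 / 42 := by
    rw [bernoulli'_def]
    norm_num [Finset.sum_range_succ, Nat.choose, bernoulli'_eq_zero_of_odd (n := 5) (by decide) (by norm_num)]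
  rw [h6]
  norm_num [Nat.factorial]
  ring

/-- No common rescaling makes all three of `E₂`, `E₄`, `E₆` algebraic at a point. -/
theorem not_isAlgebraic_Ek {z s : ℂ} (hz : 0 < z.im) (hs : s ≠ 0)
    (h2 : IsAlgebraic ℚ (s * Ek 2 z)) (h4 : IsAlgebraic ℚ (s ^ 2 * Ek 4 z))
    (h6 : IsAlgebraic ℚ (s ^ 3 * Ek 6 z)) : False := by
  lift z to ℍ using hz
  obtain ⟨μ, hμ⟩ : ∃ μ : ℂ, μ ^ 2 = Real.pi ^ 2 / s :=
    ⟨_, Complex.cpow_nat_inv_pow _ two_ne_zero⟩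
  have hpi : (Real.pi : ℂ) ≠ 0 := by exact_mod_cast Real.pi_ne_zero
  have hμ0 : μ ≠ 0 := by
    rintro rfl
    have : (Real.pi : ℂ) ^ 2 / s ≠ 0 := by positivity
    simp at hμ
    tauto
  have hG4 := tauPair_G_eq_zeta z (k := 4) (by norm_num) (by decide)
  have hG6 := tauPair_G_eq_zeta z (k := 6) (by norm_num) (by decide)
  push_cast at hG4 hG6
  rw [riemannZeta_four] at hG4
  rw [riemannZeta_six] at hG6
  have alg (q : ℚ) : IsAlgebraic ℚ (q : ℂ) := isAlgebraic_algebraMap q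
  refine Theta.not_isAlgebraic_invariants z.im_pos hμ0 ?_ ?_ ?_
  · convert! (alg (1 / 3)).mul h2 using 1
    rw [latticeG2_eq, hμ]
    push_cast
    field_simp
  · convert! (alg (4 / 3)).mul h4 using 1
    rw [PeriodPair.g₂, hG4, show μ ^ 4 = (μ ^ 2) ^ 2 by ring, hμ]
    push_cast
    field_simp
    ring
  · convert! (alg (8 / 27)).mul h6 using 1
    rw [PeriodPair.g₃, hG6, show μ ^ 6 = (μ ^ 2) ^ 3 by ring, hμ]
    push_cast
    field_simp
    ring

end

section

namespace LatticeBound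

/-- Representatives, up to sign, of the lattice points off the lines `c = 0`, `d = 0`, `c + d = 0`. -/
def coneVec : Fin 3 → ℤ → ℤ → ℤ × ℤ := ![fun a b => (a, b), fun a b => (a, -(a + b)),
  fun a b => (a + b, -a)]

/-- All lattice points off the lines `c = 0`, `d = 0`, `c + d = 0`. -/
def signedConeVec (x : (Bool × Fin 3) × (ℕ × ℕ)) : ℤ × ℤ :=
  (if x.1.1 then 1 else -1 : ℤ) • coneVec x.1.2 (x.2.1 + 1) (x.2.2 + 1)

theorem signedConeVec_injective : Function.Injective signedConeVec := by
  rintro ⟨⟨s, i⟩, a, b⟩ ⟨⟨s', i'⟩, a', b'⟩ h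
  rw [Prod.ext_iff] at h
  fin_cases i <;> fin_cases i' <;> cases s <;> cases s' <;>
    simp [signedConeVec, coneVec] at h ⊢ <;> omega

theorem mem_range_signedConeVec {c d : ℤ} (hc : c ≠ 0) (hd : d ≠ 0) (hcd : c + d ≠ 0) :
    (c, d) ∈ Set.range signedConeVec := by
  wlog h : 0 < c generalizing c d
  · obtain ⟨⟨⟨s, i⟩, a⟩, hx⟩ := this (c := -c) (d := -d) (by omega) (by omega) (by omega) (by omega)
    refine ⟨((!s, i), a), ?_⟩
    simp only [signedConeVec, Prod.ext_iff] at hx ⊢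
    cases s <;> simp at hx ⊢ <;> omega
  rcases lt_or_gt_of_ne hd with hd | hd
  · rcases lt_or_gt_of_ne hcd with hcd | hcd
    · refine ⟨((true, 1), (c - 1).toNat, (-c - d - 1).toNat), ?_⟩
      simp only [signedConeVec, coneVec, Prod.ext_iff]
      simp
      omega
    · refine ⟨((true, 2), (-d - 1).toNat, (c + d - 1).toNat), ?_⟩
      simp only [signedConeVec, coneVec, Prod.ext_iff]
      simp
      omega
  · refine ⟨((true, 0), (c - 1).toNat, (d - 1).toNat), ?_⟩
    simp only [signedConeVec, coneVec, Prod.ext_iff]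
    simp
    omega

/-- The lower bound for `‖c τ + d‖ ^ 2` on the right half of the standard fundamental domain. -/
noncomputable def normBound (c d : ℤ) : ℝ := if c * d < 0 then c ^ 2 + c * d + d ^ 2 else c ^ 2 + d ^ 2

/-- The majorant for the general term of the lattice sum. -/
noncomputable def majorant (v : ℤ × ℤ) : ℝ := |(v.2 * (v.1 + v.2) : ℝ)| / normBound v.1 v.2 ^ 3

theorem majorant_neg (v : ℤ × ℤ) : majorant (-v) = majorant v := by
  rw [majorant, majorant, normBound, normBound]
  simp only [Prod.fst_neg, Prod.snd_neg, Int.cast_neg, neg_mul_neg, neg_sq, ← neg_add]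

theorem majorant_signedConeVec (s : Bool) (i : Fin 3) (m n : ℕ) :
    majorant (signedConeVec ((s, i), m, n)) = majorant (coneVec i (m + 1) (n + 1)) := by
  cases s
  · rw [← majorant_neg]
    simp [signedConeVec]
  · simp [signedConeVec]

theorem normBound_of_neg {c d : ℤ} (h : c * d < 0) :
    normBound c d = c ^ 2 + c * d + d ^ 2 := if_pos h

theorem normBound_of_nonneg {c d : ℤ} (h : 0 ≤ c * d) : normBound c d = c ^ 2 + d ^ 2 :=
  if_neg h.not_gt

theorem sum_majorant_coneVec_le {a b : ℤ} (ha : 0 < a) (hb : 0 < b) :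
    (∑ i, majorant (coneVec i a b)) + ∑ i, majorant (coneVec i b a) ≤
      13 / 18 * (1 / (a : ℝ) ^ 2 * (1 / (b : ℝ) ^ 2)) := by
  have hab : 0 < a * b := mul_pos ha hb
  have h0' : 0 ≤ b * a := by nlinarith
  have h1 : a * -(a + b) < 0 := by nlinarith
  have h1' : b * -(b + a) < 0 := by nlinarith
  have h2 : (a + b) * -a < 0 := by nlinarith
  have h2' : (b + a) * -b < 0 := by nlinarith
  simp only [Fin.sum_univ_three, coneVec, majorant, Matrix.cons_val, normBound_of_neg h1,
    normBound_of_neg h1', normBound_of_neg h2, normBound_of_neg h2', normBound_of_nonneg hab.le,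
    normBound_of_nonneg h0']
  have ha' : (0 : ℝ) < a := by exact_mod_cast ha
  have hb' : (0 : ℝ) < b := by exact_mod_cast hb
  push_cast
  generalize (a : ℝ) = x at *
  generalize (b : ℝ) = y at *
  have hxy : 0 < x * y := mul_pos ha' hb'
  set Q := x ^ 2 + x * y + y ^ 2 with hQ
  have hQ0 : 0 < Q := by positivity
  rw [show -(x + y) * (x + -(x + y)) = y * (x + y) by ring,
    show -x * (x + y + -x) = -(x * y) by ring,
    show -(y + x) * (y + -(y + x)) = x * (x + y) by ring,
    show -y * (y + x + -y) = -(x * y) by ring, abs_neg, abs_of_pos hxy,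
    abs_of_pos (show 0 < y * (x + y) by positivity), abs_of_pos (show 0 < x * (y + x) by positivity),
    abs_of_pos (show 0 < x * (x + y) by positivity),
    show x ^ 2 + x * -(x + y) + (-(x + y)) ^ 2 = Q by ring,
    show (x + y) ^ 2 + (x + y) * -x + (-x) ^ 2 = Q by ring,
    show y ^ 2 + y * -(y + x) + (-(y + x)) ^ 2 = Q by ring,
    show (y + x) ^ 2 + (y + x) * -y + (-y) ^ 2 = Q by ring, add_comm (y ^ 2)]
  have e1 : y * (x + y) / (x ^ 2 + y ^ 2) ^ 3 + x * (y + x) / (x ^ 2 + y ^ 2) ^ 3 ≤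
      1 / 2 * (1 / x ^ 2 * (1 / y ^ 2)) := by
    rw [← add_div, show 1 / 2 * (1 / x ^ 2 * (1 / y ^ 2)) = 1 / (2 * (x * y) ^ 2) by field_simp]
    calc (y * (x + y) + x * (y + x)) / (x ^ 2 + y ^ 2) ^ 3
        ≤ (2 * (x ^ 2 + y ^ 2)) / (x ^ 2 + y ^ 2) ^ 3 := by
          gcongr
          nlinarith [sq_nonneg (x - y)]
      _ = 2 / (x ^ 2 + y ^ 2) ^ 2 := by field_simp
      _ ≤ 2 / (2 * (x * y)) ^ 2 := by
          gcongr
          nlinarith [sq_nonneg (x - y)]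
      _ = 1 / (2 * (x * y) ^ 2) := by field_simp
  have e2 : y * (x + y) / Q ^ 3 + x * y / Q ^ 3 + x * (x + y) / Q ^ 3 + x * y / Q ^ 3 ≤
      2 / 9 * (1 / x ^ 2 * (1 / y ^ 2)) := by
    rw [← add_div, ← add_div, ← add_div,
      show 2 / 9 * (1 / x ^ 2 * (1 / y ^ 2)) = 2 / (9 * (x * y) ^ 2) by field_simp]
    calc (y * (x + y) + x * y + x * (x + y) + x * y) / Q ^ 3 ≤ (2 * Q) / Q ^ 3 := by
          gcongr
          nlinarith [sq_nonneg (x - y)]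
      _ = 2 / Q ^ 2 := by field_simp
      _ ≤ 2 / (3 * (x * y)) ^ 2 := by
          gcongr
          nlinarith [sq_nonneg (x - y)]
      _ = 2 / (9 * (x * y) ^ 2) := by ring
  linarith

theorem hasSum_mul_self {u : ℕ → ℝ} {A : ℝ} (h0 : 0 ≤ u) (h : HasSum u A) :
    HasSum (fun x : ℕ × ℕ => u x.1 * u x.2) (A * A) :=
  h.mul h (h.summable.mul_of_nonneg h.summable h0 h0)

theorem hasSum_inv_sq_prod : HasSum (fun x : ℕ × ℕ =>
    1 / ((x.1 + 1 : ℤ) : ℝ) ^ 2 * (1 / ((x.2 + 1 : ℤ) : ℝ) ^ 2))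
    (Real.pi ^ 2 / 6 * (Real.pi ^ 2 / 6)) := by
  have h : HasSum (fun n : ℕ => 1 / ((n + 1 : ℤ) : ℝ) ^ 2) (Real.pi ^ 2 / 6) := by
    have := (hasSum_nat_add_iff' 1).2 hasSum_zeta_two
    simpa using this
  have h0 : 0 ≤ fun n : ℕ => 1 / ((n + 1 : ℤ) : ℝ) ^ 2 := fun n => by positivity
  exact hasSum_mul_self h0 h

theorem majorant_nonneg (v : ℤ × ℤ) : 0 ≤ majorant v := by
  refine div_nonneg (abs_nonneg _) (pow_nonneg ?_ _)
  rw [normBound]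
  split_ifs
  · nlinarith [sq_nonneg ((v.1 : ℝ) + v.2), sq_nonneg (v.1 : ℝ), sq_nonneg (v.2 : ℝ)]
  · positivity

theorem tsum_majorant_lt :
    Summable (majorant ∘ signedConeVec) ∧ ∑' x, majorant (signedConeVec x) < 2 := by
  set β : ℕ × ℕ → ℝ := fun x => ∑ i, majorant (coneVec i (x.1 + 1) (x.2 + 1)) with hβ
  have hle : ∀ x : ℕ × ℕ, β x + β x.swap ≤ 13 / 18 *
      (1 / ((x.1 + 1 : ℤ) : ℝ) ^ 2 * (1 / ((x.2 + 1 : ℤ) : ℝ) ^ 2)) := fun x =>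
    sum_majorant_coneVec_le (by omega) (by omega)
  have h0 : ∀ x, 0 ≤ β x := fun x => Finset.sum_nonneg fun i _ => majorant_nonneg _
  have hs := hasSum_inv_sq_prod.mul_left (13 / 18)
  have hβs : Summable β := .of_nonneg_of_le h0
    (fun x => (le_add_of_nonneg_right (h0 _)).trans (hle x)) hs.summable
  have hβs' : Summable (β ∘ Prod.swap) := (Equiv.prodComm ℕ ℕ).summable_iff.2 hβs
  have hβ1 : ∑' x, β x < 1 := by
    have e : ∑' x : ℕ × ℕ, β x.swap = ∑' x, β x := (Equiv.prodComm ℕ ℕ).tsum_eq β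
    have h1 := (hβs.add hβs').tsum_le_tsum hle hs.summable
    rw [hs.tsum_eq] at h1
    have h2 : ∑' x, (β x + (β ∘ Prod.swap) x) = 2 * ∑' x, β x := by
      rw [hβs.tsum_add hβs', two_mul]
      congr 1
    have h3 : Real.pi ^ 2 < 3.15 ^ 2 := by
      gcongr
      exact Real.pi_lt_d2
    have h4 : (0 : ℝ) < Real.pi ^ 2 := by positivity
    have h1' : 2 * ∑' x, β x ≤ 13 / 18 * (Real.pi ^ 2 / 6 * (Real.pi ^ 2 / 6)) := h2 ▸ h1
    nlinarith
  have hs1 : ∀ p : Bool × Fin 3, Summable fun x : ℕ × ℕ => majorant (signedConeVec (p, x)) :=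
    fun p => hβs.of_nonneg_of_le (fun x => majorant_nonneg _) fun x => by
      rw [majorant_signedConeVec]
      exact Finset.single_le_sum (f := fun i => majorant (coneVec i (x.1 + 1) (x.2 + 1)))
        (fun i _ => majorant_nonneg _) (Finset.mem_univ p.2)
  have hsum : Summable (majorant ∘ signedConeVec) :=
    (summable_prod_of_nonneg fun x => majorant_nonneg _).2 ⟨hs1, Summable.of_finite⟩
  refine ⟨hsum, ?_⟩
  have : ∑' x, majorant (signedConeVec x) = 2 * ∑' x, β x := by
    refine (hsum.tsum_prod' hs1).trans ?_
    rw [tsum_fintype, Fintype.sum_prod_type, Fintype.sum_bool]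
    have (s : Bool) : ∑ i, ∑' x : ℕ × ℕ, (majorant ∘ signedConeVec) ((s, i), x) = ∑' x, β x := by
      refine (Summable.tsum_finsetSum fun i _ => hs1 (s, i)).symm.trans ?_
      exact tsum_congr fun x => Finset.sum_congr rfl fun i _ => majorant_signedConeVec ..
    rw [this, this, two_mul]
  linarith

theorem tsum_ne_zero {g : ℤ × ℤ → ℂ} (hg : Summable fun v => ‖g v‖)
    (h0 : ∀ d : ℤ, 0 ≤ (g (0, d)).re) (h1 : 1 ≤ (g (0, 1)).re) (h2 : 1 ≤ (g (0, -1)).re)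
    (hb : ∀ c d : ℤ, c ≠ 0 → ‖g (c, d)‖ ≤ majorant (c, d)) : ∑' v, g v ≠ 0 := by
  intro hz
  classical
  set N : ℤ × ℤ → ℝ := fun v => if v.1 = 0 then 0 else ‖g v‖ with hN
  have hNs : Summable N := hg.of_nonneg_of_le (fun v => by simp only [hN]; positivity)
    fun v => by simp only [hN]; split_ifs <;> simp
  have hre : HasSum (fun v => (g v).re) 0 := by
    have := Complex.hasSum_re hg.of_norm.hasSum
    rwa [hz, Complex.zero_re] at this
  have hGs := hre.add hNs.hasSum
  rw [zero_add] at hGs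
  have hG0 : ∀ v, 0 ≤ (g v).re + N v := by
    rintro ⟨c, d⟩
    simp only [hN]
    split_ifs with hc
    · obtain rfl : c = 0 := hc
      simpa using h0 d
    · linarith [neg_abs_le (g (c, d)).re, Complex.abs_re_le_norm (g (c, d))]
  have hlow : 2 ≤ ∑' v, N v := by
    have := sum_le_hasSum ({(0, 1), (0, -1)} : Finset (ℤ × ℤ)) (fun v _ => hG0 v) hGs
    rw [Finset.sum_pair (by simp)] at this
    simp only [hN, if_true, add_zero] at this
    linarith
  have hsupp : Function.support N ⊆ Set.range signedConeVec := by
    rintro ⟨c, d⟩ h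
    have hc : c ≠ 0 := by
      rintro rfl
      simp [hN] at h
    have hp : majorant (c, d) ≠ 0 := by
      intro hm
      have := hb c d hc
      rw [hm] at this
      simp only [Function.mem_support, hN, if_neg hc] at h
      exact h (le_antisymm this (norm_nonneg _))
    refine mem_range_signedConeVec hc ?_ ?_
    · rintro rfl
      simp [majorant] at hp
    · intro hcd
      have : (c : ℝ) + d = 0 := by exact_mod_cast hcd
      simp [majorant, this] at hp
  have hup : ∑' v, N v ≤ ∑' x, majorant (signedConeVec x) := by
    rw [← signedConeVec_injective.tsum_eq hsupp]
    refine (hNs.comp_injective signedConeVec_injective).tsum_le_tsum (fun x => ?_)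
      tsum_majorant_lt.1
    simp only [hN]
    split_ifs with hc
    · exact majorant_nonneg _
    · exact hb _ _ hc
  linarith [tsum_majorant_lt.2]

end LatticeBound

end

section

open UpperHalfPlane hiding I
open Complex EisensteinSeries Filter Topology

/-- The general term of the `m`-th derivative (up to a constant) of the lattice Eisenstein series. -/
noncomputable def eisTerm (k m : ℕ) (x : Fin 2 → ℤ) (z : ℂ) : ℂ :=
  (x 0 : ℂ) ^ m * ((x 0 * z + x 1) ^ (k + m))⁻¹

theorem norm_eisTerm_le {k : ℕ} (hk : 0 < k) (m : ℕ) (x : Fin 2 → ℤ) (z : ℍ) {ρ : ℝ} (hρ : 0 < ρ)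
    (h : ρ ≤ r z) : ‖eisTerm k m x z‖ ≤ (ρ ^ (k + m))⁻¹ * ‖x‖ ^ (-(k : ℝ)) := by
  by_cases hx : x = 0
  · subst hx
    simp only [eisTerm, Pi.zero_apply, Int.cast_zero, zero_mul, add_zero,
      zero_pow (show k + m ≠ 0 by omega), inv_zero, mul_zero, norm_zero]
    positivity
  have hx0 : 0 < ‖x‖ := norm_pos_iff.2 hx
  have h1 : ρ * ‖x‖ ≤ ‖x 0 * (z : ℂ) + x 1‖ :=
    (mul_le_mul_of_nonneg_right h hx0.le).trans (r_mul_max_le z hx)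
  have h2 : ‖(x 0 : ℂ)‖ ≤ ‖x‖ := by
    have := norm_le_pi_norm x 0
    rwa [Complex.norm_intCast]
  calc ‖eisTerm k m x z‖ = ‖(x 0 : ℂ)‖ ^ m * (‖x 0 * (z : ℂ) + x 1‖ ^ (k + m))⁻¹ := by
        rw [eisTerm, norm_mul, norm_inv, norm_pow, norm_pow]
    _ ≤ ‖x‖ ^ m * ((ρ * ‖x‖) ^ (k + m))⁻¹ := by gcongr
    _ = (ρ ^ (k + m))⁻¹ * ‖x‖ ^ (-(k : ℝ)) := by
        rw [Real.rpow_neg hx0.le, Real.rpow_natCast]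
        field_simp
        ring

theorem summable_eisTerm {k : ℕ} (hk : 3 ≤ k) (m : ℕ) {z : ℂ} (hz : 0 < z.im) :
    Summable fun x => eisTerm k m x z :=
  .of_norm_bounded ((summable_one_div_norm_rpow (by exact_mod_cast hk)).mul_left _)
    fun x => norm_eisTerm_le (by omega) m x ⟨z, hz⟩ (r_pos _) le_rfl

theorem hasDerivAt_eisTerm {k : ℕ} (hk : 0 < k) (m : ℕ) (x : Fin 2 → ℤ) {z : ℂ} (hz : 0 < z.im) :
    HasDerivAt (eisTerm k m x) (-(k + m : ℕ) * eisTerm k (m + 1) x z) z := by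
  by_cases hx : x = 0
  · subst hx
    have e : eisTerm k m 0 = fun _ => 0 := by
      ext w
      simp only [eisTerm, Pi.zero_apply, Int.cast_zero, zero_mul, add_zero,
        zero_pow (show k + m ≠ 0 by omega), inv_zero, mul_zero]
    rw [e]
    simpa [eisTerm] using hasDerivAt_const z (0 : ℂ)
  have hL : (x 0 : ℂ) * z + x 1 ≠ 0 := by
    have := r_mul_max_le ⟨z, hz⟩ hx
    exact norm_pos_iff.1 ((mul_pos (r_pos _) (norm_pos_iff.2 hx)).trans_le this)
  have h := ((((hasDerivAt_id z).const_mul (x 0 : ℂ)).add_const (x 1 : ℂ)).fun_pow (k + m)).fun_inv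
    (pow_ne_zero _ hL)
  refine (h.const_mul ((x 0 : ℂ) ^ m)).congr_deriv ?_
  obtain ⟨n, hn⟩ : ∃ n, k + m = n + 1 := ⟨k + m - 1, by omega⟩
  have hn' : k + (m + 1) = n + 2 := by omega
  simp only [eisTerm, hn, hn', id, mul_one, Nat.add_sub_cancel]
  field_simp
  ring

theorem hasDerivAt_tsum_eisTerm {k : ℕ} (hk : 3 ≤ k) (m : ℕ) {z : ℂ} (hz : 0 < z.im) :
    HasDerivAt (fun z => ∑' x, eisTerm k m x z) (-(k + m : ℕ) * ∑' x, eisTerm k (m + 1) x z) z := by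
  have hB : 0 < z.im / 2 := by positivity
  have him : ∀ w ∈ Metric.ball z (z.im / 2), z.im / 2 ≤ w.im := fun w hw => by
    have h1 := (abs_im_le_norm (w - z)).trans_lt (mem_ball_iff_norm.1 hw)
    rw [sub_im] at h1
    linarith [abs_lt.1 h1]
  have hre : ∀ w ∈ Metric.ball z (z.im / 2), |w.re| ≤ |z.re| + z.im / 2 := fun w hw => by
    have h1 := (abs_re_le_norm (w - z)).trans_lt (mem_ball_iff_norm.1 hw)
    rw [sub_re] at h1
    linarith [abs_sub_abs_le_abs_sub w.re z.re]
  set ρ := r ⟨⟨|z.re| + z.im / 2, z.im / 2⟩, hB⟩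
  have hb : ∀ x : Fin 2 → ℤ, ∀ w ∈ Metric.ball z (z.im / 2),
      ‖-(k + m : ℕ) * eisTerm k (m + 1) x w‖ ≤
        (k + m : ℕ) * ((ρ ^ (k + (m + 1)))⁻¹ * ‖x‖ ^ (-(k : ℝ))) := fun x w hw => by
    rw [norm_mul, norm_neg, Complex.norm_natCast]
    gcongr
    exact norm_eisTerm_le (by omega) (m + 1) x ⟨w, hB.trans_le (him w hw)⟩ (r_pos _)
      (r_lower_bound_on_verticalStrip _ hB ⟨hre w hw, him w hw⟩)
  have hz' : z ∈ Metric.ball z (z.im / 2) := Metric.mem_ball_self hB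
  rw [← tsum_mul_left]
  exact hasDerivAt_tsum_of_isPreconnected
    (((summable_one_div_norm_rpow (by exact_mod_cast hk)).mul_left _).mul_left _)
    Metric.isOpen_ball (convex_ball _ _).isPreconnected
    (fun x w hw => hasDerivAt_eisTerm (by omega) m x (hB.trans_le (him w hw))) hb hz'
    (summable_eisTerm hk m hz) hz'

theorem tsum_eisTerm_zero {k : ℕ} (hk : 3 ≤ k) (hk2 : Even k) {z : ℂ} (hz : 0 < z.im) :
    ∑' x, eisTerm k 0 x z = 2 * riemannZeta k * Ek k z := by
  lift z to ℍ using hz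
  have h := tsum_eisSummand_eq_riemannZeta_mul_eisensteinSeries hk z
  have e : ModularForm.E hk z = (1 / 2 : ℂ) * eisensteinSeriesSIF (N := 1) 0 k z := rfl
  rw [Ek_eq_E hk hk2, e, eisensteinSeriesSIF_apply]
  calc ∑' x, eisTerm k 0 x z = ∑' x, eisSummand k x z :=
        tsum_congr fun x => by simp [eisTerm, eisSummand]
    _ = _ := by rw [h]; ring

theorem iteratedDeriv_Ek_eq_tsum {k : ℕ} (hk : 3 ≤ k) (hk2 : Even k) (j : ℕ) :
    ∃ a : ℂ, a ≠ 0 ∧ ∀ z : ℂ, 0 < z.im → ∑' x, eisTerm k j x z = a * iteratedDeriv j (Ek k) z := by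
  induction j with
  | zero =>
    refine ⟨2 * riemannZeta k, mul_ne_zero two_ne_zero (riemannZeta_ne_zero_of_one_le_re ?_),
      fun z hz => ?_⟩
    · rw [natCast_re]
      exact_mod_cast (by omega : 1 ≤ k)
    · rw [tsum_eisTerm_zero hk hk2 hz, iteratedDeriv_zero]
  | succ j ih =>
    obtain ⟨a, ha, h⟩ := ih
    have hkj : ((k + j : ℕ) : ℂ) ≠ 0 := by exact_mod_cast (by omega : k + j ≠ 0)
    refine ⟨-(a / (k + j : ℕ)), neg_ne_zero.2 (div_ne_zero ha hkj), fun z hz => ?_⟩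
    have h1 := (hasDerivAt_tsum_eisTerm hk j hz).deriv
    have h2 : (fun z => ∑' x, eisTerm k j x z) =ᶠ[𝓝 z] fun z => a * iteratedDeriv j (Ek k) z := by
      filter_upwards [(isOpen_lt continuous_const Complex.continuous_im).mem_nhds hz] with w hw
      exact h w hw
    rw [h2.deriv_eq, deriv_const_mul_field, ← iteratedDeriv_succ] at h1
    field_simp
    rw [h1]
    ring

theorem eisTerm_combination {k : ℕ} (hk : k ≠ 0) (x : Fin 2 → ℤ) (z ε : ℂ) :
    eisTerm k 0 x z + (ε - 2 * z) * eisTerm k 1 x z + -(z * (ε - z)) * eisTerm k 2 x z =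
      x 1 * (ε * x 0 + x 1) * ((x 0 * z + x 1) ^ (k + 2))⁻¹ := by
  simp only [eisTerm]
  by_cases hL : (x 0 : ℂ) * z + x 1 = 0
  · simp [hL, hk]
  · obtain ⟨L, hL'⟩ : ∃ L, L = (x 0 : ℂ) * z + x 1 := ⟨_, rfl⟩
    rw [← hL'] at hL ⊢
    rw [show (x 1 : ℂ) = L - x 0 * z by rw [hL']; ring]
    field_simp
    ring

theorem normBound_le_normSq {z : ℂ} (h1 : 1 ≤ normSq z) {c d : ℤ} {ε : ℝ} (hε : ε ^ 2 = 1)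
    (h0 : 0 ≤ ε * z.re) (h2 : ε * z.re ≤ 1 / 2) :
    LatticeBound.normBound c d ≤ normSq (ε * c * z + d) := by
  have e : normSq (ε * c * z + d) = c ^ 2 * normSq z + 2 * (c * d) * (ε * z.re) + d ^ 2 := by
    rw [normSq_apply, normSq_apply]
    simp
    linear_combination (c ^ 2 * (z.re ^ 2 + z.im ^ 2)) * hε
  rw [e]
  have h3 : (c : ℝ) ^ 2 ≤ c ^ 2 * normSq z := le_mul_of_one_le_right (sq_nonneg _) h1
  rcases lt_or_ge (c * d) 0 with h | h
  · rw [LatticeBound.normBound_of_neg h]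
    have : (c * d : ℝ) < 0 := by exact_mod_cast h
    nlinarith
  · rw [LatticeBound.normBound_of_nonneg h]
    have : (0 : ℝ) ≤ c * d := by exact_mod_cast h
    nlinarith

theorem one_le_normBound {c : ℤ} (hc : c ≠ 0) (d : ℤ) : 1 ≤ LatticeBound.normBound c d := by
  have h1 : 0 < c ^ 2 := by positivity
  rw [LatticeBound.normBound]
  split_ifs
  · have : (1 : ℤ) ≤ c ^ 2 + c * d + d ^ 2 := by nlinarith [sq_nonneg (c + 2 * d)]
    exact_mod_cast this
  · have : (1 : ℤ) ≤ c ^ 2 + d ^ 2 := by nlinarith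
    exact_mod_cast this

theorem exists_iteratedDeriv_Ek_ne_zero_of_mem_fd {k : ℕ} (hk : 4 ≤ k) (hk2 : Even k) {z : ℂ}
    (hz : 0 < z.im) (h1 : 1 ≤ normSq z) (h2 : |z.re| ≤ 1 / 2) :
    ∃ j ≤ 2, iteratedDeriv j (Ek k) z ≠ 0 := by
  by_contra! H
  have hA : ∀ j ≤ 2, HasSum (fun x => eisTerm k j x z) 0 := fun j hj => by
    obtain ⟨a, -, h⟩ := iteratedDeriv_Ek_eq_tsum (by omega) hk2 j
    have := (summable_eisTerm (by omega : 3 ≤ k) j hz).hasSum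
    rwa [h z hz, H j hj, mul_zero] at this
  obtain ⟨ε, hε0, hε2⟩ : ∃ ε : ℤˣ, 0 ≤ ((ε : ℤ) : ℝ) * z.re ∧ ((ε : ℤ) : ℝ) * z.re ≤ 1 / 2 := by
    rcases le_total 0 z.re with h | h
    · exact ⟨1, by simpa using h, by simpa [abs_of_nonneg h] using h2⟩
    · exact ⟨-1, by simpa using h, by simpa [abs_of_nonpos h] using h2⟩
  have hεε : ((ε : ℤ) : ℝ) ^ 2 = 1 := by
    have : (ε : ℤ) ^ 2 = 1 := by rw [← Units.val_pow_eq_pow_val, Int.units_sq, Units.val_one]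
    exact_mod_cast this
  have hεc : ((ε : ℤ) : ℂ) ^ 2 = 1 := by exact_mod_cast hεε
  have hg := ((hA 0 (by omega)).add ((hA 1 (by omega)).mul_left ((ε : ℤ) - 2 * z))).add
    ((hA 2 le_rfl).mul_left (-(z * ((ε : ℤ) - z))))
  let e : ℤ × ℤ ≃ (Fin 2 → ℤ) :=
    ((Units.mulLeft ε).prodCongr (Equiv.refl ℤ)).trans (finTwoArrowEquiv ℤ).symm
  rw [← e.hasSum_iff, mul_zero, mul_zero, add_zero, add_zero] at hg
  set G : ℤ × ℤ → ℂ := fun v => v.2 * (v.1 + v.2) * (((ε : ℤ) * v.1 * z + v.2) ^ (k + 2))⁻¹ with hG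
  have hGe : HasSum G 0 := by
    convert! hg using 1
    ext v
    rw [Function.comp_apply, eisTerm_combination (by omega)]
    simp only [hG, e, Equiv.trans_apply, Equiv.prodCongr_apply, finTwoArrowEquiv_symm_apply,
      Prod.map_fst, Prod.map_snd, Units.mulLeft_apply, Equiv.refl_apply, Matrix.cons_val,
      Int.cast_mul]
    rw [← mul_assoc ((ε : ℤ) : ℂ) ((ε : ℤ) : ℂ), ← sq, hεc, one_mul]
  refine LatticeBound.tsum_ne_zero hGe.summable.norm (fun d => ?_) ?_ ?_ (fun c d hc => ?_)
    hGe.tsum_eq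
  · have : G (0, d) = (((d : ℝ) ^ 2 * ((d : ℝ) ^ (k + 2))⁻¹ : ℝ) : ℂ) := by
      simp [hG, sq]
    rw [this, ofReal_re]
    have : 0 ≤ (d : ℝ) ^ (k + 2) := (hk2.add even_two).pow_nonneg _
    positivity
  · simp [hG]
  · simp [hG, (hk2.add even_two).neg_one_pow]
  · have hN := normBound_le_normSq (c := c) (d := d) h1 hεε hε0 hε2
    have hN1 := one_le_normBound hc d
    rw [normSq_eq_norm_sq] at hN
    simp only [hG, LatticeBound.majorant, norm_mul, norm_inv, norm_pow, abs_mul, div_eq_mul_inv]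
    have h3 : LatticeBound.normBound c d ^ 3 ≤ ‖(ε : ℤ) * (c : ℂ) * z + d‖ ^ (k + 2) := by
      have hL : 1 ≤ ‖(ε : ℤ) * (c : ℂ) * z + d‖ := by
        rw [ofReal_intCast] at hN
        nlinarith [norm_nonneg ((ε : ℤ) * (c : ℂ) * z + d)]
      calc LatticeBound.normBound c d ^ 3 ≤ (‖(ε : ℤ) * (c : ℂ) * z + d‖ ^ 2) ^ 3 := by
            gcongr
            simpa using hN
        _ = ‖(ε : ℤ) * (c : ℂ) * z + d‖ ^ 6 := by rw [← pow_mul]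
        _ ≤ _ := pow_le_pow_right₀ hL (by omega)
    have h4 : ‖(c : ℂ) + d‖ = |(c : ℝ) + d| := by
      rw [← Int.cast_add, Complex.norm_intCast, Int.cast_add]
    rw [h4, Complex.norm_intCast]
    gcongr

end

section

namespace RamanujanD
open MvPolynomial

local notation "QM" => MvPolynomial (Fin 3) ℚ

lemma eval_toPoly_smul {A : Type*} [CommRing A] [Algebra ℚ A] {P : QM} {w : ℕ}
    (h : P.IsWeightedHomogeneous wt w) (s b c x : A) :
    (toPoly (s ^ 2 * b) (s ^ 3 * c) P).eval (s * x) = s ^ w * (toPoly b c P).eval x := by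
  rw [eval_toPoly, eval_toPoly, ← aeval_smul_wt h]
  congr 2
  ext i
  fin_cases i <;> simp [wt]

lemma toPoly_smul_eq_zero_iff {P : QM} {w : ℕ} (h : P.IsWeightedHomogeneous wt w) {s : ℂ}
    (hs : s ≠ 0) (b c : ℂ) : toPoly (s ^ 2 * b) (s ^ 3 * c) P = 0 ↔ toPoly b c P = 0 := by
  constructor <;> intro H <;> refine Polynomial.funext fun x => ?_
  · have := eval_toPoly_smul h s b c x
    rw [H, Polynomial.eval_zero, eq_comm, mul_eq_zero] at this
    simpa using this.resolve_left (pow_ne_zero _ hs)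
  · have := eval_toPoly_smul h s b c (x / s)
    rwa [mul_div_cancel₀ _ hs, H, Polynomial.eval_zero, mul_zero, ← Polynomial.eval_zero] at this

lemma derivative_toPoly_iterate {A : Type*} [CommRing A] [Algebra ℚ A] {P : QM} {w : ℕ}
    (h : P.IsWeightedHomogeneous wt w) (h0 : ramanujanD (pderiv 0 P) = 0) (n : ℕ) (b c : A) :
    (toPoly b c (ramanujanD^[n + 1] P)).derivative =
      Polynomial.C (algebraMap ℚ A ((n + 1) * (2 * w + n) / 12)) *
        toPoly b c (ramanujanD^[n] P) := by
  rw [derivative_toPoly, pderiv_iterate_D h h0, map_mul, toPoly_C]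

lemma derivative_const_ne_zero {w : ℕ} (hw : 1 ≤ w) (n : ℕ) :
    algebraMap ℚ ℂ ((n + 1) * (2 * w + n) / 12) ≠ 0 := by
  rw [map_ne_zero]
  positivity

lemma eval_derivative_toPoly_iterate_eq_zero_iff {P : QM} {w : ℕ} (hw : 1 ≤ w)
    (h : P.IsWeightedHomogeneous wt w) (h0 : ramanujanD (pderiv 0 P) = 0) (n : ℕ) (b c x : ℂ) :
    (toPoly b c (ramanujanD^[n + 1] P)).derivative.eval x = 0 ↔
      (toPoly b c (ramanujanD^[n] P)).eval x = 0 := by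
  rw [derivative_toPoly_iterate h h0, Polynomial.eval_mul, Polynomial.eval_C,
    mul_eq_zero_iff_left (derivative_const_ne_zero hw n)]

lemma toPoly_iterate_eq_zero_of_le {P : QM} {w : ℕ} (hw : 1 ≤ w)
    (h : P.IsWeightedHomogeneous wt w) (h0 : ramanujanD (pderiv 0 P) = 0) {b c : ℂ} {j n : ℕ}
    (hj : j ≤ n) (hn : toPoly b c (ramanujanD^[n] P) = 0) :
    toPoly b c (ramanujanD^[j] P) = 0 := by
  induction n, hj using Nat.le_induction with
  | base => exact hn
  | succ n _ ih =>
    have := derivative_toPoly_iterate h h0 n b c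
    rw [hn, Polynomial.derivative_zero, eq_comm, mul_eq_zero] at this
    exact ih (this.resolve_left (Polynomial.C_ne_zero.mpr (derivative_const_ne_zero hw n)))

lemma isAlgebraic_of_eval_toPoly_eq_zero {Q : QM} {b c x : ℂ} (hb : IsAlgebraic ℚ b)
    (hc : IsAlgebraic ℚ c) (hQ : toPoly b c Q ≠ 0) (hx : (toPoly b c Q).eval x = 0) :
    IsAlgebraic ℚ x := by
  let K := algebraicClosure ℚ ℂ
  let b' : K := ⟨b, mem_algebraicClosure_iff.mpr hb⟩
  let c' : K := ⟨c, mem_algebraicClosure_iff.mpr hc⟩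
  have hm : (toPoly b' c' Q).map (algebraMap K ℂ) = toPoly b c Q :=
    map_toPoly (IntermediateField.val K) b' c' Q
  have hxK : IsAlgebraic K x := by
    refine ⟨toPoly b' c' Q, ?_, ?_⟩
    · rintro h
      rw [h, Polynomial.map_zero] at hm
      exact hQ hm.symm
    · rw [Polynomial.aeval_def, ← Polynomial.eval_map, hm, hx]
  have : Algebra.IsAlgebraic ℚ K := algebraicClosure.isAlgebraic ℚ ℂ
  exact hxK.restrictScalars ℚ

end RamanujanD

end

section

open UpperHalfPlane hiding I
open Complex Filter Topology EisensteinSeries ModularForm MvPolynomial RamanujanD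
open scoped MatrixGroups

lemma Ek_smul {k : ℕ} (hk : 3 ≤ k) (hk2 : Even k) (g : SL(2, ℤ)) (τ : ℍ) :
    Ek k (g • τ : ℍ) = denom g τ ^ k * Ek k τ := by
  rw [Ek_eq_E hk hk2, Ek_eq_E hk hk2]
  have := SlashInvariantForm.slash_action_eqn'' (Γ := 𝒮ℒ) (E hk) (γ := (g : GL (Fin 2) ℝ)) ⟨g, rfl⟩ τ
  rw [zpow_natCast] at this
  exact this

lemma aeval_eisVec (z : ℂ) (Q : MvPolynomial (Fin 3) ℚ) :
    aeval (eisVec z) Q = (toPoly (Ek 4 z) (Ek 6 z) Q).eval (Ek 2 z) := by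
  rw [eval_toPoly, eisVec]

lemma iteratedDeriv_eq_zero_iff {f : ℂ → ℂ} {P : MvPolynomial (Fin 3) ℚ}
    (hf : ∀ z, 0 < z.im → f z = aeval (eisVec z) P) (n : ℕ) {z : ℂ} (hz : 0 < z.im) :
    iteratedDeriv n f z = 0 ↔
      (toPoly (Ek 4 z) (Ek 6 z) (ramanujanD^[n] P)).eval (Ek 2 z) = 0 := by
  rw [iteratedDeriv_aeval_eisVec hf n hz, aeval_eisVec,
    mul_eq_zero_iff_left (pow_ne_zero _ two_pi_I_ne_zero)]

lemma not_forall_toPoly_eq_zero {k : ℕ} (hk : 4 ≤ k) (hk2 : Even k)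
    {P : MvPolynomial (Fin 3) ℚ} (hP : P.IsWeightedHomogeneous wt (k / 2))
    (hf : ∀ z, 0 < z.im → Ek k z = aeval (eisVec z) P) {z : ℂ} (hz : 0 < z.im) :
    ¬ ∀ j ≤ 2, toPoly (Ek 4 z) (Ek 6 z) (ramanujanD^[j] P) = 0 := by
  intro H
  obtain ⟨g, hg⟩ := ModularGroup.exists_smul_mem_fd ⟨z, hz⟩
  obtain ⟨j, hj, hne⟩ := exists_iteratedDeriv_Ek_ne_zero_of_mem_fd hk hk2 (g • (⟨z, hz⟩ : ℍ)).im_pos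
    hg.1 hg.2
  refine hne ((iteratedDeriv_eq_zero_iff hf j (UpperHalfPlane.im_pos _)).mpr ?_)
  have h4 := Ek_smul (k := 4) (by norm_num) (by decide) g ⟨z, hz⟩
  have h6 := Ek_smul (k := 6) (by norm_num) (by decide) g ⟨z, hz⟩
  have hs : denom g (⟨z, hz⟩ : ℍ) ^ 2 ≠ 0 := pow_ne_zero _ (denom_ne_zero _ _)
  have := (toPoly_smul_eq_zero_iff (weight_iterate_D hP j) hs (Ek 4 z) (Ek 6 z)).mpr (H j hj)
  rw [← pow_mul, ← pow_mul] at this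
  rw [h4, h6]
  simp only [Nat.reduceMul] at this
  erw [this]
  simp

lemma Ek_four_cube_ne_Ek_six_sq {z : ℂ} (hz : 0 < z.im) : Ek 4 z ^ 3 ≠ Ek 6 z ^ 2 := by
  have h4 := Ek_eq_E (k := 4) (by norm_num) (by decide) ⟨z, hz⟩
  have h6 := Ek_eq_E (k := 6) (by norm_num) (by decide) ⟨z, hz⟩
  intro h
  apply ModularForm.discriminant_ne_zero ⟨z, hz⟩
  rw [discriminant_eq_E₄_cube_sub_E₆_sq]
  change Ek 4 z = _ at h4
  change Ek 6 z = _ at h6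
  rw [h4, h6] at h
  rw [h, sub_self, zero_div]

lemma eventually_no_double_root_Ek {k : ℕ} (hk : Even k) (hk2 : 2 ≤ k)
    {P : MvPolynomial (Fin 3) ℚ} {w : ℕ} (hw : 1 ≤ w) (hP : P.IsWeightedHomogeneous wt w)
    {ε : ℚ} (h0 : pderiv 0 P = C ε)
    (hf : ∀ z, 0 < z.im → Ek k z = aeval (eisVec z) P) {n : ℕ} (hn : 1 ≤ n) :
    ∀ᶠ τ : ℍ in atImInfty, ∀ x, (toPoly (Ek 4 τ) (Ek 6 τ) (ramanujanD^[n] P)).eval x = 0 →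
      (toPoly (Ek 4 τ) (Ek 6 τ) (ramanujanD^[n] P)).derivative.eval x ≠ 0 := by
  choose h hd hne hder using exists_iteratedDeriv_Ek_eq_nome hk hk2
  have hπ : ∀ j : ℕ, (0 : ℝ) < ‖(2 * Real.pi * I : ℂ) ^ j‖ := fun j =>
    norm_pos_iff.mpr (pow_ne_zero _ two_pi_I_ne_zero)
  have key : ∀ (τ : ℍ) (j : ℕ), ‖(2 * Real.pi * I : ℂ) ^ (j + 1)‖ *
      ‖aeval ![Ek 2 τ, Ek 4 τ, Ek 6 τ] (ramanujanD^[j + 1] P)‖ = ‖nome τ‖ * ‖h j (nome τ)‖ := by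
    intro τ j
    rw [← norm_mul, ← norm_mul, ← hder j τ τ.im_pos, iteratedDeriv_aeval_eisVec hf _ τ.im_pos]
    rfl
  obtain ⟨m, rfl⟩ : ∃ m, n = m + 1 := ⟨n - 1, by omega⟩
  set B : ℝ := ∑ j ∈ Finset.range (m + 1), (‖h j 0‖ + 1) / ‖(2 * Real.pi * I : ℂ) ^ (j + 1)‖
  set β : ℝ := (‖h m 0‖ / 2) / ‖(2 * Real.pi * I : ℂ) ^ (m + 1)‖
  have hm := norm_pos_iff.mpr (hne m)
  have hβ : 0 < β := div_pos (half_pos hm) (hπ _)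
  obtain ⟨δ, hδ, H⟩ := eventually_no_double_root hw hP h0 hn (B := B) hβ
  have e1 : ∀ᶠ τ : ℍ in atImInfty, ‖nome τ‖ < δ := by
    have := tendsto_nome_atImInfty.norm
    rw [norm_zero] at this
    exact this.eventually_lt_const hδ
  have e2 : ∀ᶠ τ : ℍ in atImInfty, 1 / 2 < ‖Ek k τ‖ := by
    have := (tendsto_Ek hk hk2).norm
    rw [norm_one] at this
    exact this.eventually_const_lt (by norm_num)
  have e3 : ∀ᶠ τ : ℍ in atImInfty, ∀ j ∈ Finset.range (m + 1), ‖h j (nome τ)‖ < ‖h j 0‖ + 1 := by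
    rw [Finset.eventually_all]
    exact fun j _ => (tendsto_comp_nome (hd j)).norm.eventually_lt_const (lt_add_one _)
  have e4 : ∀ᶠ τ : ℍ in atImInfty, ‖h m 0‖ / 2 < ‖h m (nome τ)‖ :=
    (tendsto_comp_nome (hd m)).norm.eventually_const_lt (half_lt_self hm)
  filter_upwards [e1, e2, e3, e4] with τ h1 h2 h3 h4
  refine H (Ek 2 τ) (Ek 4 τ) (Ek 6 τ) ‖nome τ‖ (norm_pos_iff.mpr (nome_ne_zero _)) h1 ?_ ?_ ?_
  · rw [hf τ τ.im_pos] at h2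
    exact h2.le
  · intro j hj1 hj
    obtain ⟨i, rfl⟩ : ∃ i, j = i + 1 := ⟨j - 1, by omega⟩
    have hi : i ∈ Finset.range (m + 1) := Finset.mem_range.mpr (by omega)
    have hB : (‖h i 0‖ + 1) / ‖(2 * Real.pi * I : ℂ) ^ (i + 1)‖ ≤ B :=
      Finset.single_le_sum (f := fun j => (‖h j 0‖ + 1) / ‖(2 * Real.pi * I : ℂ) ^ (j + 1)‖)
        (fun j _ => by positivity) hi
    have e : ‖aeval ![Ek 2 τ, Ek 4 τ, Ek 6 τ] (ramanujanD^[i + 1] P)‖ =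
        ‖h i (nome τ)‖ / ‖(2 * Real.pi * I : ℂ) ^ (i + 1)‖ * ‖nome τ‖ := by
      rw [div_mul_eq_mul_div, eq_div_iff (hπ _).ne', mul_comm, key, mul_comm]
    rw [e]
    refine mul_le_mul_of_nonneg_right (le_trans ?_ hB) (norm_nonneg _)
    exact div_le_div_of_nonneg_right (h3 i hi).le (hπ _).le
  · have e : ‖aeval ![Ek 2 τ, Ek 4 τ, Ek 6 τ] (ramanujanD^[m + 1] P)‖ =
        ‖h m (nome τ)‖ / ‖(2 * Real.pi * I : ℂ) ^ (m + 1)‖ * ‖nome τ‖ := by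
      rw [div_mul_eq_mul_div, eq_div_iff (hπ _).ne', mul_comm, key, mul_comm]
    rw [e]
    exact mul_le_mul_of_nonneg_right (div_le_div_of_nonneg_right h4.le (hπ _).le) (norm_nonneg _)

end

section

open UpperHalfPlane hiding I
open Complex Filter Topology MvPolynomial RamanujanD

lemma tendsto_Ek_four_cube_div :
    Tendsto (fun τ : ℍ => Ek 4 τ ^ 3 / Ek 6 τ ^ 2) atImInfty (𝓝[≠] 1) := by
  have h4 := tendsto_Ek (k := 4) (by decide) (by norm_num)
  have h6 := tendsto_Ek (k := 6) (by decide) (by norm_num)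
  refine tendsto_nhdsWithin_iff.mpr ⟨?_, ?_⟩
  · have := (h4.pow 3).div (h6.pow 2) (by norm_num)
    rwa [one_pow, one_pow, div_one] at this
  · filter_upwards [h6.eventually_ne one_ne_zero] with τ hτ h
    rw [Set.mem_singleton_iff, div_eq_one_iff_eq (pow_ne_zero _ hτ)] at h
    exact Ek_four_cube_ne_Ek_six_sq τ.im_pos h

lemma isAlgebraic_of_double_root {k : ℕ} (hk : Even k) (hk2 : 2 ≤ k)
    {P : MvPolynomial (Fin 3) ℚ} {w : ℕ} (hw : 1 ≤ w) (hP : P.IsWeightedHomogeneous wt w)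
    {ε : ℚ} (h0 : pderiv 0 P = C ε)
    (hf : ∀ z, 0 < z.im → Ek k z = aeval (eisVec z) P) {n : ℕ} {t x : ℂ}
    (hx : (toPoly t t (ramanujanD^[n + 1] P)).eval x = 0)
    (hx' : (toPoly t t (ramanujanD^[n] P)).eval x = 0) : IsAlgebraic ℚ t := by
  have h0' : ramanujanD (pderiv 0 P) = 0 := by rw [h0, derivation_C]
  by_contra ht
  have hmap : ∀ s : ℂ, (toPoly Polynomial.X Polynomial.X (ramanujanD^[n + 1] P)).map
      (Polynomial.aeval s : Polynomial ℚ →ₐ[ℚ] ℂ).toRingHom =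
        toPoly s s (ramanujanD^[n + 1] P) := by
    intro s
    have := map_toPoly (Polynomial.aeval s : Polynomial ℚ →ₐ[ℚ] ℂ) Polynomial.X Polynomial.X
      (ramanujanD^[n + 1] P)
    rwa [Polynomial.aeval_X] at this
  refine Polynomial.no_double_root_of_transcendental
    (toPoly Polynomial.X Polynomial.X (ramanujanD^[n + 1] P))
    (l := map (fun τ : ℍ => Ek 4 τ ^ 3 / Ek 6 τ ^ 2) atImInfty) tendsto_Ek_four_cube_div ?_ ht
    (x := x) (by rw [hmap, hx]) ?_
  · rw [eventually_map]
    filter_upwards [eventually_no_double_root_Ek hk hk2 hw hP h0 hf (Nat.le_add_left 1 n),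
      (tendsto_Ek (k := 4) (by decide) (by norm_num)).eventually_ne one_ne_zero,
      (tendsto_Ek (k := 6) (by decide) (by norm_num)).eventually_ne one_ne_zero] with τ H h4 h6 y hy
    rw [hmap] at hy ⊢
    rw [Ne, eval_derivative_toPoly_iterate_eq_zero_iff hw hP h0']
    intro hy'
    set s := Ek 4 τ / Ek 6 τ with hs
    have hs0 : s ≠ 0 := div_ne_zero h4 h6
    have e2 : Ek 4 τ ^ 3 / Ek 6 τ ^ 2 = s ^ 2 * Ek 4 τ := by rw [hs]; field_simp
    have e3 : Ek 4 τ ^ 3 / Ek 6 τ ^ 2 = s ^ 3 * Ek 6 τ := by rw [hs]; field_simp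
    have hroot : ∀ j, (toPoly (Ek 4 τ ^ 3 / Ek 6 τ ^ 2) (Ek 4 τ ^ 3 / Ek 6 τ ^ 2)
        (ramanujanD^[j] P)).eval y = 0 →
        (toPoly (Ek 4 τ) (Ek 6 τ) (ramanujanD^[j] P)).eval (y / s) = 0 := by
      intro j hj
      have := eval_toPoly_smul (weight_iterate_D hP j) s (Ek 4 τ) (Ek 6 τ) (y / s)
      rw [← e2, ← e3, mul_div_cancel₀ _ hs0, hj, eq_comm, mul_eq_zero] at this
      exact this.resolve_left (pow_ne_zero _ hs0)
    exact H _ (hroot _ hy)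
      ((eval_derivative_toPoly_iterate_eq_zero_iff hw hP h0' _ _ _ _).mpr (hroot _ hy'))
  · rw [hmap, eval_derivative_toPoly_iterate_eq_zero_iff hw hP h0', hx']

lemma not_double_zero_of_isAlgebraic {P : MvPolynomial (Fin 3) ℚ} {w : ℕ} (hw : 1 ≤ w)
    (hP : P.IsWeightedHomogeneous wt w) (h0 : ramanujanD (pderiv 0 P) = 0) {z : ℂ}
    (hz : 0 < z.im) (hne : ¬ ∀ j ≤ 2, toPoly (Ek 4 z) (Ek 6 z) (ramanujanD^[j] P) = 0) {n : ℕ}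
    (hn : 2 ≤ n) {s : ℂ} (hs : s ≠ 0) (h4 : IsAlgebraic ℚ (s ^ 2 * Ek 4 z))
    (h6 : IsAlgebraic ℚ (s ^ 3 * Ek 6 z)) :
    (toPoly (Ek 4 z) (Ek 6 z) (ramanujanD^[n] P)).eval (Ek 2 z) ≠ 0 := by
  intro hx
  refine not_isAlgebraic_Ek hz hs ?_ h4 h6
  refine isAlgebraic_of_eval_toPoly_eq_zero (Q := ramanujanD^[n] P) h4 h6 ?_ ?_
  · rw [Ne, toPoly_smul_eq_zero_iff (weight_iterate_D hP n) hs]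
    exact fun H => hne fun j hj => toPoly_iterate_eq_zero_of_le hw hP h0 (hj.trans hn) H
  · rw [eval_toPoly_smul (weight_iterate_D hP n), hx, mul_zero]

lemma not_double_zero {k : ℕ} (hk : Even k) (hk2 : 2 ≤ k)
    {P : MvPolynomial (Fin 3) ℚ} {w : ℕ} (hw : 1 ≤ w) (hP : P.IsWeightedHomogeneous wt w)
    {ε : ℚ} (h0 : pderiv 0 P = C ε)
    (hf : ∀ z, 0 < z.im → Ek k z = aeval (eisVec z) P) {z : ℂ} (hz : 0 < z.im)
    (hne : ¬ ∀ j ≤ 2, toPoly (Ek 4 z) (Ek 6 z) (ramanujanD^[j] P) = 0) {n : ℕ} (hn : 1 ≤ n)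
    (hx : iteratedDeriv n (Ek k) z = 0) : iteratedDeriv (n + 1) (Ek k) z ≠ 0 := by
  have h0' : ramanujanD (pderiv 0 P) = 0 := by rw [h0, derivation_C]
  have hΔ := Ek_four_cube_ne_Ek_six_sq hz
  rw [iteratedDeriv_eq_zero_iff hf _ hz] at hx
  rw [Ne, iteratedDeriv_eq_zero_iff hf _ hz]
  intro hx'
  obtain ⟨s, hs, h4, h6⟩ : ∃ s ≠ 0, IsAlgebraic ℚ (s ^ 2 * Ek 4 z) ∧
      IsAlgebraic ℚ (s ^ 3 * Ek 6 z) := by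
    by_cases h4 : Ek 4 z = 0
    · have h6 : Ek 6 z ≠ 0 := fun h6 => hΔ (by simp [h4, h6])
      refine ⟨(Ek 6 z)⁻¹ ^ ((3 : ℕ)⁻¹ : ℂ), ?_, by simpa [h4] using isAlgebraic_zero, ?_⟩
      · simp [cpow_eq_zero_iff, h6]
      · rw [cpow_nat_inv_pow _ three_ne_zero, inv_mul_cancel₀ h6]
        exact isAlgebraic_one
    by_cases h6 : Ek 6 z = 0
    · refine ⟨(Ek 4 z)⁻¹ ^ ((2 : ℕ)⁻¹ : ℂ), ?_, ?_, by simpa [h6] using isAlgebraic_zero⟩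
      · simp [cpow_eq_zero_iff, h4]
      · rw [cpow_nat_inv_pow _ two_ne_zero, inv_mul_cancel₀ h4]
        exact isAlgebraic_one
    have hs : Ek 4 z / Ek 6 z ≠ 0 := div_ne_zero h4 h6
    have e : (Ek 4 z / Ek 6 z) ^ 3 * Ek 6 z = (Ek 4 z / Ek 6 z) ^ 2 * Ek 4 z := by field_simp
    have hroot : ∀ j, (toPoly (Ek 4 z) (Ek 6 z) (ramanujanD^[j] P)).eval (Ek 2 z) = 0 →
        (toPoly ((Ek 4 z / Ek 6 z) ^ 2 * Ek 4 z) ((Ek 4 z / Ek 6 z) ^ 2 * Ek 4 z)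
        (ramanujanD^[j] P)).eval (Ek 4 z / Ek 6 z * Ek 2 z) = 0 := by
      intro j hj
      have := eval_toPoly_smul (weight_iterate_D hP j) (Ek 4 z / Ek 6 z) (Ek 4 z) (Ek 6 z) (Ek 2 z)
      rwa [e, hj, mul_zero] at this
    have halg := isAlgebraic_of_double_root hk hk2 hw hP h0 hf (hroot _ hx') (hroot _ hx)
    exact ⟨_, hs, halg, e ▸ halg⟩
  exact not_double_zero_of_isAlgebraic hw hP h0' hz hne (by omega) hs h4 h6 hx'

end

theorem stmt16 (k : ℕ) (hke : Even k) (hk2 : 2 ≤ k) (r : ℕ) (hr : 1 ≤ r)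
    (z : ℂ) (hz : 0 < z.im) (h0 : iteratedDeriv r (Ek k) z = 0) :
    iteratedDeriv (r + 1) (Ek k) z ≠ 0 := by
  obtain rfl | hk := hk2.eq_or_lt
  · refine not_double_zero hke hk2 (P := MvPolynomial.X 0) le_rfl (MvPolynomial.isWeightedHomogeneous_X _ _ _)
      (ε := 1) (by simp) (fun z _ => by simp [eisVec]) hz (fun H => ?_) hr h0
    simpa [RamanujanD.toPoly] using H 0 zero_le_two
  · have hk4 : 4 ≤ k := by
      obtain ⟨m, rfl⟩ := hke
      omega
    obtain ⟨P, hP0, hP, hf⟩ := exists_polynomial_Ek hke hk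
    exact not_double_zero hke hk2 (by omega) hP (ε := 0) (by simpa using hP0) hf hz
      (not_forall_toPoly_eq_zero hk4 hke hP hf hz) hr h0
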